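/- Let N ≥ 3, let p ≥ q > 0 with pq > 1, and let a, b > −2. Assume the quadruple (p,q,a,b) is supercritical and 0 ≤ a − b ≤ (N−2)(p−q). If the Lane–Emden system (LE) with the same parameters p, q admits no bounded positive solution (u,v) ∈ C^∞(ℝ^N) × C^∞(ℝ^N) that is stable in every bounded open subset of ℝ^N, then the Hénon–Lane–Emden system (HLE) admits no positive solution (u,v) that is stable outside a compact set and satisfies ∫_{ℝ^N} u(x)^{N/α̃} dx < ∞. -/

import Mathlib

open MeasureTheory Metric Set

noncomputable section

/-- Euclidean space `ℝ^N`. -/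
abbrev Euc (N : ℕ) := EuclideanSpace ℝ (Fin N)

/-- The Laplacian of a function `f : ℝ^N → ℝ`, as the sum of the pure second
partial derivatives. -/
def lap {N : ℕ} (f : Euc N → ℝ) (x : Euc N) : ℝ :=
  ∑ i : Fin N, iteratedFDeriv ℝ 2 f x ![EuclideanSpace.single i 1, EuclideanSpace.single i 1]

/-- `(u, v)` is a solution of the Hénon–Lane–Emden system
`-Δu = |x|^a |v|^{p-1} v`, `-Δv = |x|^b |u|^{q-1} u` on `ℝ^N \ {0}`:
`u, v` are `C²` on `ℝ^N \ {0}`, continuous on `ℝ^N`, and satisfy the equations pointwise. -/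
def IsHLESol {N : ℕ} (p q a b : ℝ) (u v : Euc N → ℝ) : Prop :=
  ContDiffOn ℝ 2 u {x : Euc N | x ≠ 0} ∧ ContDiffOn ℝ 2 v {x : Euc N | x ≠ 0} ∧
  Continuous u ∧ Continuous v ∧
  (∀ x : Euc N, x ≠ 0 → -lap u x = ‖x‖ ^ a * (|v x| ^ (p - 1) * v x)) ∧
  (∀ x : Euc N, x ≠ 0 → -lap v x = ‖x‖ ^ b * (|u x| ^ (q - 1) * u x))

/-- Stability of a (positive) solution of the Hénon–Lane–Emden system on an open set `Ω`:
there exist positive `C²` functions `ξ, ζ` on `Ω` with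
`-Δξ ≥ p |x|^a v^{p-1} ζ` and `-Δζ ≥ q |x|^b u^{q-1} ξ` on `Ω`. -/
def HLEStableOn {N : ℕ} (p q a b : ℝ) (u v : Euc N → ℝ) (Ω : Set (Euc N)) : Prop :=
  ∃ ξ ζ : Euc N → ℝ, ContDiffOn ℝ 2 ξ Ω ∧ ContDiffOn ℝ 2 ζ Ω ∧
    (∀ x ∈ Ω, 0 < ξ x) ∧ (∀ x ∈ Ω, 0 < ζ x) ∧
    (∀ x ∈ Ω, p * ‖x‖ ^ a * v x ^ (p - 1) * ζ x ≤ -lap ξ x) ∧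
    (∀ x ∈ Ω, q * ‖x‖ ^ b * u x ^ (q - 1) * ξ x ≤ -lap ζ x)

/-- Stability outside a compact set `K`: stability on every open set whose closure is
compact and contained in `ℝ^N \ K`. -/
def HLEStableOutside {N : ℕ} (p q a b : ℝ) (u v : Euc N → ℝ) (K : Set (Euc N)) : Prop :=
  IsCompact K ∧
    ∀ Ω : Set (Euc N), IsOpen Ω → IsCompact (closure Ω) → closure Ω ⊆ Kᶜ →
      HLEStableOn p q a b u v Ω

/-- `(u, v)` solves the Lane–Emden system `-Δu = |v|^{p-1} v`, `-Δv = |u|^{q-1} u` on `ℝ^N`. -/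
def IsLESol {N : ℕ} (p q : ℝ) (u v : Euc N → ℝ) : Prop :=
  (∀ x : Euc N, -lap u x = |v x| ^ (p - 1) * v x) ∧
  (∀ x : Euc N, -lap v x = |u x| ^ (q - 1) * u x)

/-- Stability of a (positive) solution of the Lane–Emden system on an open set `Ω`. -/
def LEStableOn {N : ℕ} (p q : ℝ) (u v : Euc N → ℝ) (Ω : Set (Euc N)) : Prop :=
  ∃ ξ ζ : Euc N → ℝ, ContDiffOn ℝ 2 ξ Ω ∧ ContDiffOn ℝ 2 ζ Ω ∧
    (∀ x ∈ Ω, 0 < ξ x) ∧ (∀ x ∈ Ω, 0 < ζ x) ∧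
    (∀ x ∈ Ω, p * v x ^ (p - 1) * ζ x ≤ -lap ξ x) ∧
    (∀ x ∈ Ω, q * u x ^ (q - 1) * ξ x ≤ -lap ζ x)

/-- A function on `ℝ^N` is polynomially bounded. -/
def PolyBounded {N : ℕ} (w : Euc N → ℝ) : Prop :=
  ∃ K L R : ℝ, 0 < K ∧ 0 < L ∧ ∀ x : Euc N, R ≤ ‖x‖ → |w x| ≤ K * ‖x‖ ^ L

/-- The polynomial `G` from Theorem 1.4 (iii). -/
def Gpoly (p q x : ℝ) : ℝ :=
  x ^ 4 - (4 * p * q * (q + 1) / (p + 1)) * x ^ 2 +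
    (2 * p * q * (q + 1) * (p + q + 2) / (p + 1) ^ 2) * x -
    p * q * (q + 1) ^ 2 / (p + 1) ^ 2

/-- The `i`-th partial derivative of `f`. -/
def pd {N : ℕ} (i : Fin N) (f : Euc N → ℝ) (x : Euc N) : ℝ :=
  fderiv ℝ f x (EuclideanSpace.single i 1)

section Calculus

variable {N : ℕ}

lemma contDiffAt_pd {n : ℕ} {f : Euc N → ℝ} {x : Euc N} (hf : ContDiffAt ℝ (n + 1 : ℕ) f x)
    (i : Fin N) : ContDiffAt ℝ n (pd i f) x := by
  have h : ContDiffAt ℝ n (fderiv ℝ f) x := hf.fderiv_right (by norm_cast)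
  exact h.clm_apply contDiffAt_const

lemma lap_eq_sum_pd {f : Euc N → ℝ} {x : Euc N} (hf : ContDiffAt ℝ 2 f x) :
    lap f x = ∑ i, pd i (pd i f) x := by
  unfold lap
  refine Finset.sum_congr rfl fun i _ => ?_
  rw [iteratedFDeriv_two_apply]
  have h : DifferentiableAt ℝ (fderiv ℝ f) x :=
    (hf.fderiv_right (m := 1) (by norm_num)).differentiableAt (by norm_num)
  have := (h.hasFDerivAt.clm_apply
    (hasFDerivAt_const (EuclideanSpace.single i (1 : ℝ) : Euc N) x)).fderiv
  unfold pd
  rw [this]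
  simp

lemma pd_mul {f g : Euc N → ℝ} {x : Euc N} (hf : DifferentiableAt ℝ f x)
    (hg : DifferentiableAt ℝ g x) (i : Fin N) :
    pd i (fun y => f y * g y) x = f x * pd i g x + g x * pd i f x := by
  unfold pd
  rw [fderiv_fun_mul hf hg]
  simp

lemma pd_add {f g : Euc N → ℝ} {x : Euc N} (hf : DifferentiableAt ℝ f x)
    (hg : DifferentiableAt ℝ g x) (i : Fin N) :
    pd i (fun y => f y + g y) x = pd i f x + pd i g x := by
  unfold pd
  rw [fderiv_fun_add hf hg]
  simp

lemma pd_congr {f g : Euc N → ℝ} {x : Euc N} (h : f =ᶠ[nhds x] g) (i : Fin N) :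
    pd i f x = pd i g x := by
  unfold pd
  rw [h.fderiv_eq]

lemma pd_comp {f : Euc N → ℝ} {h : ℝ → ℝ} {x : Euc N} (hh : DifferentiableAt ℝ h (f x))
    (hf : DifferentiableAt ℝ f x) (i : Fin N) :
    pd i (fun y => h (f y)) x = deriv h (f x) * pd i f x := by
  unfold pd
  have := (hh.hasDerivAt.comp_hasFDerivAt x hf.hasFDerivAt).fderiv
  rw [Function.comp_def] at this
  rw [this]; simp

lemma ContDiffAt.eventually_two {f : Euc N → ℝ} {x : Euc N} (hf : ContDiffAt ℝ 2 f x) :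
    ∀ᶠ y in nhds x, ContDiffAt ℝ 2 f y := hf.eventually (by simp)

lemma lap_mul {f g : Euc N → ℝ} {x : Euc N} (hf : ContDiffAt ℝ 2 f x)
    (hg : ContDiffAt ℝ 2 g x) :
    lap (fun y => f y * g y) x =
      f x * lap g x + 2 * ∑ i, pd i f x * pd i g x + g x * lap f x := by
  rw [lap_eq_sum_pd (hf.mul hg), lap_eq_sum_pd hf, lap_eq_sum_pd hg, Finset.mul_sum,
    Finset.mul_sum, Finset.mul_sum, ← Finset.sum_add_distrib, ← Finset.sum_add_distrib]
  refine Finset.sum_congr rfl fun i _ => ?_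
  have hev : pd i (fun y => f y * g y) =ᶠ[nhds x]
      fun y => f y * pd i g y + g y * pd i f y := by
    filter_upwards [hf.eventually_two, hg.eventually_two] with y hy hy'
    exact pd_mul (hy.differentiableAt (by norm_num)) (hy'.differentiableAt (by norm_num)) i
  have hf0 := hf.differentiableAt (by norm_num)
  have hg0 := hg.differentiableAt (by norm_num)
  have hf1 := (contDiffAt_pd (n := 1) hf i).differentiableAt (by norm_num)
  have hg1 := (contDiffAt_pd (n := 1) hg i).differentiableAt (by norm_num)
  rw [pd_congr hev, pd_add (hf0.fun_mul hg1) (hg0.fun_mul hf1), pd_mul hf0 hg1, pd_mul hg0 hf1]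
  ring

lemma lap_comp {f : Euc N → ℝ} {h : ℝ → ℝ} {x : Euc N} (hh : ContDiffAt ℝ 2 h (f x))
    (hf : ContDiffAt ℝ 2 f x) :
    lap (fun y => h (f y)) x =
      deriv h (f x) * lap f x + deriv (deriv h) (f x) * ∑ i, pd i f x ^ 2 := by
  rw [lap_eq_sum_pd (hh.fun_comp x hf), lap_eq_sum_pd hf, Finset.mul_sum, Finset.mul_sum,
    ← Finset.sum_add_distrib]
  refine Finset.sum_congr rfl fun i _ => ?_
  have hev : pd i (fun y => h (f y)) =ᶠ[nhds x] fun y => deriv h (f y) * pd i f y := by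
    have h1 : ∀ᶠ y in nhds x, ContDiffAt ℝ 2 h (f y) :=
      hf.continuousAt.eventually (hh.eventually (by simp))
    filter_upwards [hf.eventually_two, h1] with y hy hy'
    exact pd_comp (hy'.differentiableAt (by norm_num)) (hy.differentiableAt (by norm_num)) i
  have hf0 := hf.differentiableAt (by norm_num)
  have hf1 := (contDiffAt_pd (n := 1) hf i).differentiableAt (by norm_num)
  have hh1 : DifferentiableAt ℝ (deriv h) (f x) := by
    have : ContDiffAt ℝ 1 (fderiv ℝ h) (f x) := hh.fderiv_right (by norm_num)
    have h2 := (this.differentiableAt (by norm_num)).clm_apply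
      (differentiableAt_const (1 : ℝ))
    exact h2
  rw [pd_congr hev, pd_mul (f := fun y => deriv h (f y)) (hh1.comp x hf0) hf1, pd_comp hh1 hf0]
  ring

lemma lap_congr {f g : Euc N → ℝ} {x : Euc N} (h : f =ᶠ[nhds x] g) : lap f x = lap g x := by
  unfold lap
  rw [h.iteratedFDeriv ℝ 2 |>.eq_of_nhds]

lemma pd_norm_sq (i : Fin N) (x : Euc N) : pd i (fun y => ‖y‖ ^ 2) x = 2 * x i := by
  unfold pd
  rw [(hasStrictFDerivAt_norm_sq x).hasFDerivAt.fderiv]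
  simp [EuclideanSpace.inner_single_right]

lemma pd_coord (i : Fin N) (x : Euc N) : pd i (fun y => y i) x = 1 := by
  unfold pd
  have : HasFDerivAt (fun y : Euc N => y i) (EuclideanSpace.proj i : Euc N →L[ℝ] ℝ) x :=
    (EuclideanSpace.proj i : Euc N →L[ℝ] ℝ).hasFDerivAt
  rw [this.fderiv]; simp

lemma pd_const_mul {f : Euc N → ℝ} {x : Euc N} (c : ℝ) (hf : DifferentiableAt ℝ f x)
    (i : Fin N) : pd i (fun y => c * f y) x = c * pd i f x := by
  unfold pd
  rw [fderiv_const_mul hf]; simp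

lemma differentiableAt_coord (i : Fin N) (x : Euc N) :
    DifferentiableAt ℝ (fun y : Euc N => y i) x :=
  (EuclideanSpace.proj i : Euc N →L[ℝ] ℝ).differentiableAt

lemma lap_norm_sq (x : Euc N) : lap (fun y => ‖y‖ ^ 2) x = 2 * N := by
  rw [lap_eq_sum_pd (contDiff_norm_sq ℝ).contDiffAt]
  have : ∀ i : Fin N, pd i (pd i fun y : Euc N => ‖y‖ ^ 2) x = 2 := by
    intro i
    have : pd i (fun y : Euc N => ‖y‖ ^ 2) = fun y => 2 * y i := by
      ext y; exact pd_norm_sq i y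
    rw [this, pd_const_mul _ (differentiableAt_coord i x), pd_coord]; norm_num
  simp [this]; ring

lemma pd_radial {g : ℝ → ℝ} {x : Euc N} (hg : DifferentiableAt ℝ g (‖x‖ ^ 2)) (i : Fin N) :
    pd i (fun y => g (‖y‖ ^ 2)) x = deriv g (‖x‖ ^ 2) * (2 * x i) := by
  rw [pd_comp (f := fun y => ‖y‖ ^ 2) hg
    ((contDiff_norm_sq ℝ (n := 1)).differentiable (by norm_num) x), pd_norm_sq]

lemma sum_coord_sq (x : Euc N) : ∑ i, x i ^ 2 = ‖x‖ ^ 2 := by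
  rw [EuclideanSpace.norm_sq_eq]; simp

lemma lap_radial {g : ℝ → ℝ} {x : Euc N} (hg : ContDiffAt ℝ 2 g (‖x‖ ^ 2)) :
    lap (fun y => g (‖y‖ ^ 2)) x =
      2 * N * deriv g (‖x‖ ^ 2) + 4 * ‖x‖ ^ 2 * deriv (deriv g) (‖x‖ ^ 2) := by
  rw [lap_comp (f := fun y => ‖y‖ ^ 2) hg (contDiff_norm_sq ℝ).contDiffAt, lap_norm_sq]
  simp_rw [pd_norm_sq, mul_pow, ← Finset.mul_sum, sum_coord_sq]
  ring

lemma pd_const_sub (f : Euc N → ℝ) (x y : Euc N) (i : Fin N) :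
    pd i (fun z => f (x - z)) y = - pd i f (x - y) := by
  unfold pd
  by_cases hf : DifferentiableAt ℝ f (x - y)
  · have := (hf.hasFDerivAt.comp y ((hasFDerivAt_id y).const_sub x)).fderiv
    rw [Function.comp_def] at this
    rw [this]; simp
  · have h2 : ¬ DifferentiableAt ℝ (fun z => f (x - z)) y := by
      intro h
      apply hf
      have h3 : DifferentiableAt ℝ (fun z => f (x - z)) (x - (x - y)) := by simpa using h
      have := h3.comp (x - y) ((differentiableAt_id).const_sub x)
      simpa [Function.comp_def] using this
    rw [fderiv_zero_of_not_differentiableAt hf, fderiv_zero_of_not_differentiableAt h2]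
    simp

lemma pd_neg (f : Euc N → ℝ) (y : Euc N) (i : Fin N) :
    pd i (fun z => - f z) y = - pd i f y := by
  unfold pd
  rw [fderiv_fun_neg]; simp

lemma lap_const_sub {f : Euc N → ℝ} {x y : Euc N} (hf : ContDiffAt ℝ 2 f (x - y)) :
    lap (fun z => f (x - z)) y = lap f (x - y) := by
  rw [lap_eq_sum_pd hf, lap_eq_sum_pd (by
    exact ContDiffAt.comp y hf (contDiffAt_const.sub contDiffAt_id))]
  refine Finset.sum_congr rfl fun i _ => ?_
  have : pd i (fun z => f (x - z)) = fun y => - pd i f (x - y) := by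
    ext y; exact pd_const_sub f x y i
  rw [this, pd_neg, pd_const_sub (pd i f)]; ring

lemma pd_sub_const (f : Euc N → ℝ) (x y : Euc N) (i : Fin N) :
    pd i (fun z => f (z - x)) y = pd i f (y - x) := by
  unfold pd
  rw [fderiv_comp_sub]

lemma hasCompactSupport_pd {f : Euc N → ℝ} (hf : HasCompactSupport f) (i : Fin N) :
    HasCompactSupport (pd i f) := by
  have h := hf.fderiv (𝕜 := ℝ)
  refine h.comp_left (g := fun L : Euc N →L[ℝ] ℝ => L (EuclideanSpace.single i 1)) (by simp)

lemma tsupport_pd_subset (f : Euc N → ℝ) (i : Fin N) : tsupport (pd i f) ⊆ tsupport f := by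
  refine (closure_mono ?_).trans (tsupport_fderiv_subset ℝ (f := f))
  intro x hx
  simp only [Function.mem_support, pd] at hx ⊢
  intro h
  exact hx (by simp [h])

lemma continuous_mul_of_tsupport {Ω : Set (Euc N)} (hΩ : IsOpen Ω) {f g : Euc N → ℝ}
    (hf : ContinuousOn f Ω) (hg : Continuous g) (hs : tsupport g ⊆ Ω) :
    Continuous fun x => f x * g x := by
  refine continuous_iff_continuousAt.2 fun x => ?_
  by_cases hx : x ∈ tsupport g
  · exact (hf.continuousAt (hΩ.mem_nhds (hs hx))).mul hg.continuousAt
  · have h0 : g =ᶠ[nhds x] 0 := notMem_tsupport_iff_eventuallyEq.1 hx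
    have : (fun x => f x * g x) =ᶠ[nhds x] fun _ => 0 := by
      filter_upwards [h0] with y hy
      simp [hy]
    exact (continuousAt_const).congr this.symm

lemma integrable_mul_of_tsupport {Ω : Set (Euc N)} (hΩ : IsOpen Ω) {f g : Euc N → ℝ}
    (hf : ContinuousOn f Ω) (hg : Continuous g) (hc : HasCompactSupport g)
    (hs : tsupport g ⊆ Ω) : Integrable fun x => f x * g x :=
  (continuous_mul_of_tsupport hΩ hf hg hs).integrable_of_hasCompactSupport hc.mul_left

lemma continuousOn_pd {Ω : Set (Euc N)} (hΩ : IsOpen Ω) {f : Euc N → ℝ}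
    (hf : ContDiffOn ℝ 1 f Ω) (i : Fin N) : ContinuousOn (pd i f) Ω := fun x hx =>
  (contDiffAt_pd (n := 0) (by simpa using hf.contDiffAt (hΩ.mem_nhds hx)) i).continuousAt
    |>.continuousWithinAt

lemma contDiffOn_pd {Ω : Set (Euc N)} (hΩ : IsOpen Ω) {f : Euc N → ℝ}
    (hf : ContDiffOn ℝ 2 f Ω) (i : Fin N) : ContDiffOn ℝ 1 (pd i f) Ω := fun _ hx =>
  (contDiffAt_pd (n := 1) (by simpa using hf.contDiffAt (hΩ.mem_nhds hx)) i).contDiffWithinAt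

lemma contDiff_pd {f : Euc N → ℝ} (hf : ContDiff ℝ 2 f) (i : Fin N) :
    ContDiff ℝ 1 (pd i f) := contDiff_iff_contDiffAt.2 fun _ =>
  contDiffAt_pd (n := 1) hf.contDiffAt i

lemma integral_mul_pd {Ω : Set (Euc N)} (hΩ : IsOpen Ω) {f g : Euc N → ℝ}
    (hf : ContDiffOn ℝ 1 f Ω) (hg : ContDiff ℝ 1 g) (hc : HasCompactSupport g)
    (hs : tsupport g ⊆ Ω) (i : Fin N) :
    ∫ x, f x * pd i g x = - ∫ x, pd i f x * g x := by
  have hg' : Continuous (pd i g) :=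
    continuousOn_univ.1 (continuousOn_pd isOpen_univ hg.contDiffOn i)
  refine integral_mul_fderiv_eq_neg_fderiv_mul_of_integrable ?_ ?_ ?_ ?_ ?_
  · exact integrable_mul_of_tsupport hΩ (continuousOn_pd hΩ hf i) hg.continuous hc hs
  · exact integrable_mul_of_tsupport hΩ hf.continuousOn hg'
      (hasCompactSupport_pd hc i) ((tsupport_pd_subset g i).trans hs)
  · exact integrable_mul_of_tsupport hΩ hf.continuousOn hg.continuous hc hs
  · exact fun x hx => (hf.contDiffAt (hΩ.mem_nhds (hs hx))).differentiableAt (by norm_num)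
  · exact fun x _ => hg.differentiable (by norm_num) x

lemma continuousOn_lap {Ω : Set (Euc N)} (hΩ : IsOpen Ω) {f : Euc N → ℝ}
    (hf : ContDiffOn ℝ 2 f Ω) : ContinuousOn (lap f) Ω := by
  have : ContinuousOn (fun x => ∑ i, pd i (pd i f) x) Ω :=
    continuousOn_finsetSum _ fun i _ => continuousOn_pd hΩ (contDiffOn_pd hΩ hf i) i
  exact this.congr fun x hx => lap_eq_sum_pd (hf.contDiffAt (hΩ.mem_nhds hx))

lemma lap_eq_zero_of_notMem_tsupport {f : Euc N → ℝ} {x : Euc N} (hx : x ∉ tsupport f) :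
    lap f x = 0 := by
  have h0 : f =ᶠ[nhds x] fun _ => 0 := notMem_tsupport_iff_eventuallyEq.1 hx
  rw [lap_congr h0]
  unfold lap
  refine Finset.sum_eq_zero fun i _ => ?_
  rw [iteratedFDeriv_two_apply]; simp

lemma tsupport_lap_subset (f : Euc N → ℝ) : tsupport (lap f) ⊆ tsupport f := by
  refine closure_minimal ?_ (isClosed_tsupport f)
  intro x hx
  by_contra h
  exact hx (lap_eq_zero_of_notMem_tsupport h)

lemma hasCompactSupport_lap {f : Euc N → ℝ} (hf : HasCompactSupport f) :
    HasCompactSupport (lap f) :=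
  hf.of_isClosed_subset (isClosed_tsupport _) (tsupport_lap_subset f)

/-- Green's identity against a compactly supported function. -/
lemma integral_mul_lap {Ω : Set (Euc N)} (hΩ : IsOpen Ω) {f g : Euc N → ℝ}
    (hf : ContDiffOn ℝ 2 f Ω) (hg : ContDiff ℝ 2 g) (hc : HasCompactSupport g)
    (hs : tsupport g ⊆ Ω) :
    ∫ x, f x * lap g x = ∫ x, lap f x * g x := by
  have hf1 : ContDiffOn ℝ 1 f Ω := hf.of_le (by norm_num)
  have e1 : ∀ x, f x * lap g x = ∑ i, f x * pd i (pd i g) x := fun x => by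
    rw [lap_eq_sum_pd hg.contDiffAt, Finset.mul_sum]
  have e2 : ∀ x, lap f x * g x = ∑ i, pd i (pd i f) x * g x := fun x => by
    by_cases hx : x ∈ tsupport g
    · rw [lap_eq_sum_pd (hf.contDiffAt (hΩ.mem_nhds (hs hx))), Finset.sum_mul]
    · simp [image_eq_zero_of_notMem_tsupport hx]
  simp_rw [e1, e2]
  have hg1 : ∀ i, ContDiff ℝ 1 (pd i g) := contDiff_pd hg
  have hsi : ∀ i, tsupport (pd i g) ⊆ Ω := fun i => (tsupport_pd_subset g i).trans hs
  rw [integral_finsetSum, integral_finsetSum]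
  · refine Finset.sum_congr rfl fun i _ => ?_
    rw [integral_mul_pd hΩ hf1 (hg1 i) (hasCompactSupport_pd hc i) (hsi i),
      integral_mul_pd hΩ (contDiffOn_pd hΩ hf i) (hg.of_le (by norm_num)) hc hs i |> neg_eq_iff_eq_neg.2 |>.symm]
  · intro i _
    exact integrable_mul_of_tsupport hΩ (continuousOn_pd hΩ (contDiffOn_pd hΩ hf i) i)
      hg.continuous hc hs
  · intro i _
    have : Continuous (pd i (pd i g)) :=
      continuousOn_univ.1 (continuousOn_pd isOpen_univ (hg1 i).contDiffOn i)
    exact integrable_mul_of_tsupport hΩ hf.continuousOn this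
      (hasCompactSupport_pd (hasCompactSupport_pd hc i) i)
      ((tsupport_pd_subset _ i).trans (hsi i))

end Calculus

section Kernel

open Filter Topology

/-- The regularized (unnormalized) Newton kernel `(|z|² + t)^{-(N-2)/2}`. -/
def gam (N : ℕ) (t : ℝ) (z : Euc N) : ℝ := (‖z‖ ^ 2 + t) ^ (-(((N : ℝ) - 2) / 2))

/-- Minus the Laplacian of `gam N t`. -/
def del (N : ℕ) (t : ℝ) (z : Euc N) : ℝ :=
  N * (N - 2) * t * (‖z‖ ^ 2 + t) ^ (-(((N : ℝ) + 2) / 2))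

/-- The total mass of `del N t`. -/
def kap (N : ℕ) : ℝ := ∫ z, del N 1 z

variable {N : ℕ}

lemma norm_sq_add_pos {t : ℝ} (ht : 0 < t) (z : Euc N) : 0 < ‖z‖ ^ 2 + t := by positivity

lemma gam_nonneg {t : ℝ} (ht : 0 ≤ t) (z : Euc N) : 0 ≤ gam N t z :=
  Real.rpow_nonneg (by positivity) _

lemma gam_neg (t : ℝ) (z : Euc N) : gam N t (-z) = gam N t z := by simp [gam]

lemma del_nonneg (hN : 3 ≤ N) {t : ℝ} (ht : 0 ≤ t) (z : Euc N) : 0 ≤ del N t z := by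
  have : (3 : ℝ) ≤ N := by exact_mod_cast hN
  have h2 : (0 : ℝ) ≤ N - 2 := by linarith
  unfold del
  positivity

lemma contDiffAt_rpow_add {t s c : ℝ} (h : 0 < s + t) {n : WithTop ℕ∞} :
    ContDiffAt ℝ n (fun s => (s + t) ^ c) s :=
  (contDiffAt_id.add contDiffAt_const).rpow_const_of_ne h.ne'

lemma contDiff_gam {t : ℝ} (ht : 0 < t) {n : WithTop ℕ∞} : ContDiff ℝ n (gam N t) :=
  contDiff_iff_contDiffAt.2 fun z =>
    (ContDiffAt.add (contDiff_norm_sq ℝ).contDiffAt contDiffAt_const).rpow_const_of_ne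
      (norm_sq_add_pos ht z).ne'

lemma deriv_rpow_add {t s c : ℝ} (h : 0 < s + t) :
    deriv (fun s => (s + t) ^ c) s = c * (s + t) ^ (c - 1) := by
  have := (((hasDerivAt_id s).add_const t).rpow_const (p := c) (Or.inl h.ne')).deriv
  simpa using this

lemma deriv_deriv_rpow_add {t s c : ℝ} (h : 0 < s + t) :
    deriv (deriv (fun s => (s + t) ^ c)) s = c * (c - 1) * (s + t) ^ (c - 2) := by
  have hev : deriv (fun s => (s + t) ^ c) =ᶠ[𝓝 s] fun s => c * (s + t) ^ (c - 1) := by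
    have : ∀ᶠ r in 𝓝 s, 0 < r + t :=
      (continuous_id.add continuous_const).continuousAt.eventually (lt_mem_nhds h)
    filter_upwards [this] with r hr
    exact deriv_rpow_add hr
  rw [hev.deriv_eq, deriv_const_mul _ ((contDiffAt_rpow_add h (n := 1)).differentiableAt
    (by norm_num)), deriv_rpow_add h]
  ring_nf

lemma pd_gam {t : ℝ} {z : Euc N} (h : 0 < ‖z‖ ^ 2 + t) (i : Fin N) :
    pd i (gam N t) z = -(N - 2) * z i * (‖z‖ ^ 2 + t) ^ (-((N : ℝ) / 2)) := by
  have := pd_radial (g := fun s => (s + t) ^ (-(((N : ℝ) - 2) / 2)))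
    ((contDiffAt_rpow_add h (n := 1)).differentiableAt (by norm_num)) i
  unfold gam
  rw [this, deriv_rpow_add h, show -(((N : ℝ) - 2) / 2) - 1 = -((N : ℝ) / 2) by ring]
  ring

lemma lap_gam {t : ℝ} {z : Euc N} (h : 0 < ‖z‖ ^ 2 + t) :
    lap (gam N t) z = - del N t z := by
  have := lap_radial (g := fun s => (s + t) ^ (-(((N : ℝ) - 2) / 2))) (x := z)
    (contDiffAt_rpow_add h)
  unfold gam
  rw [this, deriv_rpow_add h, deriv_deriv_rpow_add h, del,
    show -(((N : ℝ) - 2) / 2) - 1 = -(((N : ℝ) + 2) / 2) + 1 by ring,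
    show -(((N : ℝ) - 2) / 2) - 2 = -(((N : ℝ) + 2) / 2) by ring,
    Real.rpow_add h, Real.rpow_one]
  ring

lemma gam_anti {s t : ℝ} (hN : 3 ≤ N) {z : Euc N} (hs : 0 < ‖z‖ ^ 2 + s) (hst : s ≤ t) :
    gam N t z ≤ gam N s z := by
  have : (3 : ℝ) ≤ N := by exact_mod_cast hN
  exact Real.rpow_le_rpow_of_nonpos hs (by linarith) (by linarith)

lemma gam_zero {z : Euc N} : gam N 0 z = ‖z‖ ^ (-((N : ℝ) - 2)) := by
  unfold gam
  rw [add_zero, ← Real.rpow_natCast, ← Real.rpow_mul (norm_nonneg _)]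
  congr 1; push_cast; ring

lemma gam_le {t r : ℝ} (hN : 3 ≤ N) {z : Euc N} (hr : 0 < r) (ht : 0 ≤ t) (h : r ≤ ‖z‖) :
    gam N t z ≤ r ^ (-((N : ℝ) - 2)) := by
  have : (3 : ℝ) ≤ N := by exact_mod_cast hN
  have hz : 0 < ‖z‖ := hr.trans_le h
  refine (gam_anti hN (s := 0) (by positivity) ht).trans ?_
  rw [gam_zero]
  exact Real.rpow_le_rpow_of_nonpos hr h (by linarith)

lemma le_gam_zero {r : ℝ} (hN : 3 ≤ N) {z : Euc N} (hz : z ≠ 0) (h : ‖z‖ ≤ r) :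
    r ^ (-((N : ℝ) - 2)) ≤ gam N 0 z := by
  have : (3 : ℝ) ≤ N := by exact_mod_cast hN
  rw [gam_zero]
  exact Real.rpow_le_rpow_of_nonpos (norm_pos_iff.2 hz) h (by linarith)

lemma abs_coord_le (z : Euc N) (i : Fin N) : |z i| ≤ ‖z‖ := by
  simpa using EuclideanSpace.norm_eq z ▸ PiLp.norm_apply_le z i

lemma abs_pd_gam_le {t r : ℝ} (hN : 3 ≤ N) {z : Euc N} (hr : 0 < r) (ht : 0 ≤ t)
    (h : r ≤ ‖z‖) (i : Fin N) : |pd i (gam N t) z| ≤ (N - 2) * r ^ (-((N : ℝ) - 1)) := by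
  have h3 : (3 : ℝ) ≤ N := by exact_mod_cast hN
  have hz : 0 < ‖z‖ := hr.trans_le h
  have h0 : 0 < ‖z‖ ^ 2 + t := by positivity
  rw [pd_gam h0, abs_mul, abs_mul, abs_neg, abs_of_nonneg (by linarith : (0 : ℝ) ≤ N - 2),
    abs_of_nonneg (Real.rpow_nonneg h0.le _), mul_assoc]
  refine mul_le_mul_of_nonneg_left ?_ (by linarith)
  calc |z i| * (‖z‖ ^ 2 + t) ^ (-((N : ℝ) / 2))
      ≤ ‖z‖ * (‖z‖ ^ 2) ^ (-((N : ℝ) / 2)) := by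
        refine mul_le_mul (abs_coord_le z i) ?_ (Real.rpow_nonneg h0.le _) hz.le
        exact Real.rpow_le_rpow_of_nonpos (by positivity) (by linarith) (by linarith)
    _ = ‖z‖ ^ (-((N : ℝ) - 1)) := by
        rw [← Real.rpow_natCast, ← Real.rpow_mul hz.le]
        nth_rewrite 1 [← Real.rpow_one ‖z‖]
        rw [← Real.rpow_add hz]; congr 1; push_cast; ring
    _ ≤ r ^ (-((N : ℝ) - 1)) := Real.rpow_le_rpow_of_nonpos hr h (by linarith)

lemma measurable_gam (t : ℝ) : Measurable (gam N t) := by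
  unfold gam; fun_prop

lemma continuous_del {t : ℝ} (ht : 0 < t) : Continuous (del N t) := by
  unfold del
  refine continuous_const.mul (Continuous.rpow_const (by fun_prop) fun z => ?_)
  exact Or.inl (norm_sq_add_pos ht z).ne'

lemma tendsto_gam {z : Euc N} (hz : z ≠ 0) : Tendsto (fun t => gam N t z) (𝓝 0) (𝓝 (gam N 0 z)) := by
  have hz := norm_pos_iff.2 hz
  have : ContinuousAt (fun t => gam N t z) 0 := by
    unfold gam
    refine ContinuousAt.rpow_const (by fun_prop) (Or.inl ?_)
    positivity
  exact this

lemma integrable_del : Integrable (del N 1) := by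
  unfold del
  have := integrable_rpow_neg_one_add_norm_sq (E := Euc N) (μ := volume) (r := N + 2)
    (by simp)
  refine ((this.const_mul (N * (N - 2) * 1))).congr ?_
  filter_upwards with z
  rw [add_comm (1 : ℝ), neg_div]

lemma kap_pos (hN : 3 ≤ N) : 0 < kap N := by
  have h3 : (3 : ℝ) ≤ N := by exact_mod_cast hN
  refine (integral_pos_iff_support_of_nonneg (del_nonneg hN zero_le_one) integrable_del).2 ?_
  have : Function.support (del N 1) = univ := by
    ext z
    simp only [Function.mem_support, mem_univ, iff_true]
    unfold del
    have : (0 : ℝ) < N - 2 := by linarith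
    have : (0 : ℝ) < N := by linarith
    positivity
  rw [this]
  have : Nonempty (Fin N) := ⟨⟨0, by omega⟩⟩
  exact isOpen_univ.measure_pos _ univ_nonempty

/-- A sequence of regularization parameters tending to `0`. -/
def eps (n : ℕ) : ℝ := (1 / ((n : ℝ) + 1)) ^ 2

lemma eps_pos (n : ℕ) : 0 < eps n := by unfold eps; positivity

lemma eps_anti {m n : ℕ} (h : m ≤ n) : eps n ≤ eps m := by
  unfold eps
  have : (m : ℝ) ≤ n := by exact_mod_cast h
  gcongr

lemma tendsto_eps : Tendsto eps atTop (𝓝 0) := by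
  have := (tendsto_one_div_add_atTop_nhds_zero_nat (𝕜 := ℝ)).pow 2
  rw [zero_pow (by norm_num)] at this
  exact this

lemma del_scale {e : ℝ} (he : 0 < e) (z : Euc N) :
    del N (e ^ 2) (e • z) = (e ^ N)⁻¹ * del N 1 z := by
  have h1 : ‖e • z‖ ^ 2 + e ^ 2 = e ^ 2 * (‖z‖ ^ 2 + 1) := by
    rw [norm_smul, Real.norm_of_nonneg he.le]; ring
  unfold del
  rw [h1, Real.mul_rpow (by positivity) (by positivity), ← Real.rpow_natCast e 2,
    ← Real.rpow_mul he.le]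
  have : e ^ ((2 : ℕ) : ℝ) * e ^ (((2 : ℕ) : ℝ) * -(((N : ℝ) + 2) / 2)) = (e ^ N)⁻¹ := by
    rw [← Real.rpow_add he, ← Real.rpow_natCast, ← Real.rpow_neg he.le]
    congr 1; push_cast; ring
  rw [← this]; ring

lemma tendsto_integral_del_mul {f : Euc N → ℝ} (hf : Continuous f) {M : ℝ}
    (hM : ∀ x, |f x| ≤ M) (x : Euc N) :
    Tendsto (fun n => ∫ y, del N (eps n) (x - y) * f y) atTop (𝓝 (kap N * f x)) := by
  have key : ∀ n : ℕ, ∫ y, del N (eps n) (x - y) * f y =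
      ∫ z, del N 1 z * f (x - (1 / ((n : ℝ) + 1)) • z) := by
    intro n
    have he : 0 < 1 / ((n : ℝ) + 1) := by positivity
    set e := 1 / ((n : ℝ) + 1)
    have h1 := integral_sub_left_eq_self (fun z => del N (eps n) z * f (x - z)) volume x
    have h2 := Measure.integral_comp_smul volume (fun z => del N (eps n) z * f (x - z)) e
    simp only [sub_sub_cancel] at h1
    rw [h1]
    simp only [eps] at h2 ⊢
    simp_rw [show (1 / ((n : ℝ) + 1)) = e from rfl, del_scale he, mul_assoc] at h2 ⊢
    rw [integral_const_mul] at h2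
    rw [finrank_euclideanSpace, Fintype.card_fin, abs_of_pos (by positivity), smul_eq_mul] at h2
    exact (mul_left_cancel₀ (by positivity) h2).symm
  simp_rw [key]
  have : kap N * f x = ∫ z, del N 1 z * f x := by rw [integral_mul_const, kap]
  rw [this]
  refine tendsto_integral_of_dominated_convergence (fun z => |del N 1 z| * M) ?_ ?_ ?_ ?_
  · intro n
    exact ((continuous_del one_pos).mul (hf.comp (by fun_prop))).aestronglyMeasurable
  · exact integrable_del.abs.mul_const M
  · intro n
    filter_upwards with z
    rw [norm_mul, Real.norm_eq_abs, Real.norm_eq_abs]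
    exact mul_le_mul_of_nonneg_left (hM _) (abs_nonneg _)
  · filter_upwards with z
    refine Tendsto.const_mul _ ?_
    have h0 : Tendsto (fun n : ℕ => x - (1 / ((n : ℝ) + 1)) • z) atTop (𝓝 (x - (0 : ℝ) • z)) :=
      tendsto_const_nhds.sub (tendsto_one_div_add_atTop_nhds_zero_nat.smul_const z)
    rw [zero_smul, sub_zero] at h0
    exact (hf.tendsto x).comp h0

end Kernel

section Cutoff

open Filter Topology

/-- A smooth monotone step, `0` for `s ≤ 1/2` and `1` for `s ≥ 1`. -/
def sg (s : ℝ) : ℝ := Real.smoothTransition (2 * s - 1)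

/-- The radial step: `0` for `|y| ≤ r/2`, `1` for `|y| ≥ r`. -/
def cut {N : ℕ} (r : ℝ) (y : Euc N) : ℝ := sg (r⁻¹ ^ 2 * ‖y‖ ^ 2)

lemma contDiff_sg {n : ℕ∞} : ContDiff ℝ n sg :=
  Real.smoothTransition.contDiff.comp (by fun_prop)

lemma sg_nonneg (s : ℝ) : 0 ≤ sg s := Real.smoothTransition.nonneg _
lemma sg_le_one (s : ℝ) : sg s ≤ 1 := Real.smoothTransition.le_one _
lemma sg_zero {s : ℝ} (h : s ≤ 1 / 2) : sg s = 0 :=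
  Real.smoothTransition.zero_of_nonpos (by linarith)
lemma sg_one {s : ℝ} (h : 1 ≤ s) : sg s = 1 :=
  Real.smoothTransition.one_of_one_le (by linarith)
lemma sg_mono : Monotone sg := fun _ _ h =>
  Real.smoothTransition.monotone (by linarith)

lemma sg_eventually {s : ℝ} (h : s < 1 / 2 ∨ 1 < s) : ∃ c, sg =ᶠ[𝓝 s] fun _ => c := by
  rcases h with h | h
  · refine ⟨0, ?_⟩
    filter_upwards [gt_mem_nhds h] with r hr using sg_zero hr.le
  · refine ⟨1, ?_⟩
    filter_upwards [lt_mem_nhds h] with r hr using sg_one hr.le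

lemma deriv_sg_eq_zero {s : ℝ} (h : s < 1 / 2 ∨ 1 < s) : deriv sg s = 0 := by
  obtain ⟨c, hc⟩ := sg_eventually h
  rw [hc.deriv_eq]; simp

lemma deriv2_sg_eq_zero {s : ℝ} (h : s < 1 / 2 ∨ 1 < s) : deriv (deriv sg) s = 0 := by
  obtain ⟨c, hc⟩ := sg_eventually h
  rw [hc.deriv.deriv_eq]; simp

lemma continuous_deriv_sg : Continuous (deriv sg) :=
  (contDiff_sg (n := 1)).continuous_deriv (by norm_num)

lemma continuous_deriv2_sg : Continuous (deriv (deriv sg)) := by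
  have : ContDiff ℝ 1 (deriv sg) := ((contDiff_succ_iff_deriv (n := 1)).1
    (by simpa [one_add_one_eq_two] using contDiff_sg (n := 2))).2.2
  exact this.continuous_deriv (by norm_num)

lemma exists_bound_sg : ∃ C : ℝ, 0 < C ∧ ∀ s, |deriv sg s| ≤ C ∧ |deriv (deriv sg) s| ≤ C := by
  obtain ⟨C1, h1⟩ := (isCompact_Icc (a := (1 / 2 : ℝ)) (b := 1)).exists_bound_of_continuousOn
    continuous_deriv_sg.continuousOn
  obtain ⟨C2, h2⟩ := (isCompact_Icc (a := (1 / 2 : ℝ)) (b := 1)).exists_bound_of_continuousOn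
    continuous_deriv2_sg.continuousOn
  refine ⟨max 1 (max C1 C2), by positivity, fun s => ?_⟩
  by_cases h : s < 1 / 2 ∨ 1 < s
  · rw [deriv_sg_eq_zero h, deriv2_sg_eq_zero h]; simp
  · have hs : s ∈ Icc (1 / 2 : ℝ) 1 := by
      constructor <;> by_contra! h' <;> exact h (by tauto)
    exact ⟨(h1 s hs).trans (by simp), (h2 s hs).trans (by simp)⟩

variable {N : ℕ}

lemma cut_nonneg (r : ℝ) (y : Euc N) : 0 ≤ cut r y := sg_nonneg _
lemma cut_le_one (r : ℝ) (y : Euc N) : cut r y ≤ 1 := sg_le_one _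

lemma contDiff_cut (r : ℝ) {n : ℕ∞} : ContDiff ℝ n (cut r : Euc N → ℝ) :=
  contDiff_sg.comp (contDiff_const.mul (contDiff_norm_sq ℝ))

lemma cut_eq_zero {r : ℝ} (hr : 0 < r) {y : Euc N} (h : ‖y‖ ≤ r / 2) : cut r y = 0 := by
  apply sg_zero
  have : r⁻¹ * ‖y‖ ≤ 1 / 2 := by
    rw [inv_mul_le_iff₀ hr]; linarith
  rw [← mul_pow]
  have : 0 ≤ r⁻¹ * ‖y‖ := by positivity
  nlinarith

lemma cut_eq_one {r : ℝ} (hr : 0 < r) {y : Euc N} (h : r ≤ ‖y‖) : cut r y = 1 := by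
  apply sg_one
  have : 1 ≤ r⁻¹ * ‖y‖ := by
    rw [le_inv_mul_iff₀ hr]; linarith
  rw [← mul_pow]
  nlinarith

lemma cut_anti {r s : ℝ} (hr : 0 < r) (h : r ≤ s) (y : Euc N) : cut s y ≤ cut r y := by
  have hs : 0 < s := hr.trans_le h
  apply sg_mono
  gcongr

lemma pd_cut (r : ℝ) (y : Euc N) (i : Fin N) :
    pd i (cut r) y = deriv sg (r⁻¹ ^ 2 * ‖y‖ ^ 2) * (r⁻¹ ^ 2 * (2 * y i)) := by
  have h2 : DifferentiableAt ℝ (fun y : Euc N => ‖y‖ ^ 2) y :=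
    (contDiff_norm_sq ℝ (n := 1)).differentiable (by norm_num) y
  have := pd_comp (h := sg) (f := fun y : Euc N => r⁻¹ ^ 2 * ‖y‖ ^ 2) (x := y)
    ((contDiff_sg (n := 1)).differentiable (by norm_num) _) (h2.const_mul _) i
  rw [pd_const_mul _ h2, pd_norm_sq] at this
  exact this

lemma lap_cut (r : ℝ) (y : Euc N) :
    lap (cut r) y = 2 * N * r⁻¹ ^ 2 * deriv sg (r⁻¹ ^ 2 * ‖y‖ ^ 2) +
      4 * r⁻¹ ^ 2 * (r⁻¹ ^ 2 * ‖y‖ ^ 2) * deriv (deriv sg) (r⁻¹ ^ 2 * ‖y‖ ^ 2) := by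
  have h2 : ContDiff ℝ 2 (fun y : Euc N => r⁻¹ ^ 2 * ‖y‖ ^ 2) :=
    contDiff_const.mul (contDiff_norm_sq ℝ)
  have h3 : ContDiff ℝ 2 (fun y : Euc N => ‖y‖ ^ 2) := contDiff_norm_sq ℝ
  have := lap_comp (h := sg) (f := fun y : Euc N => r⁻¹ ^ 2 * ‖y‖ ^ 2) (x := y)
    (contDiff_sg (n := 2)).contDiffAt h2.contDiffAt
  have hl : lap (fun y : Euc N => r⁻¹ ^ 2 * ‖y‖ ^ 2) y = r⁻¹ ^ 2 * (2 * N) := by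
    rw [lap_mul (f := fun _ => r⁻¹ ^ 2) contDiffAt_const h3.contDiffAt, lap_norm_sq]
    have h4 : ∀ i : Fin N, pd i (fun _ : Euc N => r⁻¹ ^ 2) y = 0 := fun i => by simp [pd]
    have h5 : lap (fun _ : Euc N => r⁻¹ ^ 2) y = 0 := by
      unfold lap
      refine Finset.sum_eq_zero fun i _ => ?_
      rw [iteratedFDeriv_two_apply]; simp
    simp only [h4, h5, zero_mul, Finset.sum_const_zero, mul_zero, add_zero]
  have hp : ∀ i : Fin N, pd i (fun y : Euc N => r⁻¹ ^ 2 * ‖y‖ ^ 2) y = r⁻¹ ^ 2 * (2 * y i) :=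
    fun i => by rw [pd_const_mul _ (h3.differentiable (by norm_num) y), pd_norm_sq]
  simp_rw [hl, hp, mul_pow, ← Finset.mul_sum, sum_coord_sq] at this
  unfold cut
  simp_rw [← mul_pow] at this ⊢
  rw [this]; ring

lemma cut_arg {r : ℝ} (hr : 0 < r) {y : Euc N} (h : ‖y‖ < r / 2 ∨ r < ‖y‖) :
    r⁻¹ ^ 2 * ‖y‖ ^ 2 < 1 / 2 ∨ 1 < r⁻¹ ^ 2 * ‖y‖ ^ 2 := by
  rw [← mul_pow]
  have h0 : 0 ≤ r⁻¹ * ‖y‖ := by positivity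
  rcases h with h | h
  · left
    have : r⁻¹ * ‖y‖ ≤ 1 / 2 := by rw [inv_mul_le_iff₀ hr]; linarith
    nlinarith
  · right
    have : 1 < r⁻¹ * ‖y‖ := by rw [lt_inv_mul_iff₀ hr]; linarith
    nlinarith

lemma pd_cut_eq_zero {r : ℝ} (hr : 0 < r) {y : Euc N} (h : ‖y‖ < r / 2 ∨ r < ‖y‖)
    (i : Fin N) : pd i (cut r) y = 0 := by
  rw [pd_cut, deriv_sg_eq_zero (cut_arg hr h), zero_mul]

lemma lap_cut_eq_zero {r : ℝ} (hr : 0 < r) {y : Euc N} (h : ‖y‖ < r / 2 ∨ r < ‖y‖) :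
    lap (cut r) y = 0 := by
  rw [lap_cut, deriv_sg_eq_zero (cut_arg hr h), deriv2_sg_eq_zero (cut_arg hr h)]; simp

lemma exists_bound_cut (N : ℕ) : ∃ C : ℝ, 0 < C ∧ ∀ (r : ℝ), 0 < r → ∀ y : Euc N,
    (∀ i, |pd i (cut r) y| ≤ C / r) ∧ |lap (cut r) y| ≤ C / r ^ 2 := by
  obtain ⟨C, hC, h⟩ := exists_bound_sg
  refine ⟨(2 * N + 4) * C, by positivity, fun r hr y => ?_⟩
  by_cases hy : r < ‖y‖
  · constructor
    · intro i; rw [pd_cut_eq_zero hr (Or.inr hy)]; simp; positivity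
    · rw [lap_cut_eq_zero hr (Or.inr hy)]; simp; positivity
  push Not at hy
  have hq : r⁻¹ * ‖y‖ ≤ 1 := by rw [inv_mul_le_iff₀ hr]; linarith
  have hq0 : 0 ≤ r⁻¹ * ‖y‖ := by positivity
  have hr' : 0 < r⁻¹ := by positivity
  have hN0 : (0 : ℝ) ≤ N := Nat.cast_nonneg N
  constructor
  · intro i
    rw [pd_cut, abs_mul, abs_mul, abs_mul, abs_of_pos (by positivity : 0 < r⁻¹ ^ 2),
      abs_two, div_eq_mul_inv]
    have h1 : r⁻¹ ^ 2 * (2 * |y i|) ≤ 2 * r⁻¹ := by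
      have := abs_coord_le y i
      calc r⁻¹ ^ 2 * (2 * |y i|) ≤ r⁻¹ ^ 2 * (2 * ‖y‖) := by gcongr
        _ = 2 * r⁻¹ * (r⁻¹ * ‖y‖) := by ring
        _ ≤ 2 * r⁻¹ * 1 := by gcongr
        _ = _ := by ring
    calc _ ≤ C * (2 * r⁻¹) := mul_le_mul (h _).1 h1 (by positivity) hC.le
      _ = 2 * (C * r⁻¹) := by ring
      _ ≤ (2 * N + 4) * (C * r⁻¹) := by gcongr; linarith
      _ = _ := by ring
  · rw [lap_cut]
    have hq2 : r⁻¹ ^ 2 * ‖y‖ ^ 2 ≤ 1 := by rw [← mul_pow]; nlinarith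
    refine (abs_add_le _ _).trans ?_
    rw [abs_mul, abs_mul _ (deriv (deriv sg) _), abs_of_nonneg (by positivity),
      abs_of_nonneg (by positivity : 0 ≤ 4 * r⁻¹ ^ 2 * (r⁻¹ ^ 2 * ‖y‖ ^ 2))]
    calc _ ≤ 2 * N * r⁻¹ ^ 2 * C + 4 * r⁻¹ ^ 2 * 1 * C := by
          gcongr
          · exact (h _).1
          · exact (h _).2
      _ = _ := by field_simp

end Cutoff

section Representation

open Filter Topology

variable {N : ℕ}

/-- The closed annulus `R/2 ≤ |y| ≤ R`. -/
def annu (N : ℕ) (R : ℝ) : Set (Euc N) := {y | R / 2 ≤ ‖y‖ ∧ ‖y‖ ≤ R}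

lemma isClosed_annu (R : ℝ) : IsClosed (annu N R) :=
  (isClosed_le continuous_const continuous_norm).inter
    (isClosed_le continuous_norm continuous_const)

lemma annu_subset_closedBall (R : ℝ) : annu N R ⊆ closedBall 0 R := fun y hy => by
  simpa using hy.2

lemma isCompact_annu (R : ℝ) : IsCompact (annu N R) :=
  (isCompact_closedBall 0 R).of_isClosed_subset (isClosed_annu R) (annu_subset_closedBall R)

lemma measurableSet_annu (R : ℝ) : MeasurableSet (annu N R) := (isClosed_annu R).measurableSet

lemma ae_ne_zero (hN : 3 ≤ N) (x : Euc N) : ∀ᵐ y : Euc N, y ≠ x := by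
  have : Nonempty (Fin N) := ⟨⟨0, by omega⟩⟩
  exact Measure.ae_ne volume x

lemma volume_closedBall_real {r : ℝ} (hr : 0 ≤ r) :
    (volume (closedBall (0 : Euc N) r)).toReal =
      r ^ N * (volume (closedBall (0 : Euc N) 1)).toReal := by
  have := Measure.addHaar_closedBall' (volume : Measure (Euc N)) 0 hr
  rw [this, ENNReal.toReal_mul, finrank_euclideanSpace, Fintype.card_fin,
    ENNReal.toReal_ofReal (by positivity)]

lemma isOpen_ne_zero : IsOpen {x : Euc N | x ≠ 0} := isOpen_ne

lemma aemeasurable_of_continuousOn_ne_zero (hN : 3 ≤ N) {F : Euc N → ℝ}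
    (hF : ContinuousOn F {x : Euc N | x ≠ 0}) : AEMeasurable F := by
  have h2 := hF.aemeasurable (μ := volume) isOpen_ne_zero.measurableSet
  have h3 : (volume : Measure (Euc N)).restrict {x : Euc N | x ≠ 0} = volume :=
    Measure.restrict_eq_self_of_ae_mem (ae_ne_zero hN 0)
  rwa [h3] at h2

lemma tsupport_mul_cut_subset {T : Euc N → ℝ} {r : ℝ} (hr : 0 < r) :
    tsupport (fun y => T y * cut r y) ⊆ {x : Euc N | x ≠ 0} := by
  intro x hx h0
  subst h0
  refine (notMem_tsupport_iff_eventuallyEq.2 ?_) hx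
  filter_upwards [closedBall_mem_nhds (0 : Euc N) (half_pos hr)] with y hy
  simp [cut_eq_zero hr (show ‖y‖ ≤ r / 2 by simpa using hy)]

/-- The equation `-Δw = F` away from the origin holds in the weak sense across the origin. -/
lemma lintegral_mul_test (hN : 3 ≤ N) {w F : Euc N → ℝ} (hw : Continuous w)
    (hw2 : ContDiffOn ℝ 2 w {x : Euc N | x ≠ 0}) (hF : ∀ x, x ≠ 0 → -lap w x = F x)
    (hF0 : ∀ x, x ≠ 0 → 0 ≤ F x) {T : Euc N → ℝ} (hT : ContDiff ℝ 2 T)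
    (hTc : HasCompactSupport T) (hT0 : ∀ x, 0 ≤ T x) :
    ∫⁻ y, ENNReal.ofReal (F y * T y) = ENNReal.ofReal (∫ y, w y * -lap T y) := by
  obtain ⟨C, hC, hcut⟩ := exists_bound_cut N
  set r : ℕ → ℝ := fun n => 1 / ((n : ℝ) + 1) with hr
  have hr0 : ∀ n, 0 < r n := fun n => by simp only [hr]; positivity
  have hr1 : ∀ n, r n ≤ 1 := fun n => by
    simp only [hr]; rw [div_le_one (by positivity)]; linarith [(Nat.cast_nonneg n : (0 : ℝ) ≤ n)]
  have hr_lim : Tendsto r atTop (𝓝 0) := tendsto_one_div_add_atTop_nhds_zero_nat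
  have hr_anti : Antitone r := fun m n h => by
    have : (m : ℝ) ≤ n := by exact_mod_cast h
    simp only [hr]; gcongr
  have hcutC : ∀ n, ContDiff ℝ 2 (cut (r n) : Euc N → ℝ) := fun n => contDiff_cut (n := 2) _
  have hTn : ∀ n, ContDiff ℝ 2 (fun y => T y * cut (r n) y) := fun n => hT.mul (hcutC n)
  have hTnc : ∀ n, HasCompactSupport (fun y => T y * cut (r n) y) := fun n => hTc.mul_right
  have hlapT : Continuous (lap T) :=
    continuousOn_univ.1 (continuousOn_lap isOpen_univ hT.contDiffOn)
  have hpdT : ∀ i, Continuous (pd i T) := fun i => (contDiff_pd hT i).continuous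
  -- Green's identity for the truncated test function
  have green : ∀ n, ∫ y, F y * (T y * cut (r n) y) =
      ∫ y, w y * -lap (fun y => T y * cut (r n) y) y := by
    intro n
    have := integral_mul_lap isOpen_ne_zero hw2 (hTn n) (hTnc n) (tsupport_mul_cut_subset (hr0 n))
    simp_rw [mul_neg]
    rw [integral_neg, this, ← integral_neg]
    refine integral_congr_ae ?_
    filter_upwards [ae_ne_zero hN 0] with y hy
    rw [← hF y hy]; ring
  have hint : ∀ n, Integrable (fun y => F y * (T y * cut (r n) y)) := by
    intro n
    have h1 : ContinuousOn F {x : Euc N | x ≠ 0} :=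
      (continuousOn_lap isOpen_ne_zero hw2).neg.congr fun x hx => (hF x hx).symm
    exact integrable_mul_of_tsupport isOpen_ne_zero h1 (hTn n).continuous (hTnc n)
      (tsupport_mul_cut_subset (hr0 n))
  set e : ℕ → Euc N → ℝ := fun n y =>
    w y * (T y * lap (cut (r n)) y + 2 * ∑ i, pd i T y * pd i (cut (r n)) y) with he
  have hlapc : ∀ n, Continuous (lap (cut (r n)) : Euc N → ℝ) := fun n =>
    continuousOn_univ.1 (continuousOn_lap isOpen_univ (hcutC n).contDiffOn)
  have hpdc : ∀ n i, Continuous (pd i (cut (r n)) : Euc N → ℝ) := fun n i =>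
    (contDiff_pd (hcutC n) i).continuous
  have he_cont : ∀ n, Continuous (e n) := fun n => by
    have := hlapc n
    have := hpdc n
    have := hT.continuous
    simp only [he]
    fun_prop
  obtain ⟨M, hM⟩ : ∃ M : ℝ, ∀ y ∈ closedBall (0 : Euc N) 1,
      |w y| ≤ M ∧ |T y| ≤ M ∧ ∀ i, |pd i T y| ≤ M := by
    have hcont : Continuous fun y => |w y| + |T y| + ∑ i, |pd i T y| := by
      have := hT.continuous
      fun_prop
    obtain ⟨M, hM⟩ := (isCompact_closedBall (0 : Euc N) 1).exists_bound_of_continuousOn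
      hcont.continuousOn
    refine ⟨M, fun y hy => ?_⟩
    have h1 := (le_abs_self _).trans (hM y hy)
    have h2 : 0 ≤ ∑ i, |pd i T y| := Finset.sum_nonneg fun i _ => abs_nonneg _
    refine ⟨by linarith [abs_nonneg (w y), abs_nonneg (T y)],
      by linarith [abs_nonneg (w y), abs_nonneg (T y)], fun i => ?_⟩
    have h3 := Finset.single_le_sum (f := fun i => |pd i T y|) (fun i _ => abs_nonneg _)
      (Finset.mem_univ i)
    linarith [abs_nonneg (w y), abs_nonneg (T y)]
  have hM0 : 0 ≤ M := (abs_nonneg _).trans (hM 0 (by simp)).1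
  have he_zero : ∀ n y, y ∉ closedBall (0 : Euc N) (r n) → e n y = 0 := by
    intro n y hy
    have : r n < ‖y‖ := by simpa using hy
    simp only [he, lap_cut_eq_zero (hr0 n) (Or.inr this), pd_cut_eq_zero (hr0 n) (Or.inr this)]
    simp
  have he_bd : ∀ n y, y ∈ closedBall (0 : Euc N) (r n) →
      ‖e n y‖ ≤ M * (M * C + 2 * (N * (M * C))) / r n ^ 2 := by
    intro n y hy
    have hr0 := hr0 n
    have hr1 := hr1 n
    obtain ⟨h1, h2, h3⟩ := hM y (closedBall_subset_closedBall hr1 hy)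
    obtain ⟨h4, h5⟩ := hcut (r n) hr0 y
    have h6 : C / r n ≤ C / r n ^ 2 := by
      gcongr; nlinarith
    have h7 : |∑ i, pd i T y * pd i (cut (r n)) y| ≤ N * (M * (C / r n ^ 2)) := by
      refine (Finset.abs_sum_le_sum_abs _ _).trans ?_
      calc _ ≤ ∑ i : Fin N, M * (C / r n ^ 2) := by
            refine Finset.sum_le_sum fun i _ => ?_
            rw [abs_mul]
            exact mul_le_mul (h3 i) ((h4 i).trans h6) (abs_nonneg _) hM0
        _ = _ := by simp
    calc ‖e n y‖ ≤ M * (M * (C / r n ^ 2) + 2 * (N * (M * (C / r n ^ 2)))) := by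
          simp only [he, Real.norm_eq_abs, abs_mul]
          refine mul_le_mul h1 ((abs_add_le _ _).trans (add_le_add ?_ ?_)) (abs_nonneg _) hM0
          · rw [abs_mul]
            exact mul_le_mul h2 h5 (abs_nonneg _) hM0
          · rw [abs_mul, abs_two]; gcongr
      _ = _ := by ring
  have he_lim : Tendsto (fun n => ∫ y, e n y) atTop (𝓝 0) := by
    have hb : ∀ n, ‖∫ y, e n y‖ ≤ M * (M * C + 2 * (N * (M * C))) *
        (volume (closedBall (0 : Euc N) 1)).toReal * r n := by
      intro n
      rw [← setIntegral_eq_integral_of_forall_compl_eq_zero (he_zero n)]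
      refine (norm_setIntegral_le_of_norm_le_const measure_closedBall_lt_top
        (fun y hy => he_bd n y hy)).trans ?_
      rw [measureReal_def, volume_closedBall_real (hr0 n).le]
      have h1 : r n ^ N ≤ r n ^ 3 := pow_le_pow_of_le_one (hr0 n).le (hr1 n) hN
      have h2 := hr0 n
      calc _ = M * (M * C + 2 * (N * (M * C))) * (volume (closedBall (0 : Euc N) 1)).toReal *
            (r n ^ N / r n ^ 2) := by ring
        _ ≤ M * (M * C + 2 * (N * (M * C))) * (volume (closedBall (0 : Euc N) 1)).toReal *
            (r n ^ 3 / r n ^ 2) := by gcongr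
        _ = _ := by field_simp
    refine squeeze_zero_norm hb ?_
    simpa using hr_lim.const_mul
      (M * (M * C + 2 * (N * (M * C))) * (volume (closedBall (0 : Euc N) 1)).toReal)
  have hcut_ev : ∀ y : Euc N, y ≠ 0 → ∀ᶠ n in atTop, cut (r n) y = 1 := by
    intro y hy
    filter_upwards [hr_lim.eventually (gt_mem_nhds (norm_pos_iff.2 hy))] with n hn
    exact cut_eq_one (hr0 n) hn.le
  have hmain : Tendsto (fun n => ∫ y, w y * -lap T y * cut (r n) y) atTop
      (𝓝 (∫ y, w y * -lap T y)) := by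
    have hc : Continuous fun y => w y * -lap T y := hw.mul hlapT.neg
    have hi : Integrable fun y => w y * -lap T y := hc.integrable_of_hasCompactSupport
      ((hasCompactSupport_lap hTc).neg.mul_left)
    refine tendsto_integral_of_dominated_convergence (fun y => |w y * -lap T y|) ?_ hi.abs ?_ ?_
    · exact fun n => (hc.mul (hcutC n).continuous).aestronglyMeasurable
    · intro n
      filter_upwards with y
      rw [norm_mul, Real.norm_eq_abs, Real.norm_eq_abs, abs_of_nonneg (cut_nonneg _ y)]
      exact mul_le_of_le_one_right (abs_nonneg _) (cut_le_one _ y)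
    · filter_upwards [ae_ne_zero hN 0] with y hy
      refine tendsto_const_nhds.congr' ?_
      filter_upwards [hcut_ev y hy] with n hn
      rw [hn, mul_one]
  have hlim : Tendsto (fun n => ∫ y, F y * (T y * cut (r n) y)) atTop
      (𝓝 (∫ y, w y * -lap T y)) := by
    have h := hmain.sub he_lim
    rw [sub_zero] at h
    refine h.congr fun n => ?_
    rw [green n, ← integral_sub]
    · refine integral_congr_ae ?_
      filter_upwards with y
      simp only [he, lap_mul hT.contDiffAt (hcutC n).contDiffAt]
      ring
    · have hc : Continuous fun y => w y * -lap T y * cut (r n) y :=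
        (hw.mul hlapT.neg).mul (hcutC n).continuous
      exact hc.integrable_of_hasCompactSupport
        ((hasCompactSupport_lap hTc).neg.mul_left.mul_right)
    · exact (he_cont n).integrable_of_hasCompactSupport
        (HasCompactSupport.intro (isCompact_closedBall 0 (r n)) (he_zero n))
  have hFm : AEMeasurable F := by
    have h1 : ContinuousOn F {x : Euc N | x ≠ 0} :=
      (continuousOn_lap isOpen_ne_zero hw2).neg.congr fun x hx => (hF x hx).symm
    exact aemeasurable_of_continuousOn_ne_zero hN h1
  have hlim2 : Tendsto (fun n => ∫⁻ y, ENNReal.ofReal (F y * (T y * cut (r n) y))) atTop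
      (𝓝 (∫⁻ y, ENNReal.ofReal (F y * T y))) := by
    refine lintegral_tendsto_of_tendsto_of_monotone ?_ ?_ ?_
    · exact fun n => (hFm.mul (hTn n).continuous.aemeasurable).ennreal_ofReal
    · filter_upwards [ae_ne_zero hN 0] with y hy m n hmn
      refine ENNReal.ofReal_le_ofReal (mul_le_mul_of_nonneg_left
        (mul_le_mul_of_nonneg_left ?_ (hT0 y)) (hF0 y hy))
      exact cut_anti (hr0 n) (hr_anti hmn) y
    · filter_upwards [ae_ne_zero hN 0] with y hy
      refine tendsto_const_nhds.congr' ?_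
      filter_upwards [hcut_ev y hy] with n hn
      rw [hn, mul_one]
  refine tendsto_nhds_unique hlim2 ?_
  have := (ENNReal.continuous_ofReal.tendsto _).comp hlim
  refine this.congr fun n => ?_
  refine ofReal_integral_eq_lintegral_ofReal (hint n) ?_
  filter_upwards [ae_ne_zero hN 0] with y hy
  exact mul_nonneg (hF0 y hy) (mul_nonneg (hT0 y) (cut_nonneg _ y))

end Representation

section Representation

open Filter Topology

variable {N : ℕ}

lemma pd_const_minus (f : Euc N → ℝ) (c : ℝ) (y : Euc N) (i : Fin N) :
    pd i (fun z => c - f z) y = - pd i f y := by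
  unfold pd
  rw [fderiv_const_sub]; simp

lemma lap_const_minus {f : Euc N → ℝ} (c : ℝ) {y : Euc N} (hf : ContDiffAt ℝ 2 f y) :
    lap (fun z => c - f z) y = - lap f y := by
  rw [lap_eq_sum_pd hf, lap_eq_sum_pd (contDiffAt_const.sub hf), ← Finset.sum_neg_distrib]
  refine Finset.sum_congr rfl fun i _ => ?_
  have : pd i (fun z => c - f z) = fun y => - pd i f y := by
    ext y; exact pd_const_minus f c y i
  rw [this, pd_neg]

lemma hasCompactSupport_one_sub_cut {R : ℝ} (hR : 0 < R) :
    HasCompactSupport (fun y : Euc N => 1 - cut R y) := by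
  refine HasCompactSupport.intro (isCompact_closedBall 0 R) fun y hy => ?_
  have : R < ‖y‖ := by simpa using hy
  rw [cut_eq_one hR this.le, sub_self]

lemma rpow_quarter {R : ℝ} (hR : 0 < R) (c : ℝ) (m : ℕ) (hc : c + m = N) :
    (R / 4) ^ (-c) * (R ^ m)⁻¹ = 4 ^ c * (R ^ N)⁻¹ := by
  rw [Real.div_rpow hR.le (by norm_num), Real.rpow_neg (by norm_num : (0 : ℝ) ≤ 4),
    Real.rpow_neg hR.le, ← Real.rpow_natCast R N, ← hc, Real.rpow_add hR, Real.rpow_natCast]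
  have : 0 < R ^ c := Real.rpow_pos_of_pos hR c
  field_simp

/-- A nonnegative function with vanishing averages over large annuli is the Newton potential of
minus its Laplacian. -/
lemma lintegral_gam_mul (hN : 3 ≤ N) {w F : Euc N → ℝ} (hw : Continuous w)
    (hw0 : ∀ x, 0 ≤ w x)
    (hw2 : ContDiffOn ℝ 2 w {x : Euc N | x ≠ 0}) (hF : ∀ x, x ≠ 0 → -lap w x = F x)
    (hF0 : ∀ x, x ≠ 0 → 0 ≤ F x)
    (havg : Tendsto (fun k : ℕ => (((2 : ℝ) ^ k) ^ N)⁻¹ * ∫ y in annu N (2 ^ k), w y) atTop (𝓝 0))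
    (x : Euc N) :
    ∫⁻ y, ENNReal.ofReal (gam N 0 (x - y) * F y) = ENNReal.ofReal (kap N * w x) := by
  obtain ⟨C, hC, hcut⟩ := exists_bound_cut N
  have h3 : (3 : ℝ) ≤ N := by exact_mod_cast hN
  have hF1 : ContinuousOn F {x : Euc N | x ≠ 0} :=
    (continuousOn_lap isOpen_ne_zero hw2).neg.congr fun x hx => (hF x hx).symm
  have hFm : AEMeasurable F := aemeasurable_of_continuousOn_ne_zero hN hF1
  have hsub : Continuous fun y : Euc N => x - y := by fun_prop
  have hGC : ∀ n, ContDiff ℝ 2 (fun y : Euc N => gam N (eps n) (x - y)) := fun n =>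
    (contDiff_gam (eps_pos n)).comp (contDiff_const.sub contDiff_id)
  set C' : ℝ := 4 ^ ((N : ℝ) - 2) * C + 2 * (N * ((N - 2) * 4 ^ ((N : ℝ) - 1) * C)) with hC'
  -- Estimates at a fixed radius
  have fixed : ∀ R : ℝ, 0 < R → 4 * ‖x‖ < R →
      ENNReal.ofReal (kap N * w x - C' * ((R ^ N)⁻¹ * ∫ y in annu N R, w y)) ≤
        ∫⁻ y, ENNReal.ofReal (gam N 0 (x - y) * F y * (1 - cut R y)) ∧
      ∫⁻ y, ENNReal.ofReal (gam N 0 (x - y) * F y * (1 - cut R y)) ≤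
        ENNReal.ofReal (kap N * w x + C' * ((R ^ N)⁻¹ * ∫ y in annu N R, w y)) := by
    intro R hR hxR
    set T : ℕ → Euc N → ℝ := fun n y => gam N (eps n) (x - y) * (1 - cut R y) with hTdef
    have hcC : ContDiff ℝ 2 (cut R : Euc N → ℝ) := contDiff_cut (n := 2) R
    have hcC' : ContDiff ℝ 2 (fun y : Euc N => 1 - cut R y) := contDiff_const.sub hcC
    have hT : ∀ n, ContDiff ℝ 2 (T n) := fun n => (hGC n).mul hcC'
    have hTc : ∀ n, HasCompactSupport (T n) := fun n => (hasCompactSupport_one_sub_cut hR).mul_left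
    have hT0 : ∀ n y, 0 ≤ T n y := fun n y =>
      mul_nonneg (gam_nonneg (eps_pos n).le _) (by linarith [cut_le_one R y])
    set e : ℕ → Euc N → ℝ := fun n y => w y * (gam N (eps n) (x - y) * lap (cut R) y +
      2 * ∑ i, pd i (fun y => gam N (eps n) (x - y)) y * pd i (cut R) y) with he
    have hdecomp : ∀ n y, w y * -lap (T n) y =
        del N (eps n) (x - y) * (w y * (1 - cut R y)) + e n y := by
      intro n y
      simp only [hTdef, he]
      rw [lap_mul (hGC n).contDiffAt hcC'.contDiffAt, lap_const_minus _ hcC.contDiffAt,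
        lap_const_sub (contDiff_gam (eps_pos n)).contDiffAt,
        lap_gam (norm_sq_add_pos (eps_pos n) _)]
      simp_rw [pd_const_minus, mul_neg, Finset.sum_neg_distrib]
      ring
    have he_cont : ∀ n, Continuous (e n) := fun n => by
      have h1 : Continuous (lap (cut R) : Euc N → ℝ) :=
        continuousOn_univ.1 (continuousOn_lap isOpen_univ hcC.contDiffOn)
      have h2 : ∀ i, Continuous (pd i (cut R) : Euc N → ℝ) := fun i => (contDiff_pd hcC i).continuous
      have h3 : ∀ i, Continuous (pd i (fun y => gam N (eps n) (x - y))) := fun i =>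
        (contDiff_pd (hGC n) i).continuous
      have h4 := (hGC n).continuous
      simp only [he]
      fun_prop
    have he_zero : ∀ n y, y ∉ annu N R → e n y = 0 := by
      intro n y hy
      have : ‖y‖ < R / 2 ∨ R < ‖y‖ := by
        by_contra! h
        exact hy ⟨h.1, h.2⟩
      simp only [he, lap_cut_eq_zero hR this, pd_cut_eq_zero hR this]
      simp
    have he_bd : ∀ n y, y ∈ annu N R → ‖e n y‖ ≤ C' * ((R ^ N)⁻¹ * w y) := by
      intro n y hy
      have hxy : R / 4 ≤ ‖x - y‖ := by
        have := norm_sub_norm_le y x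
        rw [norm_sub_rev] at this
        linarith [hy.1]
      have hR4 : 0 < R / 4 := by positivity
      have g0 := gam_nonneg (eps_pos n).le (x - y)
      have g1 := gam_le hN hR4 (eps_pos n).le hxy
      have g2 := fun i => abs_pd_gam_le hN hR4 (eps_pos n).le hxy i
      obtain ⟨h4, h5⟩ := hcut R hR y
      have b1 : |gam N (eps n) (x - y) * lap (cut R) y| ≤ 4 ^ ((N : ℝ) - 2) * C * (R ^ N)⁻¹ := by
        rw [abs_mul, abs_of_nonneg g0]
        calc _ ≤ (R / 4) ^ (-((N : ℝ) - 2)) * (C / R ^ 2) :=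
              mul_le_mul g1 h5 (abs_nonneg _) (by positivity)
          _ = ((R / 4) ^ (-((N : ℝ) - 2)) * (R ^ 2)⁻¹) * C := by ring
          _ = _ := by rw [rpow_quarter hR ((N : ℝ) - 2) 2 (by push_cast; ring)]; ring
      have b2 : |∑ i, pd i (fun y => gam N (eps n) (x - y)) y * pd i (cut R) y| ≤
          N * ((N - 2) * 4 ^ ((N : ℝ) - 1) * C) * (R ^ N)⁻¹ := by
        refine (Finset.abs_sum_le_sum_abs _ _).trans ?_
        calc _ ≤ ∑ i : Fin N, ((N - 2) * (R / 4) ^ (-((N : ℝ) - 1))) * (C / R) := by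
              refine Finset.sum_le_sum fun i _ => ?_
              rw [abs_mul, pd_const_sub, abs_neg]
              refine mul_le_mul (g2 i) (h4 i) (abs_nonneg _) ?_
              have : (0 : ℝ) ≤ N - 2 := by linarith
              positivity
          _ = N * (N - 2) * C * ((R / 4) ^ (-((N : ℝ) - 1)) * (R ^ 1)⁻¹) := by
              simp; ring
          _ = _ := by rw [rpow_quarter hR ((N : ℝ) - 1) 1 (by push_cast; ring)]; ring
      simp only [he]
      rw [norm_mul, Real.norm_of_nonneg (hw0 y)]
      calc _ ≤ w y * (4 ^ ((N : ℝ) - 2) * C * (R ^ N)⁻¹ +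
            2 * (N * ((N - 2) * 4 ^ ((N : ℝ) - 1) * C) * (R ^ N)⁻¹)) := by
            refine mul_le_mul_of_nonneg_left ((norm_add_le _ _).trans (add_le_add b1 ?_)) (hw0 y)
            rw [norm_mul, Real.norm_of_nonneg (by norm_num)]
            exact mul_le_mul_of_nonneg_left b2 (by norm_num)
        _ = _ := by rw [hC']; ring
    have he_int : ∀ n, |∫ y, e n y| ≤ C' * ((R ^ N)⁻¹ * ∫ y in annu N R, w y) := by
      intro n
      rw [← setIntegral_eq_integral_of_forall_compl_eq_zero (he_zero n), ← integral_const_mul,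
        ← integral_const_mul, ← Real.norm_eq_abs]
      refine norm_integral_le_of_norm_le ?_ ?_
      · exact (((hw.continuousOn.integrableOn_compact (isCompact_annu R)).const_mul _).const_mul _)
      · filter_upwards [ae_restrict_mem (measurableSet_annu R)] with y hy using he_bd n y hy
    set W : Euc N → ℝ := fun y => w y * (1 - cut R y) with hW
    have hWc : Continuous W := hw.mul hcC'.continuous
    have hWs : HasCompactSupport W := (hasCompactSupport_one_sub_cut hR).mul_left
    obtain ⟨M, hM⟩ := hWs.exists_bound_of_continuous hWc
    have hWx : W x = w x := by
      simp only [hW]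
      rw [cut_eq_zero hR (by linarith [norm_nonneg x])]; ring
    have hconv := tendsto_integral_del_mul hWc hM x
    rw [hWx] at hconv
    have hweak : ∀ n, ∫⁻ y, ENNReal.ofReal (F y * T n y) =
        ENNReal.ofReal ((∫ y, del N (eps n) (x - y) * W y) + ∫ y, e n y) := by
      intro n
      rw [lintegral_mul_test hN hw hw2 hF hF0 (hT n) (hTc n) (hT0 n), ← integral_add]
      · simp_rw [hdecomp, hW]
      · exact (((continuous_del (eps_pos n)).comp hsub).mul hWc).integrable_of_hasCompactSupport
          hWs.mul_left
      · exact (he_cont n).integrable_of_hasCompactSupport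
          (HasCompactSupport.intro (isCompact_annu R) (he_zero n))
    have hlim : Tendsto (fun n => ∫⁻ y, ENNReal.ofReal (F y * T n y)) atTop
        (𝓝 (∫⁻ y, ENNReal.ofReal (gam N 0 (x - y) * F y * (1 - cut R y)))) := by
      refine lintegral_tendsto_of_tendsto_of_monotone ?_ ?_ ?_
      · exact fun n => (hFm.mul (hT n).continuous.aemeasurable).ennreal_ofReal
      · filter_upwards [ae_ne_zero hN 0] with y hy m n hmn
        refine ENNReal.ofReal_le_ofReal (mul_le_mul_of_nonneg_left
          (mul_le_mul_of_nonneg_right ?_ (by linarith [cut_le_one R y])) (hF0 y hy))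
        exact gam_anti hN (norm_sq_add_pos (eps_pos n) _) (eps_anti hmn)
      · filter_upwards [ae_ne_zero hN x] with y hy
        refine (ENNReal.continuous_ofReal.tendsto _).comp ?_
        have h1 := (tendsto_gam (sub_ne_zero.2 hy.symm)).comp tendsto_eps
        have h2 := (h1.mul_const (1 - cut R y)).const_mul (F y)
        simp only [Function.comp_def] at h2
        convert h2 using 2
        ring
    constructor
    · refine le_of_tendsto_of_tendsto (ENNReal.tendsto_ofReal (hconv.sub_const _)) hlim ?_
      filter_upwards with n
      rw [hweak n]
      exact ENNReal.ofReal_le_ofReal (by linarith [neg_le_of_abs_le (he_int n)])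
    · refine le_of_tendsto_of_tendsto hlim (ENNReal.tendsto_ofReal (hconv.add_const _)) ?_
      filter_upwards with n
      rw [hweak n]
      exact ENNReal.ofReal_le_ofReal (by linarith [le_of_abs_le (he_int n)])
  have hpow : Tendsto (fun k : ℕ => (2 : ℝ) ^ k) atTop atTop :=
    tendsto_pow_atTop_atTop_of_one_lt (by norm_num)
  have hlim2 : Tendsto (fun k : ℕ => ∫⁻ y, ENNReal.ofReal
      (gam N 0 (x - y) * F y * (1 - cut (2 ^ k) y))) atTop
      (𝓝 (∫⁻ y, ENNReal.ofReal (gam N 0 (x - y) * F y))) := by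
    refine lintegral_tendsto_of_tendsto_of_monotone ?_ ?_ ?_
    · intro k
      have h1 : Measurable fun y => gam N 0 (x - y) := (measurable_gam 0).comp hsub.measurable
      have h2 : Continuous (cut (2 ^ k) : Euc N → ℝ) := (contDiff_cut (n := 0) _).continuous
      exact ((h1.aemeasurable.mul hFm).mul
        (continuous_const.sub h2).aemeasurable).ennreal_ofReal
    · filter_upwards [ae_ne_zero hN 0] with y hy m n hmn
      refine ENNReal.ofReal_le_ofReal (mul_le_mul_of_nonneg_left ?_
        (mul_nonneg (gam_nonneg le_rfl _) (hF0 y hy)))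
      have := cut_anti (show (0 : ℝ) < 2 ^ m by positivity)
        (pow_le_pow_right₀ (by norm_num : (1 : ℝ) ≤ 2) hmn) y
      linarith
    · filter_upwards with y
      refine tendsto_const_nhds.congr' ?_
      filter_upwards [hpow.eventually_ge_atTop (2 * ‖y‖)] with k hk
      rw [cut_eq_zero (by positivity) (by linarith), sub_zero, mul_one]
  have hA := (havg.const_mul C')
  rw [mul_zero] at hA
  have hup : Tendsto (fun k : ℕ => ENNReal.ofReal (kap N * w x +
      C' * ((((2 : ℝ) ^ k) ^ N)⁻¹ * ∫ y in annu N (2 ^ k), w y))) atTop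
      (𝓝 (ENNReal.ofReal (kap N * w x))) := by
    simpa using ENNReal.tendsto_ofReal (hA.const_add (kap N * w x))
  have hlo : Tendsto (fun k : ℕ => ENNReal.ofReal (kap N * w x -
      C' * ((((2 : ℝ) ^ k) ^ N)⁻¹ * ∫ y in annu N (2 ^ k), w y))) atTop
      (𝓝 (ENNReal.ofReal (kap N * w x))) := by
    simpa using ENNReal.tendsto_ofReal (hA.const_sub (kap N * w x))
  refine tendsto_nhds_unique hlim2 (tendsto_of_tendsto_of_tendsto_of_le_of_le' hlo hup ?_ ?_)
  · filter_upwards [hpow.eventually_gt_atTop (4 * ‖x‖)] with k hk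
    exact (fixed _ (by positivity) hk).1
  · filter_upwards [hpow.eventually_gt_atTop (4 * ‖x‖)] with k hk
    exact (fixed _ (by positivity) hk).2

end Representation

section NewtonPotential

open Filter Topology Convolution

variable {N : ℕ}

/-- The (unnormalized) Newton potential of `F`. -/
def nwt (F : Euc N → ℝ) (x : Euc N) : ℝ := ∫ y, gam N 0 (x - y) * F y

lemma locallyIntegrable_gam (hN : 3 ≤ N) : LocallyIntegrable (gam N 0) := by
  have h3 : (3 : ℝ) ≤ N := by exact_mod_cast hN
  refine locallyIntegrable_of_norm_le_rpow (C := 1) (α := (N : ℝ) - 2) ?_ ?_ ?_ ?_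
  · rw [finrank_euclideanSpace, Fintype.card_fin]; omega
  · rw [finrank_euclideanSpace, Fintype.card_fin]; linarith
  · filter_upwards with z
    rw [Real.norm_of_nonneg (gam_nonneg le_rfl z), gam_zero, one_mul]
  · exact (measurable_gam 0).aestronglyMeasurable

lemma nwt_eq_convolution (F : Euc N → ℝ) :
    nwt F = gam N 0 ⋆[ContinuousLinearMap.mul ℝ ℝ, volume] F := by
  ext x
  rw [convolution_eq_swap]
  rfl

lemma integrable_gam_mul (hN : 3 ≤ N) {F : Euc N → ℝ} (hF : Continuous F)
    (hc : HasCompactSupport F) (x : Euc N) : Integrable fun y => gam N 0 (x - y) * F y := by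
  have h2 : Integrable fun z => gam N 0 z * F (x - z) := by
    refine (locallyIntegrable_gam hN).integrable_smul_right_of_hasCompactSupport
      (g := fun z => F (x - z)) (by fun_prop) ?_
    exact hc.comp_homeomorph (Homeomorph.subLeft x)
  have := h2.comp_sub_left x
  simpa using this

lemma contDiff_nwt (hN : 3 ≤ N) {F : Euc N → ℝ} (hF : ContDiff ℝ 2 F)
    (hc : HasCompactSupport F) : ContDiff ℝ 2 (nwt F) := by
  rw [nwt_eq_convolution]
  exact hc.contDiff_convolution_right (n := 2) _ (locallyIntegrable_gam hN) hF

lemma pd_nwt (hN : 3 ≤ N) {F : Euc N → ℝ} (hF : ContDiff ℝ 1 F)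
    (hc : HasCompactSupport F) (i : Fin N) : pd i (nwt F) = nwt (pd i F) := by
  ext x
  unfold pd
  rw [nwt_eq_convolution, (hc.hasFDerivAt_convolution_right _ (locallyIntegrable_gam hN) hF x).fderiv,
    convolution_precompR_apply _ (locallyIntegrable_gam hN) (hc.fderiv ℝ)
      (hF.continuous_fderiv one_ne_zero), ← nwt_eq_convolution]

lemma nwt_lap (hN : 3 ≤ N) {F : Euc N → ℝ} (hF : ContDiff ℝ 2 F)
    (hc : HasCompactSupport F) (x : Euc N) : nwt (lap F) x = -(kap N * F x) := by
  have hlapF : Continuous (lap F) :=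
    continuousOn_univ.1 (continuousOn_lap isOpen_univ hF.contDiffOn)
  have hsub : Continuous fun y : Euc N => x - y := by fun_prop
  have hGC : ∀ n, ContDiff ℝ 2 (fun y : Euc N => gam N (eps n) (x - y)) := fun n =>
    (contDiff_gam (eps_pos n)).comp (contDiff_const.sub contDiff_id)
  obtain ⟨M, hM⟩ := hc.exists_bound_of_continuous hF.continuous
  have h1 := (tendsto_integral_del_mul hF.continuous hM x).neg
  have h2 : Tendsto (fun n => ∫ y, gam N (eps n) (x - y) * lap F y) atTop
      (𝓝 (∫ y, gam N 0 (x - y) * lap F y)) := by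
    refine tendsto_integral_of_dominated_convergence
      (fun y => |gam N 0 (x - y) * lap F y|) ?_ ?_ ?_ ?_
    · exact fun n => ((hGC n).continuous.mul hlapF).aestronglyMeasurable
    · exact (integrable_gam_mul hN hlapF (hasCompactSupport_lap hc) x).abs
    · intro n
      filter_upwards [ae_ne_zero hN x] with y hy
      have h0 : 0 < ‖x - y‖ ^ 2 + 0 := by
        have := norm_pos_iff.2 (sub_ne_zero.2 hy.symm); positivity
      rw [norm_mul, abs_mul, Real.norm_eq_abs, Real.norm_eq_abs,
        abs_of_nonneg (gam_nonneg (eps_pos n).le _), abs_of_nonneg (gam_nonneg le_rfl _)]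
      exact mul_le_mul_of_nonneg_right (gam_anti hN h0 (eps_pos n).le) (abs_nonneg _)
    · filter_upwards [ae_ne_zero hN x] with y hy
      exact ((tendsto_gam (sub_ne_zero.2 hy.symm)).comp tendsto_eps).mul_const _
  refine tendsto_nhds_unique h2 (h1.congr fun n => ?_)
  rw [integral_mul_lap isOpen_univ (hGC n).contDiffOn hF hc (subset_univ _), ← integral_neg]
  refine integral_congr_ae ?_
  filter_upwards with y
  rw [lap_const_sub (contDiff_gam (eps_pos n)).contDiffAt, lap_gam (norm_sq_add_pos (eps_pos n) _)]
  ring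

lemma lap_nwt (hN : 3 ≤ N) {F : Euc N → ℝ} (hF : ContDiff ℝ 2 F)
    (hc : HasCompactSupport F) (x : Euc N) : lap (nwt F) x = -(kap N * F x) := by
  rw [← nwt_lap hN hF hc x, lap_eq_sum_pd (contDiff_nwt hN hF hc).contDiffAt]
  have hF1 : ∀ i, ContDiff ℝ 1 (pd i F) := contDiff_pd hF
  have h1 : ∀ i : Fin N, pd i (pd i (nwt F)) x = nwt (pd i (pd i F)) x := fun i => by
    rw [pd_nwt hN (hF.of_le (by norm_num)) hc, pd_nwt hN (hF1 i) (hasCompactSupport_pd hc i)]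
  simp_rw [h1]
  unfold nwt
  rw [← integral_finsetSum]
  · refine integral_congr_ae ?_
    filter_upwards with y
    rw [lap_eq_sum_pd hF.contDiffAt, Finset.mul_sum]
  · intro i _
    exact integrable_gam_mul hN (continuousOn_univ.1 (continuousOn_pd isOpen_univ
      (hF1 i).contDiffOn i)) (hasCompactSupport_pd (hasCompactSupport_pd hc i) i) x

end NewtonPotential

section Stability

variable {N : ℕ}

lemma contDiff_mul_of_tsupport {Ω : Set (Euc N)} (hΩ : IsOpen Ω) {n : WithTop ℕ∞}
    {f g : Euc N → ℝ} (hf : ContDiffOn ℝ n f Ω) (hg : ContDiffOn ℝ n g Ω)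
    (hs : tsupport g ⊆ Ω) : ContDiff ℝ n fun x => f x * g x := by
  refine contDiff_iff_contDiffAt.2 fun x => ?_
  by_cases hx : x ∈ tsupport g
  · exact (hf.contDiffAt (hΩ.mem_nhds (hs hx))).mul (hg.contDiffAt (hΩ.mem_nhds (hs hx)))
  · have h0 : g =ᶠ[nhds x] 0 := notMem_tsupport_iff_eventuallyEq.1 hx
    have : (fun x => f x * g x) =ᶠ[nhds x] fun _ => 0 := by
      filter_upwards [h0] with y hy
      simp [hy]
    exact contDiffAt_const.congr_of_eventuallyEq this

/-- The integral inequality satisfied by a stable pair, tested with `ψ` such that `-Δψ ≤ G`. -/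
lemma stability_integral_le {Ω : Set (Euc N)} (hΩ : IsOpen Ω) {ξ ζ V W ψ G : Euc N → ℝ}
    (hξ : ContDiffOn ℝ 2 ξ Ω) (hζ : ContDiffOn ℝ 2 ζ Ω)
    (hξ0 : ∀ x ∈ Ω, 0 < ξ x) (hζ0 : ∀ x ∈ Ω, 0 < ζ x)
    (hV : ContinuousOn V Ω) (hW : ContinuousOn W Ω) (hW0 : ∀ x ∈ Ω, 0 < W x)
    (h1 : ∀ x ∈ Ω, V x * ζ x ≤ -lap ξ x) (h2 : ∀ x ∈ Ω, W x * ξ x ≤ -lap ζ x)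
    (hψ : ContDiff ℝ 2 ψ) (hψc : HasCompactSupport ψ) (hψs : tsupport ψ ⊆ Ω)
    (hψ0 : ∀ x, 0 ≤ ψ x) (hG : Continuous G) (hGc : HasCompactSupport G)
    (hGs : tsupport G ⊆ Ω) (hψG : ∀ x ∈ Ω, -lap ψ x ≤ G x) :
    ∫ x, V x * ψ x ^ 2 ≤ ∫ x, (W x)⁻¹ * G x ^ 2 := by
  set k : Euc N → ℝ := fun x => (ζ x)⁻¹ * ψ x with hk
  have hζi : ContDiffOn ℝ 2 (fun x => (ζ x)⁻¹) Ω := hζ.inv fun x hx => (hζ0 x hx).ne'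
  have hkC : ContDiff ℝ 2 k := contDiff_mul_of_tsupport hΩ hζi hψ.contDiffOn hψs
  set φ : Euc N → ℝ := fun x => k x * ψ x with hφ
  have hφC : ContDiff ℝ 2 φ := hkC.mul hψ
  have hφc : HasCompactSupport φ := hψc.mul_left
  have hφs : tsupport φ ⊆ Ω := (tsupport_mul_subset_right).trans hψs
  have hψ2 : tsupport (fun x => ψ x ^ 2) ⊆ Ω := by
    simp_rw [pow_two]
    exact (tsupport_mul_subset_right).trans hψs
  have hψ2c : HasCompactSupport (fun x => ψ x ^ 2) := by
    simp_rw [pow_two]; exact hψc.mul_left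
  have hG2 : tsupport (fun x => G x ^ 2) ⊆ Ω := by
    simp_rw [pow_two]
    exact (tsupport_mul_subset_right).trans hGs
  have hG2c : HasCompactSupport (fun x => G x ^ 2) := by
    simp_rw [pow_two]; exact hGc.mul_left
  have hψC := hψ.continuous
  have hlapφ : Continuous (lap φ) :=
    continuousOn_univ.1 (continuousOn_lap isOpen_univ hφC.contDiffOn)
  have hlaps : tsupport (lap φ) ⊆ Ω := (tsupport_lap_subset φ).trans hφs
  have hlapc := hasCompactSupport_lap hφc
  have key : ∀ x ∈ Ω, -lap φ x ≤ 2 * k x * G x - k x ^ 2 * (W x * ξ x) := by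
    intro x hx
    have hζx : ContDiffAt ℝ 2 ζ x := hζ.contDiffAt (hΩ.mem_nhds hx)
    have hev : ∀ᶠ y in nhds x, ψ y = k y * ζ y := by
      filter_upwards [hΩ.mem_nhds hx] with y hy
      have := (hζ0 y hy).ne'
      simp only [hk]; field_simp
    have e1 : lap ψ x = k x * lap ζ x + 2 * ∑ i, pd i k x * pd i ζ x + ζ x * lap k x := by
      rw [lap_congr hev, lap_mul hkC.contDiffAt hζx]
    have e2 : lap φ x = k x * lap ψ x + 2 * ∑ i, pd i k x * pd i ψ x + ψ x * lap k x :=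
      lap_mul hkC.contDiffAt hψ.contDiffAt
    have e3 : ∀ i, pd i k x * pd i ψ x = k x * (pd i k x * pd i ζ x) + ζ x * pd i k x ^ 2 := by
      intro i
      rw [pd_congr hev, pd_mul (hkC.contDiffAt.differentiableAt (by norm_num))
        (hζx.differentiableAt (by norm_num))]
      ring
    have e4 : ∑ i, pd i k x * pd i ψ x =
        k x * ∑ i, pd i k x * pd i ζ x + ζ x * ∑ i, pd i k x ^ 2 := by
      simp_rw [e3, Finset.sum_add_distrib, ← Finset.mul_sum]
    have hk0 : 0 ≤ k x := mul_nonneg (inv_nonneg.2 (hζ0 x hx).le) (hψ0 x)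
    have hs : 0 ≤ ζ x * ∑ i, pd i k x ^ 2 :=
      mul_nonneg (hζ0 x hx).le (Finset.sum_nonneg fun i _ => sq_nonneg _)
    have e5 : ψ x = k x * ζ x := hev.self_of_nhds
    have e6 : lap φ x = 2 * k x * lap ψ x - k x ^ 2 * lap ζ x +
        2 * (ζ x * ∑ i, pd i k x ^ 2) := by
      have : ζ x * lap k x = lap ψ x - k x * lap ζ x - 2 * ∑ i, pd i k x * pd i ζ x := by
        rw [e1]; ring
      rw [e2, e4, e5, mul_assoc (k x) (ζ x), this]; ring
    rw [e6]
    nlinarith [mul_le_mul_of_nonneg_left (hψG x hx) hk0,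
      mul_le_mul_of_nonneg_left (h2 x hx) (sq_nonneg (k x))]
  have green := integral_mul_lap hΩ hξ hφC hφc hφs
  calc ∫ x, V x * ψ x ^ 2 ≤ ∫ x, -(lap ξ x * φ x) := by
        refine integral_mono (integrable_mul_of_tsupport hΩ hV (by fun_prop) hψ2c hψ2)
          (integrable_mul_of_tsupport hΩ (continuousOn_lap hΩ hξ) hφC.continuous hφc hφs).neg ?_
        intro x
        by_cases hx : x ∈ Ω
        · have hz := hζ0 x hx
          have hφ0 : 0 ≤ φ x := mul_nonneg (mul_nonneg (inv_nonneg.2 hz.le) (hψ0 x)) (hψ0 x)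
          have : V x * ψ x ^ 2 = V x * ζ x * φ x := by
            simp only [hφ, hk]; field_simp
          simp only
          rw [this, ← neg_mul]
          exact mul_le_mul_of_nonneg_right (h1 x hx) hφ0
        · have : ψ x = 0 := image_eq_zero_of_notMem_tsupport fun h => hx (hψs h)
          simp [hφ, this]
    _ = ∫ x, -(ξ x * lap φ x) := by rw [integral_neg, ← green, ← integral_neg]
    _ ≤ ∫ x, (W x)⁻¹ * G x ^ 2 := by
        refine integral_mono
          (integrable_mul_of_tsupport hΩ hξ.continuousOn hlapφ hlapc hlaps).neg
          (integrable_mul_of_tsupport hΩ (hW.inv₀ fun x hx => (hW0 x hx).ne')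
            (by fun_prop) hG2c hG2) ?_
        intro x
        by_cases hx : x ∈ Ω
        · have hWx := hW0 x hx
          have h3 : -(ξ x * lap φ x) ≤ ξ x * (2 * k x * G x - k x ^ 2 * (W x * ξ x)) := by
            rw [← mul_neg]
            exact mul_le_mul_of_nonneg_left (key x hx) (hξ0 x hx).le
          have h4 : (W x)⁻¹ * G x ^ 2 - ξ x * (2 * k x * G x - k x ^ 2 * (W x * ξ x)) =
              (W x)⁻¹ * (G x - k x * ξ x * W x) ^ 2 := by
            field_simp; ring
          have h5 : 0 ≤ (W x)⁻¹ * (G x - k x * ξ x * W x) ^ 2 := by positivity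
          simp only
          linarith
        · have h3 : lap φ x = 0 := image_eq_zero_of_notMem_tsupport fun h => hx (hlaps h)
          have h4 : G x = 0 := image_eq_zero_of_notMem_tsupport fun h => hx (hGs h)
          simp [h3, h4]

end Stability

section Averages

open Filter Topology

variable {N : ℕ}

lemma rpow_le_of_mem_annu {R : ℝ} (hR : 0 < R) (c : ℝ) {t : ℝ} (h1 : R / 2 ≤ t) (h2 : t ≤ 2 * R) :
    t ^ c ≤ 2 ^ |c| * R ^ c := by
  have ht : 0 < t := by linarith
  rcases le_total 0 c with hc | hc
  · rw [abs_of_nonneg hc, ← Real.mul_rpow (by norm_num) hR.le]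
    exact Real.rpow_le_rpow ht.le h2 hc
  · rw [abs_of_nonpos hc]
    calc t ^ c ≤ (R / 2) ^ c := Real.rpow_le_rpow_of_nonpos (by positivity) h1 hc
      _ = 2 ^ (-c) * R ^ c := by
        rw [Real.div_rpow hR.le (by norm_num), Real.rpow_neg (by norm_num)]
        ring

lemma le_rpow_of_mem_annu {R : ℝ} (hR : 0 < R) (c : ℝ) {t : ℝ} (h1 : R / 2 ≤ t) (h2 : t ≤ 2 * R) :
    R ^ c ≤ 2 ^ |c| * t ^ c :=
  rpow_le_of_mem_annu (by linarith) c (by linarith) (by linarith)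

lemma setIntegral_annu_const {R : ℝ} (hR : 0 ≤ R) {c : ℝ} (hc : 0 ≤ c) :
    ∫ _ in annu N R, c ≤ c * (R ^ N * (volume (closedBall (0 : Euc N) 1)).toReal) := by
  rw [setIntegral_const, smul_eq_mul, mul_comm]
  refine mul_le_mul_of_nonneg_left ?_ hc
  rw [← volume_closedBall_real hR]
  exact ENNReal.toReal_mono measure_closedBall_lt_top.ne (measure_mono (annu_subset_closedBall R))

lemma le_add_mul_rpow {t l s : ℝ} (ht : 0 ≤ t) (hl : 0 < l) (hs : 1 ≤ s) :
    t ≤ l + l ^ (1 - s) * t ^ s := by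
  rcases le_total t l with h | h
  · have : 0 ≤ l ^ (1 - s) * t ^ s := by positivity
    linarith
  · have ht0 : 0 < t := by linarith
    have h1 : t = t ^ (1 - s) * t ^ s := by
      rw [← Real.rpow_add ht0]; simp
    have h2 : t ^ (1 - s) ≤ l ^ (1 - s) := Real.rpow_le_rpow_of_nonpos hl h (by linarith)
    have h3 : t ^ (1 - s) * t ^ s ≤ l ^ (1 - s) * t ^ s :=
      mul_le_mul_of_nonneg_right h2 (by positivity)
    linarith

/-- Smallness of the averages of a power implies smallness of the averages. -/
lemma tendsto_average_of_rpow {w : Euc N → ℝ} (hw : Continuous w) (hw0 : ∀ x, 0 ≤ w x) {s : ℝ}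
    (hs : 1 ≤ s)
    (h : Tendsto (fun k : ℕ => (((2 : ℝ) ^ k) ^ N)⁻¹ * ∫ y in annu N (2 ^ k), w y ^ s) atTop
      (𝓝 0)) :
    Tendsto (fun k : ℕ => (((2 : ℝ) ^ k) ^ N)⁻¹ * ∫ y in annu N (2 ^ k), w y) atTop (𝓝 0) := by
  set ω := (volume (closedBall (0 : Euc N) 1)).toReal with hω
  have hω0 : 0 ≤ ω := ENNReal.toReal_nonneg
  have hws : Continuous fun y => w y ^ s := hw.rpow_const fun x => Or.inr (by linarith)
  refine tendsto_order.2 ⟨fun c hc => Eventually.of_forall fun k => lt_of_lt_of_le hc ?_,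
    fun c hc => ?_⟩
  · exact mul_nonneg (by positivity) (setIntegral_nonneg (measurableSet_annu _) fun x _ => hw0 x)
  set l := c / (2 * (ω + 1)) with hl
  have hl0 : 0 < l := by positivity
  have hlω : l * ω < c / 2 + c / 4 := by
    have : l * (ω + 1) = c / 2 := by rw [hl]; field_simp
    nlinarith
  have h1 := (tendsto_order.1 (h.const_mul (l ^ (1 - s)))).2 (c / 4) (by simpa using by linarith)
  filter_upwards [h1] with k hk
  set R : ℝ := 2 ^ k
  have hR : 0 < R := by positivity
  have i1 : IntegrableOn w (annu N R) := hw.continuousOn.integrableOn_compact (isCompact_annu R)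
  have i2 : IntegrableOn (fun y => w y ^ s) (annu N R) :=
    hws.continuousOn.integrableOn_compact (isCompact_annu R)
  have i3 : IntegrableOn (fun _ : Euc N => l) (annu N R) :=
    continuousOn_const.integrableOn_compact (isCompact_annu R)
  have h2 : ∫ y in annu N R, w y ≤ ∫ y in annu N R, (l + l ^ (1 - s) * w y ^ s) :=
    setIntegral_mono i1 (i3.add (i2.const_mul _)) fun y => le_add_mul_rpow (hw0 y) hl0 hs
  rw [integral_add i3 (i2.const_mul _), integral_const_mul] at h2
  have h3 := setIntegral_annu_const (N := N) hR.le hl0.le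
  rw [← hω] at h3
  have h4 : (R ^ N)⁻¹ * ∫ y in annu N R, w y ≤ (R ^ N)⁻¹ * (l * (R ^ N * ω) +
      l ^ (1 - s) * ∫ y in annu N R, w y ^ s) :=
    mul_le_mul_of_nonneg_left (by linarith) (by positivity)
  have h5 : (R ^ N)⁻¹ * (l * (R ^ N * ω) + l ^ (1 - s) * ∫ y in annu N R, w y ^ s) =
      l * ω + l ^ (1 - s) * ((R ^ N)⁻¹ * ∫ y in annu N R, w y ^ s) := by
    field_simp
  linarith

lemma integrable_of_lintegral {f : Euc N → ℝ} (hf : AEMeasurable f) (hf0 : ∀ᵐ x, 0 ≤ f x)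
    (h : ∫⁻ x, ENNReal.ofReal (f x) < ⊤) : Integrable f :=
  ⟨hf.aestronglyMeasurable, (hasFiniteIntegral_iff_ofReal hf0).2 h⟩

end Averages

/-- The data of a positive solution together with its integral representation. -/
structure HLERep (N : ℕ) (p q a b : ℝ) (u v : Euc N → ℝ) : Prop where
  hN : 3 ≤ N
  hp : 0 < p
  hq : 0 < q
  hpq : 1 < p * q
  ha : -2 < a
  hb : -2 < b
  u_pos : ∀ x, 0 < u x
  v_pos : ∀ x, 0 < v x
  u_cont : Continuous u
  v_cont : Continuous v
  u_C2 : ContDiffOn ℝ 2 u {x | x ≠ 0}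
  v_C2 : ContDiffOn ℝ 2 v {x | x ≠ 0}
  u_eq : ∀ x, x ≠ 0 → -lap u x = ‖x‖ ^ a * v x ^ p
  v_eq : ∀ x, x ≠ 0 → -lap v x = ‖x‖ ^ b * u x ^ q
  u_rep : ∀ x, ∫⁻ y, ENNReal.ofReal (gam N 0 (x - y) * (‖y‖ ^ a * v y ^ p)) =
    ENNReal.ofReal (kap N * u x)
  v_rep : ∀ x, ∫⁻ y, ENNReal.ofReal (gam N 0 (x - y) * (‖y‖ ^ b * u y ^ q)) =
    ENNReal.ofReal (kap N * v x)

lemma HLERep.symm {N : ℕ} {p q a b : ℝ} {u v : Euc N → ℝ} (h : HLERep N p q a b u v) :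
    HLERep N q p b a v u :=
  ⟨h.hN, h.hq, h.hp, by linarith [h.hpq, mul_comm p q], h.hb, h.ha, h.v_pos, h.u_pos, h.v_cont,
    h.u_cont, h.v_C2, h.u_C2, h.v_eq, h.u_eq, h.v_rep, h.u_rep⟩

section Sources

open Filter Topology

variable {N : ℕ}

/-- The source term `|x|^a v^p`. -/
def src (a p : ℝ) (v : Euc N → ℝ) (x : Euc N) : ℝ := ‖x‖ ^ a * v x ^ p

lemma src_nonneg {a p : ℝ} {v : Euc N → ℝ} (hv : ∀ x, 0 ≤ v x) (x : Euc N) : 0 ≤ src a p v x :=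
  mul_nonneg (by positivity) (Real.rpow_nonneg (hv x) _)

lemma src_pos {a p : ℝ} {v : Euc N → ℝ} (hv : ∀ x, 0 < v x) {x : Euc N} (hx : x ≠ 0) :
    0 < src a p v x :=
  mul_pos (Real.rpow_pos_of_pos (norm_pos_iff.2 hx) _) (Real.rpow_pos_of_pos (hv x) _)

lemma continuousOn_norm_rpow (c : ℝ) : ContinuousOn (fun x : Euc N => ‖x‖ ^ c) {x | x ≠ 0} :=
  continuous_norm.continuousOn.rpow_const fun _ hx => Or.inl (norm_ne_zero_iff.2 hx)

lemma continuousOn_src {a p : ℝ} {v : Euc N → ℝ} (hv : Continuous v) (hv0 : ∀ x, 0 < v x) :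
    ContinuousOn (src a p v) {x | x ≠ 0} :=
  (continuousOn_norm_rpow a).mul
    (hv.rpow_const fun x => Or.inl (hv0 x).ne').continuousOn

lemma annu_subset_ne_zero {R : ℝ} (hR : 0 < R) : annu N R ⊆ {x | x ≠ 0} := by
  rintro x hx rfl
  have := hx.1
  rw [norm_zero] at this
  linarith

lemma integrableOn_annu {f : Euc N → ℝ} (hf : ContinuousOn f {x | x ≠ 0}) {R : ℝ} (hR : 0 < R) :
    IntegrableOn f (annu N R) :=
  (hf.mono (annu_subset_ne_zero hR)).integrableOn_compact (isCompact_annu R)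

lemma aemeasurable_gam_mul (hN : 3 ≤ N) {F : Euc N → ℝ} (hF : ContinuousOn F {x | x ≠ 0})
    (x : Euc N) : AEMeasurable fun y => gam N 0 (x - y) * F y :=
  (((measurable_gam 0).comp (continuous_const.sub continuous_id).measurable).aemeasurable).mul
    (aemeasurable_of_continuousOn_ne_zero hN hF)

theorem hleRep_of_averages {p q a b : ℝ} {u v : Euc N → ℝ} (hN : 3 ≤ N) (hp : 1 ≤ p)
    (hq : 0 < q) (hpq : 1 < p * q) (ha : -2 < a) (hb : -2 < b)
    (hsol : IsHLESol p q a b u v) (hu : ∀ x, 0 < u x) (hv : ∀ x, 0 < v x)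
    {s : ℝ} (hs : 1 ≤ s) (hus : ∫⁻ x, ENNReal.ofReal (u x ^ s) < ⊤) :
    HLERep N p q a b u v := by
  obtain ⟨u_C2, v_C2, u_cont, v_cont, eu, ev⟩ := hsol
  have u_eq : ∀ x, x ≠ 0 → -lap u x = ‖x‖ ^ a * v x ^ p := fun x hx => by
    rw [eu x hx, abs_of_pos (hv x), ← Real.rpow_add_one (hv x).ne', sub_add_cancel]
  have v_eq : ∀ x, x ≠ 0 → -lap v x = ‖x‖ ^ b * u x ^ q := fun x hx => by
    rw [ev x hx, abs_of_pos (hu x), ← Real.rpow_add_one (hu x).ne', sub_add_cancel]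
  have hpow : Tendsto (fun k : ℕ => (((2 : ℝ) ^ k) ^ N)⁻¹) atTop (𝓝 0) := by
    refine Tendsto.inv_tendsto_atTop ((tendsto_pow_atTop (by omega)).comp
      (tendsto_pow_atTop_atTop_of_one_lt (by norm_num)))
  -- bounded masses give vanishing averages
  have key : ∀ {f : ℕ → ℝ} {C : ℝ}, (∀ k, 0 ≤ f k) → (∀ k, f k ≤ C) → ∀ {g : ℕ → ℝ},
      Tendsto g atTop (𝓝 0) → (∀ k, 0 ≤ g k) → Tendsto (fun k => g k * f k) atTop (𝓝 0) := by
    intro f C hf0 hfC g hg hg0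
    have := hg.mul_const C
    rw [zero_mul] at this
    exact squeeze_zero (fun k => mul_nonneg (hg0 k) (hf0 k))
      (fun k => mul_le_mul_of_nonneg_left (hfC k) (hg0 k)) this
  have us_cont : Continuous fun x => u x ^ s := u_cont.rpow_const fun x => Or.inl (hu x).ne'
  have us_int : Integrable fun x => u x ^ s :=
    integrable_of_lintegral us_cont.measurable.aemeasurable
      (ae_of_all _ fun x => Real.rpow_nonneg (hu x).le _) hus
  have avg_u := tendsto_average_of_rpow u_cont (fun x => (hu x).le) hs
    (key (f := fun k => ∫ y in annu N (2 ^ k), u y ^ s) (C := ∫ y, u y ^ s)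
      (fun k => integral_nonneg fun x => Real.rpow_nonneg (hu x).le _)
      (fun k => setIntegral_le_integral us_int
        (ae_of_all _ fun x => Real.rpow_nonneg (hu x).le _)) hpow (fun k => by positivity))
  have u_rep := lintegral_gam_mul hN u_cont (fun x => (hu x).le) u_C2 u_eq
    (fun x hx => (src_pos hv hx).le) avg_u
  have hFint : Integrable fun y => gam N 0 (0 - y) * src a p v y :=
    integrable_of_lintegral (aemeasurable_gam_mul hN (continuousOn_src v_cont hv) 0)
      (ae_of_all _ fun y => mul_nonneg (gam_nonneg le_rfl _) (src_nonneg (fun x => (hv x).le) y))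
      (by rw [show ∫⁻ y, ENNReal.ofReal (gam N 0 (0 - y) * src a p v y) = _ from u_rep 0]
          exact ENNReal.ofReal_lt_top)
  have avg_v := tendsto_average_of_rpow v_cont (fun x => (hv x).le) hp (by
    have hg : Tendsto (fun k : ℕ => ((2 : ℝ) ^ k) ^ (-(a + 2))) atTop (𝓝 0) :=
      (tendsto_rpow_neg_atTop (by linarith)).comp
        (tendsto_pow_atTop_atTop_of_one_lt (by norm_num))
    have := key (f := fun k : ℕ => ((2 : ℝ) ^ k) ^ (a + 2 - N) * ∫ y in annu N (2 ^ k), v y ^ p)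
      (C := 2 ^ |a + 2 - N| * ∫ y, gam N 0 (0 - y) * src a p v y) ?_ ?_ hg
      (fun k => by positivity)
    · refine this.congr fun k => ?_
      rw [← mul_assoc, ← Real.rpow_add (by positivity),
        show -(a + 2) + (a + 2 - N) = -(N : ℝ) by ring, Real.rpow_neg (by positivity),
        Real.rpow_natCast]
    · intro k
      have : 0 ≤ ∫ y in annu N (2 ^ k), v y ^ p :=
        integral_nonneg fun x => Real.rpow_nonneg (hv x).le _
      positivity
    · intro k
      have hR : (0 : ℝ) < 2 ^ k := by positivity
      have vp_cont : Continuous fun y => v y ^ p := v_cont.rpow_const fun x => Or.inl (hv x).ne'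
      rw [← integral_const_mul, ← integral_const_mul]
      refine le_trans (setIntegral_mono_on
        ((vp_cont.continuousOn.integrableOn_compact (isCompact_annu _)).const_mul _)
        (hFint.const_mul (2 ^ |a + 2 - N|)).integrableOn (measurableSet_annu _) ?_)
        (setIntegral_le_integral (hFint.const_mul _) (ae_of_all _ fun y => ?_))
      · intro y hy
        have hy0 : 0 < ‖y‖ := norm_pos_iff.2 (annu_subset_ne_zero hR hy)
        have h1 := le_rpow_of_mem_annu hR (a + 2 - N) hy.1 (hy.2.trans (by linarith))
        rw [zero_sub, gam_neg, gam_zero, src, ← mul_assoc (‖y‖ ^ _), ← Real.rpow_add hy0,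
          show -((N : ℝ) - 2) + a = a + 2 - N by ring, ← mul_assoc]
        exact mul_le_mul_of_nonneg_right h1 (Real.rpow_nonneg (hv y).le _)
      · exact mul_nonneg (by positivity)
          (mul_nonneg (gam_nonneg le_rfl _) (src_nonneg (fun x => (hv x).le) y)))
  have v_rep := lintegral_gam_mul hN v_cont (fun x => (hv x).le) v_C2 v_eq
    (fun x hx => (src_pos hu hx).le) avg_v
  exact ⟨hN, by linarith, hq, hpq, ha, hb, hu, hv, u_cont, v_cont, u_C2, v_C2, u_eq, v_eq,
    u_rep, v_rep⟩

end Sources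

namespace HLERep

open Filter Topology

variable {N : ℕ} {p q a b : ℝ} {u v : Euc N → ℝ}

lemma src_nn (h : HLERep N p q a b u v) (x : Euc N) : 0 ≤ src a p v x :=
  src_nonneg (fun x => (h.v_pos x).le) x

lemma src_cont (h : HLERep N p q a b u v) : ContinuousOn (src a p v) {x | x ≠ 0} :=
  continuousOn_src h.v_cont h.v_pos

lemma src_aemeas (h : HLERep N p q a b u v) : AEMeasurable (src a p v) :=
  aemeasurable_of_continuousOn_ne_zero h.hN h.src_cont

lemma kap_pos (h : HLERep N p q a b u v) : 0 < kap N := _root_.kap_pos h.hN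

lemma integrable (h : HLERep N p q a b u v) (x : Euc N) :
    Integrable fun y => gam N 0 (x - y) * src a p v y :=
  integrable_of_lintegral (aemeasurable_gam_mul h.hN h.src_cont x)
    (ae_of_all _ fun y => mul_nonneg (gam_nonneg le_rfl _) (h.src_nn y))
    (by rw [show ∫⁻ y, ENNReal.ofReal (gam N 0 (x - y) * src a p v y) = _ from h.u_rep x]
        exact ENNReal.ofReal_lt_top)

lemma integral_eq (h : HLERep N p q a b u v) (x : Euc N) :
    ∫ y, gam N 0 (x - y) * src a p v y = kap N * u x := by
  rw [integral_eq_lintegral_of_nonneg_ae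
    (ae_of_all _ fun y => mul_nonneg (gam_nonneg le_rfl _) (h.src_nn y))
    (h.integrable x).aestronglyMeasurable]
  rw [show ∫⁻ y, ENNReal.ofReal (gam N 0 (x - y) * src a p v y) = _ from h.u_rep x,
    ENNReal.toReal_ofReal (mul_nonneg h.kap_pos.le (h.u_pos x).le)]

end HLERep

section Hat

open Filter Topology

variable {N : ℕ}

/-- The averaged Newtonian potential of `F` at radius `R`. -/
def hat (F : Euc N → ℝ) (R : ℝ) : ℝ := ∫ y, F y * max R ‖y‖ ^ (-((N : ℝ) - 2))

lemma setIntegral_union_le {f : Euc N → ℝ} {s t : Set (Euc N)} (hs : MeasurableSet s)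
    (ht : MeasurableSet t) (hf : ∀ x, 0 ≤ f x) (his : IntegrableOn f s) (hit : IntegrableOn f t) :
    ∫ x in s ∪ t, f x ≤ (∫ x in s, f x) + ∫ x in t, f x := by
  rw [← union_sdiff_self, setIntegral_union disjoint_sdiff_right (ht.diff hs) his
    (hit.mono_set sdiff_subset)]
  gcongr
  · exact ae_of_all _ hf
  · exact sdiff_subset

lemma le_volume_annu (hN : 3 ≤ N) {R : ℝ} (hR : 0 ≤ R) :
    R ^ N * ((volume (closedBall (0 : Euc N) 1)).toReal / 2) ≤ (volume (annu N R)).toReal := by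
  have h1 : closedBall (0 : Euc N) R ⊆ annu N R ∪ closedBall 0 (R / 2) := by
    intro y hy
    rw [mem_closedBall_zero_iff] at hy
    rcases le_total (R / 2) ‖y‖ with h | h
    · exact Or.inl ⟨h, hy⟩
    · exact Or.inr (by simpa using h)
  have hfin : volume (annu N R) ≠ ⊤ := (isCompact_annu R).measure_lt_top.ne
  have h2 : (volume (closedBall (0 : Euc N) R)).toReal ≤
      (volume (annu N R)).toReal + (volume (closedBall (0 : Euc N) (R / 2))).toReal := by
    rw [← ENNReal.toReal_add hfin measure_closedBall_lt_top.ne]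
    exact ENNReal.toReal_mono (ENNReal.add_ne_top.2 ⟨hfin, measure_closedBall_lt_top.ne⟩)
      ((measure_mono h1).trans (measure_union_le _ _))
  rw [volume_closedBall_real hR, volume_closedBall_real (r := R / 2) (by linarith)] at h2
  have h3 : (R / 2) ^ N ≤ R ^ N / 2 := by
    rw [div_pow]
    have : (2 : ℝ) ≤ 2 ^ N := by
      calc (2 : ℝ) = 2 ^ 1 := by norm_num
        _ ≤ 2 ^ N := pow_le_pow_right₀ (by norm_num) (by omega)
    gcongr
  have h4 : (0 : ℝ) ≤ (volume (closedBall (0 : Euc N) 1)).toReal := ENNReal.toReal_nonneg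
  have := mul_le_mul_of_nonneg_right h3 h4
  linarith

lemma volume_unit_pos : 0 < (volume (closedBall (0 : Euc N) 1)).toReal :=
  ENNReal.toReal_pos (measure_closedBall_pos _ _ one_pos).ne' measure_closedBall_lt_top.ne

end Hat

namespace HLERep

open Filter Topology

variable {N : ℕ} {p q a b : ℝ} {u v : Euc N → ℝ}

lemma two_le (h : HLERep N p q a b u v) : (0 : ℝ) ≤ (N : ℝ) - 2 := by
  have : (3 : ℝ) ≤ N := by exact_mod_cast h.hN
  linarith

lemma integrable_norm (h : HLERep N p q a b u v) :
    Integrable fun y => src a p v y * ‖y‖ ^ (-((N : ℝ) - 2)) := by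
  refine (h.integrable 0).congr (ae_of_all _ fun y => ?_)
  simp only
  rw [zero_sub, gam_neg, gam_zero, mul_comm]

lemma hat_integrand_le (h : HLERep N p q a b u v) (R : ℝ) {y : Euc N} (hy : y ≠ 0) :
    src a p v y * max R ‖y‖ ^ (-((N : ℝ) - 2)) ≤ src a p v y * ‖y‖ ^ (-((N : ℝ) - 2)) :=
  mul_le_mul_of_nonneg_left (Real.rpow_le_rpow_of_nonpos (norm_pos_iff.2 hy) (le_max_right _ _)
    (by linarith [h.two_le])) (h.src_nn y)

lemma hat_integrand_nonneg (h : HLERep N p q a b u v) (R : ℝ) (y : Euc N) :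
    0 ≤ src a p v y * max R ‖y‖ ^ (-((N : ℝ) - 2)) :=
  mul_nonneg (h.src_nn y) (Real.rpow_nonneg (le_max_of_le_right (norm_nonneg _)) _)

lemma hat_integrable (h : HLERep N p q a b u v) {R : ℝ} (hR : 0 < R) :
    Integrable fun y => src a p v y * max R ‖y‖ ^ (-((N : ℝ) - 2)) := by
  refine h.integrable_norm.mono' ?_ ?_
  · have : Continuous fun y : Euc N => max R ‖y‖ ^ (-((N : ℝ) - 2)) :=
      (continuous_const.max continuous_norm).rpow_const
        fun x => Or.inl (lt_of_lt_of_le hR (le_max_left _ _)).ne'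
    exact (h.src_aemeas.mul this.measurable.aemeasurable).aestronglyMeasurable
  · filter_upwards [ae_ne_zero h.hN 0] with y hy
    rw [Real.norm_of_nonneg (h.hat_integrand_nonneg R y)]
    exact h.hat_integrand_le R hy

lemma hat_nonneg (h : HLERep N p q a b u v) (R : ℝ) : 0 ≤ hat (src a p v) R :=
  integral_nonneg fun y => h.hat_integrand_nonneg R y

lemma hat_pos (h : HLERep N p q a b u v) {R : ℝ} (hR : 0 < R) : 0 < hat (src a p v) R := by
  refine (h.hat_nonneg R).lt_of_ne fun h0 => ?_
  have h1 := (integral_eq_zero_iff_of_nonneg (fun y => h.hat_integrand_nonneg R y)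
    (h.hat_integrable hR)).1 h0.symm
  have : Nonempty (Fin N) := ⟨⟨0, by have := h.hN; omega⟩⟩
  have hne : (volume : Measure (Euc N)) ≠ 0 := NeZero.ne _
  refine hne (ae_eq_bot.1 (eventually_false_iff_eq_bot.1 ?_))
  filter_upwards [h1, ae_ne_zero h.hN 0] with y hy hy0
  have : 0 < src a p v y * max R ‖y‖ ^ (-((N : ℝ) - 2)) :=
    mul_pos (src_pos h.v_pos hy0) (Real.rpow_pos_of_pos (lt_max_of_lt_left hR) _)
  exact this.ne' hy

lemma hat_le (h : HLERep N p q a b u v) {R : ℝ} (hR : 0 < R) {x : Euc N} (hx : ‖x‖ ≤ R) :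
    hat (src a p v) R ≤ 2 ^ ((N : ℝ) - 2) * (kap N * u x) := by
  rw [← h.integral_eq x, ← integral_const_mul]
  refine integral_mono_ae (h.hat_integrable hR) ((h.integrable x).const_mul _) ?_
  filter_upwards [ae_ne_zero h.hN x] with y hy
  rw [mul_comm (gam _ _ _), mul_left_comm]
  refine mul_le_mul_of_nonneg_left ?_ (h.src_nn y)
  have h1 : 0 < max R ‖y‖ := lt_max_of_lt_left hR
  have h2 : ‖x - y‖ ≤ 2 * max R ‖y‖ := by
    have := norm_sub_le x y
    have := le_max_left R ‖y‖
    have := le_max_right R ‖y‖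
    linarith
  calc max R ‖y‖ ^ (-((N : ℝ) - 2))
      = 2 ^ ((N : ℝ) - 2) * (2 * max R ‖y‖) ^ (-((N : ℝ) - 2)) := by
        rw [Real.mul_rpow (by norm_num) h1.le, ← mul_assoc, ← Real.rpow_add (by norm_num)]
        simp
    _ ≤ _ := mul_le_mul_of_nonneg_left (le_gam_zero h.hN (sub_ne_zero.2 hy.symm) h2)
        (by positivity)

lemma mass_le (h : HLERep N p q a b u v) {R : ℝ} (hR : 0 < R) :
    ∫ y in annu N R, src a p v y ≤ R ^ ((N : ℝ) - 2) * hat (src a p v) R := by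
  rw [hat, ← integral_const_mul]
  refine le_trans (setIntegral_mono_on (integrableOn_annu h.src_cont hR)
    ((h.hat_integrable hR).const_mul _).integrableOn (measurableSet_annu R) fun y hy => ?_)
    (setIntegral_le_integral ((h.hat_integrable hR).const_mul _) (ae_of_all _ fun y =>
      mul_nonneg (by positivity) (h.hat_integrand_nonneg R y)))
  rw [max_eq_left hy.2, mul_left_comm, ← Real.rpow_add hR]
  simp

/-- The averaged potentials control each other. -/
lemma exists_hat_rpow_le (h : HLERep N p q a b u v) : ∃ C, 0 < C ∧ ∀ R, 0 < R →
    R ^ (a + 2) * hat (src b q u) R ^ p ≤ C * hat (src a p v) R := by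
  set ω := (volume (closedBall (0 : Euc N) 1)).toReal with hω
  have hω0 : 0 < ω := volume_unit_pos
  have hk := h.kap_pos
  set c : ℝ := 2 ^ ((N : ℝ) - 2) * kap N with hc
  have hc0 : 0 < c := by positivity
  refine ⟨2 ^ |a| * c ^ p * (2 / ω), by positivity, fun R hR => ?_⟩
  set H := hat (src b q u) R with hH
  have hH0 : 0 < H := h.symm.hat_pos hR
  have hp := h.hp
  have hpt : ∀ y ∈ annu N R, (2 ^ |a|)⁻¹ * R ^ a * (H / c) ^ p ≤ src a p v y := by
    intro y hy
    have h1 := le_rpow_of_mem_annu hR a hy.1 (hy.2.trans (by linarith))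
    have h2 : H / c ≤ v y := by
      rw [div_le_iff₀ hc0]
      have := h.symm.hat_le hR hy.2
      rw [hc]; linarith
    have h3 : (H / c) ^ p ≤ v y ^ p := Real.rpow_le_rpow (by positivity) h2 hp.le
    have h4 : (2 ^ |a|)⁻¹ * R ^ a ≤ ‖y‖ ^ a := by
      rw [inv_mul_le_iff₀ (by positivity)]; exact h1
    exact mul_le_mul h4 h3 (by positivity) (by positivity)
  have h5 : (volume (annu N R)).toReal * ((2 ^ |a|)⁻¹ * R ^ a * (H / c) ^ p) ≤
      ∫ y in annu N R, src a p v y := by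
    have := setIntegral_mono_on (integrableOn_const (isCompact_annu R).measure_lt_top.ne)
      (integrableOn_annu h.src_cont hR) (measurableSet_annu R) hpt
    rwa [setIntegral_const, smul_eq_mul] at this
  have h6 := h.mass_le hR
  have h7 := mul_le_mul_of_nonneg_right (le_volume_annu h.hN hR.le)
    (show 0 ≤ (2 ^ |a|)⁻¹ * R ^ a * (H / c) ^ p by positivity)
  have h8 : R ^ N * (ω / 2) * ((2 ^ |a|)⁻¹ * R ^ a * (H / c) ^ p) ≤
      R ^ ((N : ℝ) - 2) * hat (src a p v) R := h7.trans (h5.trans h6)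
  rw [Real.div_rpow hH0.le hc0.le] at h8
  have e1 : (R ^ N : ℝ) = R ^ ((N : ℝ) - 2) * R ^ (2 : ℝ) := by
    rw [← Real.rpow_add hR, ← Real.rpow_natCast]; congr 1; ring
  rw [e1, mul_assoc, mul_assoc] at h8
  have h9 := le_of_mul_le_mul_left h8 (by positivity)
  rw [Real.rpow_add hR]
  have e2 : R ^ a * R ^ (2 : ℝ) * H ^ p = 2 ^ |a| * c ^ p * (2 / ω) *
      (R ^ (2 : ℝ) * (ω / 2 * ((2 ^ |a|)⁻¹ * R ^ a * (H ^ p / c ^ p)))) := by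
    field_simp
  rw [e2]
  exact mul_le_mul_of_nonneg_left h9 (by positivity)

/-- Decay of the averaged potential under an integrability condition. -/
lemma tendsto_hat (h : HLERep N p q a b u v) {s : ℝ} (hs : 0 < s)
    (hus : ∫⁻ x, ENNReal.ofReal (u x ^ s) < ⊤) :
    Tendsto (fun k : ℕ => ((2 : ℝ) ^ k) ^ ((N : ℝ) / s) * hat (src a p v) (2 ^ k)) atTop
      (𝓝 0) := by
  have us_cont : Continuous fun x => u x ^ s := h.u_cont.rpow_const fun x => Or.inl (h.u_pos x).ne'
  have us0 : ∀ x, 0 ≤ u x ^ s := fun x => Real.rpow_nonneg (h.u_pos x).le _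
  have us_int : Integrable fun x => u x ^ s :=
    integrable_of_lintegral us_cont.measurable.aemeasurable (ae_of_all _ us0) hus
  have hpow : Tendsto (fun k : ℕ => (2 : ℝ) ^ k) atTop atTop :=
    tendsto_pow_atTop_atTop_of_one_lt (by norm_num)
  have ht : Tendsto (fun k : ℕ => ∫ x in annu N (2 ^ k), u x ^ s) atTop (𝓝 0) := by
    have := tendsto_integral_of_dominated_convergence (F := fun (k : ℕ) x =>
      (annu N (2 ^ k)).indicator (fun x => u x ^ s) x) (f := fun _ => 0) (μ := volume)
      (fun x => u x ^ s)
      (fun k => (us_int.indicator (measurableSet_annu _)).aestronglyMeasurable) us_int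
      (fun k => ae_of_all _ fun x => by
        rw [Real.norm_of_nonneg (indicator_nonneg (fun x _ => us0 x) x)]
        exact indicator_le_self' (fun x _ => us0 x) x)
      (ae_of_all _ fun x => by
        refine tendsto_const_nhds.congr' ?_
        filter_upwards [hpow.eventually_gt_atTop (2 * ‖x‖)] with k hk
        rw [indicator_of_notMem]
        intro hx
        linarith [hx.1])
    simp_rw [integral_indicator (measurableSet_annu _), integral_zero] at this
    exact this
  set ω := (volume (closedBall (0 : Euc N) 1)).toReal with hω
  have hω0 : 0 < ω := volume_unit_pos
  have hk := h.kap_pos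
  set c : ℝ := 2 ^ ((N : ℝ) - 2) * kap N with hc
  have hc0 : 0 < c := by positivity
  have hbound : ∀ k : ℕ, (((2 : ℝ) ^ k) ^ ((N : ℝ) / s) * hat (src a p v) (2 ^ k)) ≤
      (c ^ s * (2 / ω) * ∫ x in annu N (2 ^ k), u x ^ s) ^ (1 / s) := by
    intro k
    have hR : (0 : ℝ) < 2 ^ k := by positivity
    set R : ℝ := 2 ^ k
    have hH0 := h.hat_pos hR
    set H := hat (src a p v) R with hH
    have h5 : (volume (annu N R)).toReal * (H / c) ^ s ≤ ∫ y in annu N R, u y ^ s := by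
      have := setIntegral_mono_on (integrableOn_const (isCompact_annu R).measure_lt_top.ne)
        us_int.integrableOn (measurableSet_annu R) (f := fun _ => (H / c) ^ s) fun y hy => by
          refine Real.rpow_le_rpow (by positivity) ?_ hs.le
          rw [div_le_iff₀ hc0]
          have := h.hat_le hR hy.2
          rw [hc]; linarith
      rwa [setIntegral_const, smul_eq_mul] at this
    have h7 := mul_le_mul_of_nonneg_right (le_volume_annu h.hN hR.le)
      (show 0 ≤ (H / c) ^ s by positivity)
    rw [← hω] at h7
    rw [one_div, Real.le_rpow_inv_iff_of_pos (by positivity)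
      (mul_nonneg (by positivity) (integral_nonneg us0)) hs,
      Real.mul_rpow (by positivity) hH0.le, ← Real.rpow_mul hR.le, div_mul_cancel₀ _ hs.ne',
      Real.rpow_natCast]
    calc R ^ N * H ^ s = c ^ s * (2 / ω) * (R ^ N * (ω / 2) * (H / c) ^ s) := by
          rw [Real.div_rpow hH0.le hc0.le]; field_simp
      _ ≤ _ := mul_le_mul_of_nonneg_left (h7.trans h5) (by positivity)
  have hlim : Tendsto (fun k : ℕ => (c ^ s * (2 / ω) * ∫ x in annu N (2 ^ k), u x ^ s) ^ (1 / s))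
      atTop (𝓝 0) := by
    have := (ht.const_mul (c ^ s * (2 / ω))).rpow_const (p := 1 / s) (Or.inr (by positivity))
    rwa [mul_zero, Real.zero_rpow (by positivity)] at this
  exact squeeze_zero (fun k => mul_nonneg (by positivity) (h.hat_nonneg _)) hbound hlim

lemma integrableOn_closedBall (h : HLERep N p q a b u v) {R : ℝ} (hR : 0 < R) :
    IntegrableOn (src a p v) (closedBall 0 R) := by
  refine (((h.hat_integrable hR).const_mul (R ^ ((N : ℝ) - 2))).integrableOn).congr_fun
    (fun y hy => ?_) measurableSet_closedBall
  have : ‖y‖ ≤ R := by simpa using hy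
  simp only
  rw [max_eq_left this, mul_left_comm, ← Real.rpow_add hR]
  simp

lemma hat_eq (h : HLERep N p q a b u v) {R : ℝ} (hR : 0 < R) :
    hat (src a p v) R = R ^ (-((N : ℝ) - 2)) * (∫ y in closedBall 0 R, src a p v y) +
      ∫ y in (closedBall 0 R)ᶜ, src a p v y * ‖y‖ ^ (-((N : ℝ) - 2)) := by
  rw [hat, ← integral_add_compl measurableSet_closedBall (h.hat_integrable hR),
    ← integral_const_mul]
  congr 1
  · refine setIntegral_congr_fun measurableSet_closedBall fun y hy => ?_
    have : ‖y‖ ≤ R := by simpa using hy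
    rw [max_eq_left this, mul_comm]
  · refine setIntegral_congr_fun measurableSet_closedBall.compl fun y hy => ?_
    have : R < ‖y‖ := by simpa using hy
    rw [max_eq_right this.le]

lemma ball_le (h : HLERep N p q a b u v) {R : ℝ} (hR : 0 < R) :
    ∫ y in closedBall 0 (2 * R), src a p v y ≤
      (∫ y in closedBall 0 R, src a p v y) + ∫ y in annu N (2 * R), src a p v y := by
  refine le_trans (setIntegral_mono_set ?_ (ae_of_all _ h.src_nn) (LE.le.eventuallyLE ?_))
    (setIntegral_union_le measurableSet_closedBall (measurableSet_annu _) h.src_nn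
      (h.integrableOn_closedBall hR) (integrableOn_annu h.src_cont (by positivity)))
  · exact (h.integrableOn_closedBall hR).union (integrableOn_annu h.src_cont (by positivity))
  · intro y hy
    rw [mem_closedBall_zero_iff] at hy
    rcases le_total ‖y‖ R with hy2 | hy2
    · exact Or.inl (by simpa using hy2)
    · exact Or.inr ⟨by linarith, hy⟩

lemma tail_le (h : HLERep N p q a b u v) {R : ℝ} (hR : 0 < R) :
    ∫ y in (closedBall 0 R)ᶜ, src a p v y * ‖y‖ ^ (-((N : ℝ) - 2)) ≤
      (∫ y in (closedBall 0 (2 * R))ᶜ, src a p v y * ‖y‖ ^ (-((N : ℝ) - 2))) +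
        R ^ (-((N : ℝ) - 2)) * ∫ y in annu N (2 * R), src a p v y := by
  have nn : ∀ y, 0 ≤ src a p v y * ‖y‖ ^ (-((N : ℝ) - 2)) := fun y =>
    mul_nonneg (h.src_nn y) (by positivity)
  have hi := h.integrable_norm
  refine le_trans (setIntegral_mono_set hi.integrableOn (ae_of_all _ nn)
    (LE.le.eventuallyLE (t := (closedBall 0 (2 * R))ᶜ ∪ annu N (2 * R)) ?_))
    (le_trans (setIntegral_union_le measurableSet_closedBall.compl (measurableSet_annu _) nn
      hi.integrableOn hi.integrableOn) ?_)
  · intro y hy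
    simp only [mem_compl_iff, mem_closedBall_zero_iff, not_le] at hy
    rcases le_or_gt ‖y‖ (2 * R) with hy2 | hy2
    · exact Or.inr ⟨by linarith, hy2⟩
    · exact Or.inl (by simpa using hy2)
  · gcongr
    rw [← integral_const_mul]
    refine setIntegral_mono_on hi.integrableOn
      ((integrableOn_annu h.src_cont (by positivity)).const_mul _) (measurableSet_annu _)
      fun y hy => ?_
    rw [mul_comm]
    exact mul_le_mul_of_nonneg_right (Real.rpow_le_rpow_of_nonpos hR (by linarith [hy.1])
      (by linarith [h.two_le])) (h.src_nn y)

lemma tendsto_tail (h : HLERep N p q a b u v) :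
    Tendsto (fun k : ℕ => ∫ y in (closedBall 0 (2 ^ k))ᶜ, src a p v y * ‖y‖ ^ (-((N : ℝ) - 2)))
      atTop (𝓝 0) := by
  have hpow : Tendsto (fun k : ℕ => (2 : ℝ) ^ k) atTop atTop :=
    tendsto_pow_atTop_atTop_of_one_lt (by norm_num)
  have nn : ∀ y, 0 ≤ src a p v y * ‖y‖ ^ (-((N : ℝ) - 2)) := fun y =>
    mul_nonneg (h.src_nn y) (by positivity)
  have hi := h.integrable_norm
  have hm : ∀ k : ℕ, MeasurableSet (closedBall (0 : Euc N) (2 ^ k))ᶜ :=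
    fun k => measurableSet_closedBall.compl
  have := tendsto_integral_of_dominated_convergence (F := fun (k : ℕ) x =>
    ((closedBall (0 : Euc N) (2 ^ k))ᶜ).indicator
      (fun y => src a p v y * ‖y‖ ^ (-((N : ℝ) - 2))) x) (f := fun _ => 0) (μ := volume)
    _ (fun k => (hi.indicator (hm k)).aestronglyMeasurable) hi
    (fun k => ae_of_all _ fun x => by
      rw [Real.norm_of_nonneg (indicator_nonneg (fun x _ => nn x) x)]
      exact indicator_le_self' (fun x _ => nn x) x)
    (ae_of_all _ fun x => by
      refine tendsto_const_nhds.congr' ?_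
      filter_upwards [hpow.eventually_ge_atTop ‖x‖] with k hk
      rw [indicator_of_notMem]
      simpa using hk)
  simp_rw [integral_indicator (hm _), integral_zero] at this
  exact this

end HLERep

section Truncation

open Filter Topology

variable {N : ℕ}

/-- A smooth convex truncation of the positive part. -/
lemma exists_truncation {c : ℝ} (hc : 0 < c) : ∃ J : ℝ → ℝ, ContDiff ℝ 2 J ∧
    (∀ t, t ≤ c → J t = 0) ∧ (∀ t, 0 ≤ J t) ∧ (∀ t, t - 2 * c ≤ J t) ∧
    (∀ t, 0 ≤ deriv J t) ∧ (∀ t, deriv J t ≤ 1) ∧ ∀ t, 0 ≤ deriv (deriv J) t := by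
  set f : ℝ → ℝ := fun r => Real.smoothTransition (r / c - 1) with hf
  have hfC : ContDiff ℝ 1 f := Real.smoothTransition.contDiff.comp
    ((contDiff_id.div_const c).sub contDiff_const)
  have hfc : Continuous f := hfC.continuous
  have hf0 : ∀ r, r ≤ c → f r = 0 := fun r hr =>
    Real.smoothTransition.zero_of_nonpos (by rw [sub_nonpos, div_le_one hc]; exact hr)
  have hf1 : ∀ r, 2 * c ≤ r → f r = 1 := fun r hr =>
    Real.smoothTransition.one_of_one_le (by
      rw [le_sub_iff_add_le, le_div_iff₀ hc]; linarith)
  have hfm : Monotone f := fun r s hrs => Real.smoothTransition.monotone (by gcongr)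
  have hfn : ∀ r, 0 ≤ f r := fun r => Real.smoothTransition.nonneg _
  set J : ℝ → ℝ := fun t => ∫ r in (0 : ℝ)..t, f r with hJ
  have hderiv : deriv J = f := by
    ext t; exact hfc.deriv_integral f 0 t
  have hdiff : Differentiable ℝ J := fun t =>
    (hfc.integral_hasStrictDerivAt 0 t).hasDerivAt.differentiableAt
  have hJ0 : ∀ t, t ≤ c → J t = 0 := fun t ht => by
    have : EqOn f (fun _ => 0) (uIcc 0 t) := fun r hr =>
      hf0 r ((mem_uIcc.1 hr).elim (fun h => h.2.trans ht) fun h => h.2.trans hc.le)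
    simp only [hJ]
    rw [intervalIntegral.integral_congr this]
    simp
  have hJn : ∀ t, 0 ≤ J t := fun t => by
    rcases le_total t c with h | h
    · exact (hJ0 t h).ge
    · exact intervalIntegral.integral_nonneg (by linarith) fun r _ => hfn r
  refine ⟨J, ?_, hJ0, hJn, fun t => ?_, fun t => ?_, fun t => ?_, fun t => ?_⟩
  · rw [show (2 : WithTop ℕ∞) = 1 + 1 by norm_num, contDiff_succ_iff_deriv]
    exact ⟨hdiff, by simp, by rwa [hderiv]⟩
  · rcases le_total t (2 * c) with h | h
    · linarith [hJn t]
    · have h1 : J t = J (2 * c) + ∫ r in (2 * c)..t, f r :=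
        (intervalIntegral.integral_add_adjacent_intervals (hfc.intervalIntegrable _ _)
          (hfc.intervalIntegrable _ _)).symm
      have : EqOn f (fun _ => 1) (uIcc (2 * c) t) := fun r hr =>
        hf1 r ((uIcc_of_le h ▸ hr).1)
      rw [intervalIntegral.integral_congr this, intervalIntegral.integral_const] at h1
      simp only [smul_eq_mul, mul_one] at h1
      linarith [hJn (2 * c)]
  · rw [hderiv]; exact hfn t
  · rw [hderiv]; exact Real.smoothTransition.le_one _
  · rw [hderiv]; exact hfm.deriv_nonneg

/-- The closed shell `R (1 - t/2) ≤ |x| ≤ R (2 + t)`. -/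
def shell (N : ℕ) (R t : ℝ) : Set (Euc N) := {x | R * (1 - t / 2) ≤ ‖x‖ ∧ ‖x‖ ≤ R * (2 + t)}

lemma isClosed_shell (R t : ℝ) : IsClosed (shell N R t) :=
  (isClosed_le continuous_const continuous_norm).inter
    (isClosed_le continuous_norm continuous_const)

lemma isCompact_shell (R t : ℝ) : IsCompact (shell N R t) :=
  (isCompact_closedBall 0 (R * (2 + t))).of_isClosed_subset (isClosed_shell R t)
    fun x hx => by simpa using hx.2

lemma shell_mono {R s t : ℝ} (hR : 0 ≤ R) (hst : s ≤ t) : shell N R s ⊆ shell N R t :=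
  fun x hx => ⟨le_trans (by gcongr) hx.1, hx.2.trans (by gcongr)⟩

lemma exists_shell_cutoff {R s t : ℝ} (hR : 0 < R) (hst : s < t) :
    ∃ η : Euc N → ℝ, ContDiff ℝ 2 η ∧ (∀ x, 0 ≤ η x) ∧ (∀ x, η x ≤ 1) ∧
      (∀ x ∈ shell N R s, η x = 1) ∧ (∀ x, x ∉ shell N R t → η x = 0) ∧
      tsupport η ⊆ shell N R t := by
  have hc : IsClosed {x : Euc N | ‖x‖ ≤ R * (1 - t / 2) ∨ R * (2 + t) ≤ ‖x‖} :=
    (isClosed_le continuous_norm continuous_const).union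
      (isClosed_le continuous_const continuous_norm)
  have hd : Disjoint {x : Euc N | ‖x‖ ≤ R * (1 - t / 2) ∨ R * (2 + t) ≤ ‖x‖} (shell N R s) := by
    refine disjoint_left.2 fun x hx hx2 => ?_
    have h1 := hx2.1
    have h2 := hx2.2
    rcases hx with hx | hx <;> nlinarith
  obtain ⟨f, hf0, hf1, hf⟩ := exists_contMDiffMap_zero_one_of_isClosed
    (modelWithCornersSelf ℝ (Euc N)) (n := 2) hc (isClosed_shell R s) hd
  have hz : ∀ x, x ∉ shell N R t → f x = 0 := fun x hx => by
    refine hf0 ?_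
    by_contra hx2
    simp only [mem_ofPred_eq, not_or, not_le] at hx2
    exact hx ⟨hx2.1.le, hx2.2.le⟩
  refine ⟨f, f.contMDiff.contDiff, fun x => (hf x).1, fun x => (hf x).2, fun x hx => hf1 hx, hz,
    closure_minimal (fun x hx => ?_) (isClosed_shell R t)⟩
  by_contra hx2
  exact hx (hz x hx2)

lemma le_norm_sub_of_shell {R s t : ℝ} (hR : 0 < R) (hs : 0 ≤ s) (hst : s ≤ t) (ht : t ≤ 1)
    {x y : Euc N} (hx : x ∈ shell N R s) (hy : y ∉ shell N R t) :
    (t - s) / 3 * max R ‖y‖ ≤ ‖x - y‖ := by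
  have h1 := abs_norm_sub_norm_le x y
  have h2 := le_abs_self (‖x‖ - ‖y‖)
  have h3 := neg_le_abs (‖x‖ - ‖y‖)
  obtain ⟨hx1, hx2⟩ := hx
  have hyn := norm_nonneg y
  rcases lt_or_ge ‖y‖ (R * (1 - t / 2)) with h | h
  · rw [max_eq_left (by nlinarith)]
    nlinarith
  · have h4 : R * (2 + t) < ‖y‖ := by
      by_contra h5
      exact hy ⟨h, not_lt.1 h5⟩
    rw [max_eq_right (by nlinarith)]
    have h6 : R * (2 + t) * (1 - (t - s) / 3) ≤ ‖y‖ * (1 - (t - s) / 3) :=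
      mul_le_mul_of_nonneg_right h4.le (by linarith)
    have h7 : R * (2 + s) ≤ R * (2 + t) * (1 - (t - s) / 3) := by
      have : 0 ≤ R * ((t - s) * (1 - t)) :=
        mul_nonneg hR.le (mul_nonneg (by linarith) (by linarith))
      nlinarith
    linarith

/-- Symmetry of the Newtonian kernel. -/
lemma lintegral_gam_swap {f g : Euc N → ℝ} (hf : AEMeasurable f) (hg : AEMeasurable g) :
    ∫⁻ x, ENNReal.ofReal (g x) * ∫⁻ y, ENNReal.ofReal (gam N 0 (x - y) * f y) =
      ∫⁻ y, ENNReal.ofReal (f y) * ∫⁻ x, ENNReal.ofReal (gam N 0 (y - x) * g x) := by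
  have hm : ∀ x : Euc N, Measurable fun y => gam N 0 (x - y) := fun x =>
    (measurable_gam 0).comp (continuous_const.sub continuous_id).measurable
  have e1 : ∀ x, ENNReal.ofReal (g x) * ∫⁻ y, ENNReal.ofReal (gam N 0 (x - y) * f y) =
      ∫⁻ y, ENNReal.ofReal (g x) * ENNReal.ofReal (gam N 0 (x - y) * f y) := fun x =>
    (lintegral_const_mul'' _ (((hm x).aemeasurable.mul hf).ennreal_ofReal)).symm
  have e2 : ∀ y, ENNReal.ofReal (f y) * ∫⁻ x, ENNReal.ofReal (gam N 0 (y - x) * g x) =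
      ∫⁻ x, ENNReal.ofReal (f y) * ENNReal.ofReal (gam N 0 (y - x) * g x) := fun y =>
    (lintegral_const_mul'' _ (((hm y).aemeasurable.mul hg).ennreal_ofReal)).symm
  simp_rw [e1, e2]
  rw [lintegral_lintegral_swap]
  · refine lintegral_congr fun y => lintegral_congr fun x => ?_
    rw [ENNReal.ofReal_mul (gam_nonneg le_rfl _), ENNReal.ofReal_mul (gam_nonneg le_rfl _),
      show y - x = -(x - y) by abel, gam_neg]
    ring
  · have h1 : Measurable fun z : Euc N × Euc N => gam N 0 (z.1 - z.2) :=
      (measurable_gam 0).comp (measurable_fst.sub measurable_snd)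
    exact (hg.comp_fst.ennreal_ofReal).mul
      ((h1.aemeasurable.mul hf.comp_snd).ennreal_ofReal)

end Truncation

namespace HLERep

open Filter Topology

variable {N : ℕ} {p q a b : ℝ} {u v : Euc N → ℝ}

lemma src_C2 (h : HLERep N p q a b u v) : ContDiffOn ℝ 2 (src a p v) {x | x ≠ 0} := by
  intro x hx
  have h1 : ContDiffWithinAt ℝ 2 (fun x : Euc N => ‖x‖ ^ a) {x | x ≠ 0} x :=
    ((contDiffAt_norm ℝ hx).rpow_const_of_ne (norm_ne_zero_iff.2 hx)).contDiffWithinAt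
  exact h1.mul ((h.v_C2 x hx).rpow_const_of_ne (h.v_pos x).ne')

end HLERep

namespace HLERep

open Filter Topology

variable {N : ℕ} {p q a b : ℝ} {u v : Euc N → ℝ}

lemma inv_weight_mul_src_sq (h : HLERep N p q a b u v) {x : Euc N} (hx : x ≠ 0) (e : ℝ) :
    (q * ‖x‖ ^ b * u x ^ (q - 1))⁻¹ * (src b q u x * e) ^ 2 =
      q⁻¹ * (src b q u x * u x * e ^ 2) := by
  have hn : 0 < ‖x‖ := norm_pos_iff.2 hx
  have hu := h.u_pos x
  have hq := h.hq
  rw [src, show u x ^ q = u x ^ (q - 1) * u x by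
    rw [← Real.rpow_add_one hu.ne', sub_add_cancel]]
  have h1 := Real.rpow_pos_of_pos hn b
  have h2 := Real.rpow_pos_of_pos hu (q - 1)
  field_simp

lemma annulus_step (h : HLERep N p q a b u v) {R s t : ℝ} (hR : 0 < R) (hs : 0 ≤ s) (hst : s < t)
    (ht : t ≤ 1) (hstab : HLEStableOn p q a b u v {x | R / 4 < ‖x‖ ∧ ‖x‖ < 4 * R}) {c : ℝ}
    (hc : c = (kap N)⁻¹ * (27 / (t - s)) ^ ((N : ℝ) - 2) * hat (src b q u) R) :
    ∃ P : ℝ, (∫ x in shell N R s, src b q u x * u x ≤ P) ∧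
      P ≤ (∫ x in shell N R t, src a p v x * v x) +
        c * (R ^ ((N : ℝ) - 2) * hat (src a p v) R) ∧
      p * q * ∫ x in shell N R s, ‖x‖ ^ a * v x ^ (p - 1) * max (v x - 3 * c) 0 ^ 2 ≤ P := by
  obtain ⟨ξ, ζ, hξ, hζ, hξ0, hζ0, hst1, hst2⟩ := hstab
  have hN2 := h.two_le
  have hκ := h.kap_pos
  have hp := h.hp
  have hq := h.hq
  set d := t - s with hd
  have hd0 : 0 < d := sub_pos.2 hst
  have hH := h.symm.hat_pos hR
  have hc0 : 0 < c := by rw [hc]; positivity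
  set Ω : Set (Euc N) := {x | R / 4 < ‖x‖ ∧ ‖x‖ < 4 * R} with hΩ
  have hΩo : IsOpen Ω := (isOpen_lt continuous_const continuous_norm).inter
    (isOpen_lt continuous_norm continuous_const)
  have hΩ0 : Ω ⊆ {x | x ≠ 0} := by
    rintro x hx rfl
    have := hx.1
    rw [norm_zero] at this
    linarith
  have shell_sub : ∀ r, r ≤ 1 → shell N R r ⊆ Ω := fun r hr x hx =>
    ⟨lt_of_lt_of_le (by nlinarith) hx.1, lt_of_le_of_lt hx.2 (by nlinarith)⟩
  have shell_ne : ∀ r, r ≤ 1 → shell N R r ⊆ {x | x ≠ 0} := fun r hr => (shell_sub r hr).trans hΩ0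
  obtain ⟨η, hηC, hη0, hη1, hηone, hηz, hηs⟩ :=
    exists_shell_cutoff (N := N) hR (show s + d / 3 < s + 2 * d / 3 by linarith)
  have hηΩ : tsupport η ⊆ Ω := hηs.trans (shell_sub _ (by linarith))
  have hηc : HasCompactSupport η := HasCompactSupport.of_support_subset_isCompact
    (isCompact_shell R _) ((subset_tsupport η).trans hηs)
  set F : Euc N → ℝ := fun x => src b q u x * η x with hF
  have hFC : ContDiff ℝ 2 F :=
    contDiff_mul_of_tsupport hΩo (h.symm.src_C2.mono hΩ0) hηC.contDiffOn hηΩ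
  have hFc : HasCompactSupport F := hηc.mul_left
  have hFs : tsupport F ⊆ Ω := tsupport_mul_subset_right.trans hηΩ
  have hF0 : ∀ x, 0 ≤ F x := fun x => mul_nonneg (h.symm.src_nn x) (hη0 x)
  have hF1 : ∀ x, F x ≤ src b q u x := fun x =>
    mul_le_of_le_one_right (h.symm.src_nn x) (hη1 x)
  set 𝒩 : Euc N → ℝ := fun x => (kap N)⁻¹ * nwt F x with h𝒩
  have h𝒩C : ContDiff ℝ 2 𝒩 := contDiff_const.mul (contDiff_nwt h.hN hFC hFc)
  have hint : ∀ x, Integrable fun y => gam N 0 (x - y) * F y :=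
    integrable_gam_mul h.hN hFC.continuous hFc
  have hκ𝒩 : ∀ x, ∫ y, gam N 0 (x - y) * F y = kap N * 𝒩 x := fun x => by
    simp only [h𝒩, nwt]; field_simp
  have h𝒩0 : ∀ x, 0 ≤ 𝒩 x := fun x => mul_nonneg (inv_nonneg.2 hκ.le)
    (integral_nonneg fun y => mul_nonneg (gam_nonneg le_rfl _) (hF0 y))
  have h𝒩v : ∀ x, 𝒩 x ≤ v x := fun x => by
    refine le_of_mul_le_mul_left ?_ hκ
    rw [← hκ𝒩, ← h.symm.integral_eq x]
    exact integral_mono (hint x) (h.symm.integrable x) fun y =>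
      mul_le_mul_of_nonneg_left (hF1 y) (gam_nonneg le_rfl _)
  have h𝒩lap : ∀ x, lap 𝒩 x = -F x := fun x => by
    have e : lap 𝒩 x = (kap N)⁻¹ * lap (nwt F) x := by
      have hn := contDiff_nwt h.hN hFC hFc
      have := lap_comp (f := nwt F) (h := fun r => (kap N)⁻¹ * r) (x := x)
        (contDiff_const.mul contDiff_id).contDiffAt hn.contDiffAt
      have e1 : deriv (fun r : ℝ => (kap N)⁻¹ * r) = fun _ => (kap N)⁻¹ := by
        ext r; simp
      rw [e1] at this
      simpa using this
    rw [e, lap_nwt h.hN hFC hFc]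
    field_simp
  -- the kernel away from the diagonal
  have hker : ∀ {x y : Euc N}, d / 9 * max R ‖y‖ ≤ ‖x - y‖ →
      gam N 0 (x - y) ≤ (9 / d) ^ ((N : ℝ) - 2) * max R ‖y‖ ^ (-((N : ℝ) - 2)) := by
    intro x y hxy
    have hm : 0 < max R ‖y‖ := lt_max_of_lt_left hR
    refine (gam_le h.hN (by positivity) le_rfl hxy).trans_eq ?_
    rw [Real.mul_rpow (by positivity) hm.le, Real.rpow_neg (by positivity),
      ← Real.inv_rpow (by positivity), inv_div]
  have h927 : (9 / d) ^ ((N : ℝ) - 2) ≤ (27 / d) ^ ((N : ℝ) - 2) :=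
    Real.rpow_le_rpow (by positivity) (by gcongr; norm_num) hN2
  have hinner : ∀ x ∈ shell N R s, v x - 𝒩 x ≤ c := by
    intro x hx
    refine le_of_mul_le_mul_left ?_ hκ
    rw [mul_sub, ← hκ𝒩, ← h.symm.integral_eq x, ← integral_sub (h.symm.integrable x) (hint x),
      show kap N * c = (27 / d) ^ ((N : ℝ) - 2) * hat (src b q u) R by rw [hc]; field_simp,
      hat, ← integral_const_mul]
    refine integral_mono ((h.symm.integrable x).sub (hint x))
      ((h.symm.hat_integrable hR).const_mul _) fun y => ?_
    simp only
    by_cases hy : y ∈ shell N R (s + d / 3)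
    · simp only [hF]
      rw [hηone y hy, mul_one, sub_self]
      exact mul_nonneg (by positivity) (h.symm.hat_integrand_nonneg R y)
    · have h1 := le_norm_sub_of_shell hR hs (show s ≤ s + d / 3 by linarith) (by linarith) hx hy
      have h2 := hker (x := x) (y := y) (le_trans (le_of_eq (by ring)) h1)
      have hm := Real.rpow_nonneg (lt_max_of_lt_left (c := ‖y‖) hR).le (-((N : ℝ) - 2))
      calc gam N 0 (x - y) * src b q u y - gam N 0 (x - y) * F y
          ≤ gam N 0 (x - y) * src b q u y :=
            sub_le_self _ (mul_nonneg (gam_nonneg le_rfl _) (hF0 y))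
        _ ≤ (27 / d) ^ ((N : ℝ) - 2) * max R ‖y‖ ^ (-((N : ℝ) - 2)) * src b q u y :=
            mul_le_mul_of_nonneg_right (h2.trans (mul_le_mul_of_nonneg_right h927 hm))
              (h.symm.src_nn y)
        _ = _ := by ring
  have houter : ∀ x, x ∉ shell N R t →
      𝒩 x ≤ c * (R ^ ((N : ℝ) - 2) * max R ‖x‖ ^ (-((N : ℝ) - 2))) := by
    intro x hx
    have hm := Real.rpow_nonneg (lt_max_of_lt_left (c := ‖x‖) hR).le (-((N : ℝ) - 2))
    refine le_of_mul_le_mul_left ?_ hκ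
    rw [← hκ𝒩, show kap N * (c * (R ^ ((N : ℝ) - 2) * max R ‖x‖ ^ (-((N : ℝ) - 2)))) =
      ((27 / d) ^ ((N : ℝ) - 2) * R ^ ((N : ℝ) - 2) * max R ‖x‖ ^ (-((N : ℝ) - 2))) *
        hat (src b q u) R by rw [hc]; field_simp, hat, ← integral_const_mul]
    refine integral_mono (hint x) ((h.symm.hat_integrable hR).const_mul _) fun y => ?_
    simp only
    by_cases hy : y ∈ shell N R (s + 2 * d / 3)
    · have h1 := le_norm_sub_of_shell hR (by linarith) (show s + 2 * d / 3 ≤ t by linarith) ht hy hx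
      have h2 := hker (x := y) (y := x) (le_trans (le_of_eq (by ring)) h1)
      rw [show y - x = -(x - y) by abel, gam_neg] at h2
      have hm3 : max R ‖y‖ ≤ 3 * R := max_le (by linarith) (hy.2.trans (by nlinarith))
      have h3 : 1 ≤ (3 * R) ^ ((N : ℝ) - 2) * max R ‖y‖ ^ (-((N : ℝ) - 2)) := by
        calc (1 : ℝ) = (3 * R) ^ ((N : ℝ) - 2) * (3 * R) ^ (-((N : ℝ) - 2)) := by
              rw [← Real.rpow_add (by positivity)]; simp
          _ ≤ _ := mul_le_mul_of_nonneg_left (Real.rpow_le_rpow_of_nonpos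
              (lt_max_of_lt_left hR) hm3 (by linarith)) (by positivity)
      calc gam N 0 (x - y) * F y ≤ gam N 0 (x - y) * src b q u y :=
            mul_le_mul_of_nonneg_left (hF1 y) (gam_nonneg le_rfl _)
        _ ≤ ((9 / d) ^ ((N : ℝ) - 2) * max R ‖x‖ ^ (-((N : ℝ) - 2))) * src b q u y :=
            mul_le_mul_of_nonneg_right h2 (h.symm.src_nn y)
        _ ≤ ((9 / d) ^ ((N : ℝ) - 2) * max R ‖x‖ ^ (-((N : ℝ) - 2))) * src b q u y *
              ((3 * R) ^ ((N : ℝ) - 2) * max R ‖y‖ ^ (-((N : ℝ) - 2))) :=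
            le_mul_of_one_le_right (mul_nonneg (mul_nonneg (by positivity) hm)
              (h.symm.src_nn y)) h3
        _ = _ := by
            rw [show (27 : ℝ) / d = 9 / d * 3 by ring, Real.mul_rpow (by norm_num) hR.le,
              Real.mul_rpow (by positivity) (by norm_num)]
            ring
    · have : F y = 0 := by simp only [hF]; rw [hηz y hy, mul_zero]
      rw [this, mul_zero]
      exact mul_nonneg (mul_nonneg (by positivity) hm) (h.symm.hat_integrand_nonneg R y)
  have houter2 : ∀ x, x ∉ shell N R t → 𝒩 x ≤ c := by
    intro x hx
    refine (houter x hx).trans (mul_le_of_le_one_right hc0.le ?_)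
    calc R ^ ((N : ℝ) - 2) * max R ‖x‖ ^ (-((N : ℝ) - 2))
        ≤ R ^ ((N : ℝ) - 2) * R ^ (-((N : ℝ) - 2)) := mul_le_mul_of_nonneg_left
          (Real.rpow_le_rpow_of_nonpos hR (le_max_left _ _) (by linarith)) (by positivity)
      _ = 1 := by rw [← Real.rpow_add hR]; simp
  obtain ⟨J, hJC, hJz, hJ0, hJl, hJ1, hJ2, hJ3⟩ := exists_truncation hc0
  set ψ : Euc N → ℝ := fun x => J (𝒩 x) with hψ
  have hψC : ContDiff ℝ 2 ψ := hJC.comp h𝒩C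
  have hψt : tsupport ψ ⊆ shell N R t := by
    refine closure_minimal (fun x hx => ?_) (isClosed_shell R t)
    by_contra hx2
    exact hx (hJz _ (houter2 x hx2))
  have hψc : HasCompactSupport ψ := HasCompactSupport.of_support_subset_isCompact
    (isCompact_shell R t) ((subset_tsupport ψ).trans hψt)
  have hψΩ : tsupport ψ ⊆ Ω := hψt.trans (shell_sub t ht)
  have hψlap : ∀ x, -lap ψ x ≤ F x := fun x => by
    have := lap_comp (h := J) (f := 𝒩) (x := x) hJC.contDiffAt h𝒩C.contDiffAt
    rw [show lap ψ x = _ from this, h𝒩lap]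
    have h1 : 0 ≤ deriv (deriv J) (𝒩 x) * ∑ i, pd i 𝒩 x ^ 2 :=
      mul_nonneg (hJ3 _) (Finset.sum_nonneg fun i _ => sq_nonneg _)
    have h2 : deriv J (𝒩 x) * F x ≤ F x := mul_le_of_le_one_left (hF0 x) (hJ2 _)
    linarith
  have hVc : ContinuousOn (fun x => ‖x‖ ^ a * v x ^ (p - 1)) Ω :=
    ((continuousOn_norm_rpow a).mul
      (h.v_cont.rpow_const fun x => Or.inl (h.v_pos x).ne').continuousOn).mono hΩ0
  have hWc : ContinuousOn (fun x => ‖x‖ ^ b * u x ^ (q - 1)) Ω :=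
    ((continuousOn_norm_rpow b).mul
      (h.u_cont.rpow_const fun x => Or.inl (h.u_pos x).ne').continuousOn).mono hΩ0
  have main := stability_integral_le (V := fun x => p * ‖x‖ ^ a * v x ^ (p - 1))
    (W := fun x => q * ‖x‖ ^ b * u x ^ (q - 1)) hΩo hξ hζ hξ0 hζ0
    (by simpa only [mul_assoc] using hVc.const_mul p) (by simpa only [mul_assoc] using hWc.const_mul q)
    (fun x hx => by
      have := Real.rpow_pos_of_pos (norm_pos_iff.2 (hΩ0 hx)) b
      have := Real.rpow_pos_of_pos (h.u_pos x) (q - 1)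
      positivity) hst1 hst2 hψC hψc hψΩ (fun x => hJ0 _) hFC.continuous hFc hFs
    (fun x _ => hψlap x)
  have huF : Integrable fun x => u x * F x :=
    (h.u_cont.mul hFC.continuous).integrable_of_hasCompactSupport hFc.mul_left
  have huF0 : ∀ x, 0 ≤ u x * F x := fun x => mul_nonneg (h.u_pos x).le (hF0 x)
  refine ⟨∫ x, u x * F x, ?_, ?_, ?_⟩
  · refine le_trans (le_of_eq ?_) (setIntegral_le_integral huF (ae_of_all _ huF0)
      (s := shell N R s))
    refine setIntegral_congr_fun (isClosed_shell R s).measurableSet fun x hx => ?_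
    simp only [hF]
    rw [hηone x (shell_mono hR.le (by linarith) hx), mul_one, mul_comm]
  · -- symmetry of the kernel
    have hsw : ∫ x, u x * F x = ∫ x, src a p v x * 𝒩 x := by
      have e := lintegral_gam_swap h.src_aemeas hFC.continuous.measurable.aemeasurable
      have e1 : ∀ x, ∫⁻ y, ENNReal.ofReal (gam N 0 (x - y) * src a p v y) =
        ENNReal.ofReal (kap N * u x) := h.u_rep
      have e2 : ∀ x, ∫⁻ y, ENNReal.ofReal (gam N 0 (x - y) * F y) =
          ENNReal.ofReal (kap N * 𝒩 x) := fun x => by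
        rw [← ofReal_integral_eq_lintegral_ofReal (hint x)
          (ae_of_all _ fun y => mul_nonneg (gam_nonneg le_rfl _) (hF0 y)), hκ𝒩]
      simp_rw [e1, e2] at e
      rw [integral_eq_lintegral_of_nonneg_ae (ae_of_all _ huF0) huF.aestronglyMeasurable,
        integral_eq_lintegral_of_nonneg_ae
          (ae_of_all _ fun x => mul_nonneg (h.src_nn x) (h𝒩0 x))
          (h.src_aemeas.mul h𝒩C.continuous.measurable.aemeasurable).aestronglyMeasurable]
      congr 1
      have hk0 : ENNReal.ofReal (kap N) ≠ 0 := by simpa using hκ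
      refine (ENNReal.mul_right_inj hk0 ENNReal.ofReal_ne_top).1 ?_
      rw [← lintegral_const_mul' _ _ ENNReal.ofReal_ne_top,
        ← lintegral_const_mul' _ _ ENNReal.ofReal_ne_top]
      refine Eq.trans (lintegral_congr fun x => ?_) (e.trans (lintegral_congr fun x => ?_))
      · rw [ENNReal.ofReal_mul hκ.le, ENNReal.ofReal_mul (h.u_pos x).le]; ring
      · rw [ENNReal.ofReal_mul hκ.le, ENNReal.ofReal_mul (h.src_nn x)]; ring
    rw [hsw, ← integral_indicator (isClosed_shell R t).measurableSet, hat, ← mul_assoc,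
      ← integral_const_mul, ← integral_add]
    · refine integral_mono_of_nonneg (ae_of_all _ fun x => mul_nonneg (h.src_nn x) (h𝒩0 x)) ?_
        (ae_of_all _ fun x => ?_)
      · refine Integrable.add ?_ ((h.hat_integrable hR).const_mul _)
        refine IntegrableOn.integrable_indicator ?_ (isClosed_shell R t).measurableSet
        exact ((h.src_cont.mul h.v_cont.continuousOn).mono
          (shell_ne t ht)).integrableOn_compact (isCompact_shell R t)
      · simp only
        by_cases hx : x ∈ shell N R t
        · rw [indicator_of_mem hx]
          have h1 := mul_le_mul_of_nonneg_left (h𝒩v x) (h.src_nn x)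
          have h2 : 0 ≤ c * R ^ ((N : ℝ) - 2) *
            (src a p v x * max R ‖x‖ ^ (-((N : ℝ) - 2))) :=
            mul_nonneg (by positivity) (h.hat_integrand_nonneg R x)
          linarith
        · rw [indicator_of_notMem hx, zero_add]
          have h1 := mul_le_mul_of_nonneg_left (houter x hx) (h.src_nn x)
          exact h1.trans_eq (by ring)
    · refine IntegrableOn.integrable_indicator ?_ (isClosed_shell R t).measurableSet
      exact ((h.src_cont.mul h.v_cont.continuousOn).mono
        (shell_ne t ht)).integrableOn_compact (isCompact_shell R t)
    · exact (h.hat_integrable hR).const_mul _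
  · have hψ2s : tsupport (fun x => ψ x ^ 2) ⊆ Ω := by
      simp_rw [pow_two]; exact tsupport_mul_subset_right.trans hψΩ
    have hψ2c : HasCompactSupport fun x => ψ x ^ 2 := by
      simp_rw [pow_two]; exact hψc.mul_left
    have hVψ : Integrable fun x => ‖x‖ ^ a * v x ^ (p - 1) * ψ x ^ 2 :=
      integrable_mul_of_tsupport hΩo hVc (hψC.continuous.pow 2) hψ2c hψ2s
    have hV0 : ∀ x, 0 ≤ ‖x‖ ^ a * v x ^ (p - 1) := fun x =>
      mul_nonneg (by positivity) (Real.rpow_nonneg (h.v_pos x).le _)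
    have low : ∫ x in shell N R s, ‖x‖ ^ a * v x ^ (p - 1) * max (v x - 3 * c) 0 ^ 2 ≤
        ∫ x, ‖x‖ ^ a * v x ^ (p - 1) * ψ x ^ 2 := by
      refine le_trans (setIntegral_mono_on ?_ hVψ.integrableOn (isClosed_shell R s).measurableSet
        fun x hx => ?_) (setIntegral_le_integral hVψ (ae_of_all _ fun x =>
          mul_nonneg (hV0 x) (sq_nonneg _)))
      · refine ContinuousOn.integrableOn_compact (isCompact_shell R s) ?_
        exact (hVc.mono (shell_sub s (by linarith))).mul
          (((h.v_cont.sub continuous_const).max continuous_const).pow 2).continuousOn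
      · refine mul_le_mul_of_nonneg_left ?_ (hV0 x)
        refine pow_le_pow_left₀ (le_max_right _ _) (max_le ?_ (hJ0 _)) 2
        have h1 := hJl (𝒩 x)
        have h2 := hinner x hx
        linarith
    have up : ∫ x, (q * ‖x‖ ^ b * u x ^ (q - 1))⁻¹ * F x ^ 2 ≤ q⁻¹ * ∫ x, u x * F x := by
      rw [← integral_const_mul]
      refine integral_mono_of_nonneg (ae_of_all _ fun x => ?_) (huF.const_mul _) ?_
      · exact mul_nonneg (inv_nonneg.2 (mul_nonneg (mul_nonneg hq.le (by positivity))
          (Real.rpow_nonneg (h.u_pos x).le _))) (sq_nonneg _)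
      · filter_upwards [ae_ne_zero h.hN 0] with x hx
        simp only [hF]
        rw [h.inv_weight_mul_src_sq hx]
        refine mul_le_mul_of_nonneg_left ?_ (inv_nonneg.2 hq.le)
        rw [mul_comm (u x), mul_right_comm]
        refine mul_le_mul_of_nonneg_right (mul_le_mul_of_nonneg_left ?_ (h.symm.src_nn x))
          (h.u_pos x).le
        nlinarith [hη0 x, hη1 x]
    have e : ∫ x, p * ‖x‖ ^ a * v x ^ (p - 1) * ψ x ^ 2 =
        p * ∫ x, ‖x‖ ^ a * v x ^ (p - 1) * ψ x ^ 2 := by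
      rw [← integral_const_mul]
      refine integral_congr_ae (ae_of_all _ fun x => ?_)
      simp only; ring
    rw [e] at main
    have h1 := (mul_le_mul_of_nonneg_left low hp.le).trans (main.trans up)
    have h2 := mul_le_mul_of_nonneg_left h1 hq.le
    rw [← mul_assoc q q⁻¹, mul_inv_cancel₀ hq.ne', one_mul] at h2
    linarith

end HLERep

section Iteration

open Filter Topology

/-- The standard iteration lemma for absorbing a term on a larger set. -/
lemma exists_iteration_bound {θ m : ℝ} (hθ : 0 < θ) (hθ1 : θ < 1) (hm : 0 < m) :
    ∃ C₀, 0 < C₀ ∧ ∀ (f : ℝ → ℝ) (M C : ℝ), 0 ≤ C → (∀ t, 0 ≤ t → t ≤ 1 → f t ≤ M) →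
      (∀ s t, 0 ≤ s → s < t → t ≤ 1 → f s ≤ θ * f t + C * (t - s) ^ (-m)) →
      f (1 / 2) ≤ C₀ * C := by
  set σ := θ ^ (1 / 2 : ℝ) with hσ
  have hσ0 : 0 < σ := by positivity
  have hσ1 : σ < 1 := Real.rpow_lt_one hθ.le hθ1 (by norm_num)
  have hσσ : σ * σ = θ := by
    rw [hσ, ← Real.rpow_add hθ]; norm_num
  set τ := σ ^ (1 / m) with hτ
  have hτ0 : 0 < τ := by positivity
  have hτ1 : τ < 1 := Real.rpow_lt_one hσ0.le hσ1 (by positivity)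
  have hτm : τ ^ m = σ := by
    rw [hτ, ← Real.rpow_mul hσ0.le, one_div, inv_mul_cancel₀ hm.ne', Real.rpow_one]
  set D := ((1 - τ) / 2) ^ (-m) with hD
  have hτ2 : 0 < 1 - τ := by linarith
  have hσ2 : 0 < 1 - σ := by linarith
  have hD0 : 0 < D := by positivity
  refine ⟨D / (1 - σ), by positivity, fun f M C hC hM hf => ?_⟩
  have hτn : ∀ n : ℕ, 0 < τ ^ n ∧ τ ^ n ≤ 1 := fun n =>
    ⟨by positivity, pow_le_one₀ hτ0.le hτ1.le⟩
  have hstep : ∀ n : ℕ, σ ^ n * f (1 - τ ^ n / 2) ≤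
      σ * (σ ^ (n + 1) * f (1 - τ ^ (n + 1) / 2)) + C * D := by
    intro n
    have h1 := hf (1 - τ ^ n / 2) (1 - τ ^ (n + 1) / 2) (by linarith [(hτn n).2])
      (by rw [pow_succ]; nlinarith [(hτn n).1]) (by linarith [(hτn (n + 1)).1])
    have h2 : (1 - τ ^ (n + 1) / 2 - (1 - τ ^ n / 2)) ^ (-m) = D * (σ ^ n)⁻¹ := by
      rw [show 1 - τ ^ (n + 1) / 2 - (1 - τ ^ n / 2) = (1 - τ) / 2 * τ ^ n by ring,
        Real.mul_rpow (by positivity) (by positivity), hD, Real.rpow_neg (by positivity : 0 ≤ τ ^ n),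
        ← hτm, ← Real.rpow_natCast, ← Real.rpow_mul hτ0.le, mul_comm (n : ℝ),
        Real.rpow_mul hτ0.le, Real.rpow_natCast]
    rw [h2] at h1
    have h3 := mul_le_mul_of_nonneg_left h1 (show 0 ≤ σ ^ n by positivity)
    refine h3.trans_eq ?_
    rw [← hσσ]
    field_simp
    ring
  set K := C * D / (1 - σ) with hK
  have hK0 : 0 ≤ K := by positivity
  have hKeq : C * D = K * (1 - σ) := by rw [hK]; field_simp
  have hind : ∀ n : ℕ, f (1 / 2) - K ≤ σ ^ n * (σ ^ n * f (1 - τ ^ n / 2) - K) := by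
    intro n
    induction n with
    | zero => norm_num
    | succ n ih =>
      refine ih.trans ?_
      rw [pow_succ σ n, mul_assoc (σ ^ n) σ]
      refine mul_le_mul_of_nonneg_left ?_ (by positivity)
      have := hstep n
      rw [hKeq] at this
      rw [← pow_succ]
      linarith
  have hlim : Tendsto (fun n : ℕ => σ ^ n * max M 0) atTop (𝓝 0) := by
    simpa using (tendsto_pow_atTop_nhds_zero_of_lt_one hσ0.le hσ1).mul_const (max M 0)
  have := ge_of_tendsto hlim (Eventually.of_forall fun n => (hind n).trans ?_)
  · have e : D / (1 - σ) * C = K := by rw [hK]; ring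
    rw [e]; linarith
  · refine mul_le_mul_of_nonneg_left ?_ (by positivity)
    have h1 := hM (1 - τ ^ n / 2) (by linarith [(hτn n).2]) (by linarith [(hτn n).1])
    have h2 : σ ^ n ≤ 1 := pow_le_one₀ hσ0.le hσ1.le
    have h3 : σ ^ n * f (1 - τ ^ n / 2) ≤ σ ^ n * max M 0 :=
      mul_le_mul_of_nonneg_left (h1.trans (le_max_left _ _)) (by positivity)
    have h4 : σ ^ n * max M 0 ≤ max M 0 := mul_le_of_le_one_left (le_max_right _ _) h2
    linarith

lemma rpow_le_of_mem_four {R : ℝ} (hR : 0 < R) (c : ℝ) {t : ℝ} (h1 : R / 4 ≤ t) (h2 : t ≤ 4 * R) :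
    t ^ c ≤ 4 ^ |c| * R ^ c := by
  have ht : 0 < t := by linarith
  rcases le_total 0 c with hc | hc
  · rw [abs_of_nonneg hc, ← Real.mul_rpow (by norm_num) hR.le]
    exact Real.rpow_le_rpow ht.le h2 hc
  · rw [abs_of_nonpos hc]
    calc t ^ c ≤ (R / 4) ^ c := Real.rpow_le_rpow_of_nonpos (by positivity) h1 hc
      _ = 4 ^ (-c) * R ^ c := by
        rw [Real.div_rpow hR.le (by norm_num), Real.rpow_neg (by norm_num)]
        ring

end Iteration

namespace HLERep

open Filter Topology

variable {N : ℕ} {p q a b : ℝ} {u v : Euc N → ℝ}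

lemma shell_ne_zero {R t : ℝ} (hR : 0 < R) (ht : t ≤ 1) : shell N R t ⊆ {x | x ≠ 0} := by
  rintro x hx rfl
  have := hx.1
  rw [norm_zero] at this
  nlinarith

lemma integrableOn_shell {f : Euc N → ℝ} (hf : ContinuousOn f {x | x ≠ 0}) {R t : ℝ} (hR : 0 < R)
    (ht : t ≤ 1) : IntegrableOn f (shell N R t) :=
  (hf.mono (shell_ne_zero hR ht)).integrableOn_compact (isCompact_shell R t)

lemma setIntegral_shell_norm_le {R t : ℝ} (hR : 0 < R) (ht : t ≤ 1) :
    ∫ x in shell N R t, ‖x‖ ^ a ≤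
      4 ^ |a| * 3 ^ N * (volume (closedBall (0 : Euc N) 1)).toReal * R ^ ((N : ℝ) + a) := by
  have h1 : ∫ x in shell N R t, ‖x‖ ^ a ≤ ∫ _ in shell N R t, 4 ^ |a| * R ^ a := by
    refine setIntegral_mono_on (integrableOn_shell (continuousOn_norm_rpow a) hR ht)
      (integrableOn_const (isCompact_shell R t).measure_lt_top.ne)
      (isClosed_shell R t).measurableSet fun x hx => ?_
    exact rpow_le_of_mem_four hR a (le_trans (by nlinarith) hx.1) (hx.2.trans (by nlinarith))
  rw [setIntegral_const, smul_eq_mul] at h1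
  have h2 : (volume.real (shell N R t)) ≤ (volume (closedBall (0 : Euc N) (3 * R))).toReal := by
    refine ENNReal.toReal_mono measure_closedBall_lt_top.ne (measure_mono fun x hx => ?_)
    rw [mem_closedBall_zero_iff]
    exact hx.2.trans (by nlinarith)
  rw [volume_closedBall_real (by positivity)] at h2
  refine h1.trans ((mul_le_mul_of_nonneg_right h2 (by positivity)).trans_eq ?_)
  rw [Real.rpow_add hR, Real.rpow_natCast, mul_pow]
  ring

/-- Energy estimate on annuli for solutions which are stable there. -/
lemma exists_energy_bound (h : HLERep N p q a b u v) : ∃ C, 0 < C ∧ ∀ R, 0 < R →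
    HLEStableOn p q a b u v {x | R / 4 < ‖x‖ ∧ ‖x‖ < 4 * R} →
    (∫ x in annu N (2 * R), src a p v x * v x ≤
      C * (R ^ ((N : ℝ) - 2) * hat (src a p v) R * hat (src b q u) R +
        R ^ ((N : ℝ) + a) * hat (src b q u) R ^ (p + 1))) ∧
    ∫ x in annu N (2 * R), src b q u x * u x ≤
      C * (R ^ ((N : ℝ) - 2) * hat (src a p v) R * hat (src b q u) R +
        R ^ ((N : ℝ) + a) * hat (src b q u) R ^ (p + 1)) := by
  have hp := h.hp
  have hq := h.hq
  have hN2 := h.two_le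
  have hN3 : (3 : ℝ) ≤ N := by exact_mod_cast h.hN
  have hκ := h.kap_pos
  have hpq := h.hpq
  set Q := p * q with hQ
  have hQ0 : 0 < Q := by linarith
  set ω := √((1 + 1 / Q) / 2) with hω
  have hω2 : ω ^ 2 = (1 + 1 / Q) / 2 := Real.sq_sqrt (by positivity)
  have hω0 : 0 < ω := Real.sqrt_pos.2 (by positivity)
  have hQi : 1 / Q < 1 := by rw [div_lt_one hQ0]; exact hpq
  have hω1 : ω < 1 := by
    rw [hω, Real.sqrt_lt' one_pos]; linarith
  have hω1' : 0 < 1 - ω := by linarith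
  have hQω : Q * ω ^ 2 = (Q + 1) / 2 := by rw [hω2]; field_simp
  set θ := 1 / (Q * ω ^ 2) with hθ
  have hθ0 : 0 < θ := by positivity
  have hθ1 : θ < 1 := by rw [hθ, div_lt_one (by positivity), hQω]; linarith
  set m := ((N : ℝ) - 2) * (p + 1) with hm
  have hm0 : 0 < m := mul_pos (by linarith) (by linarith)
  obtain ⟨C₀, hC₀, iter⟩ := exists_iteration_bound hθ0 hθ1 hm0
  set c₁ := (kap N)⁻¹ * 27 ^ ((N : ℝ) - 2) with hc₁
  have hc₁0 : 0 < c₁ := by positivity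
  set Ω₁ := (4 : ℝ) ^ |a| * 3 ^ N * (volume (closedBall (0 : Euc N) 1)).toReal with hΩ₁
  have hΩ₁0 : 0 ≤ Ω₁ := mul_nonneg (by positivity) ENNReal.toReal_nonneg
  set C₁ := c₁ + (3 * c₁ / (1 - ω)) ^ (p + 1) * Ω₁ with hC₁
  have hC₁0 : 0 < C₁ := add_pos_of_pos_of_nonneg hc₁0 (mul_nonneg (by positivity) hΩ₁0)
  refine ⟨C₀ * C₁ + c₁ * (1 / 2) ^ (-m), by positivity, fun R hR hst => ?_⟩
  set U := hat (src a p v) R with hU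
  set V := hat (src b q u) R with hV
  have hU0 : 0 < U := h.hat_pos hR
  have hV0 : 0 < V := h.symm.hat_pos hR
  set S := R ^ ((N : ℝ) - 2) * U * V + R ^ ((N : ℝ) + a) * V ^ (p + 1) with hS
  have hS0 : 0 < S := by positivity
  set G : ℝ → ℝ := fun t => ∫ x in shell N R t, src a p v x * v x with hG
  have hfc : ContinuousOn (fun x => src a p v x * v x) {x : Euc N | x ≠ 0} :=
    h.src_cont.mul h.v_cont.continuousOn
  have hf0 : ∀ x, 0 ≤ src a p v x * v x := fun x => mul_nonneg (h.src_nn x) (h.v_pos x).le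
  have hGm : ∀ s t, s ≤ t → t ≤ 1 → G s ≤ G t := fun s t hst ht =>
    setIntegral_mono_set (integrableOn_shell hfc hR ht) (ae_of_all _ hf0)
      (shell_mono hR.le hst).eventuallyLE
  have cform : ∀ d : ℝ, 0 < d → (kap N)⁻¹ * (27 / d) ^ ((N : ℝ) - 2) * V =
      c₁ * d ^ (-((N : ℝ) - 2)) * V := fun d hd => by
    rw [Real.div_rpow (by norm_num) hd.le, Real.rpow_neg hd.le, hc₁]; ring
  have dm : ∀ d : ℝ, 0 < d → d ≤ 1 → d ^ (-((N : ℝ) - 2)) ≤ d ^ (-m) := fun d hd hd1 =>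
    Real.rpow_le_rpow_of_exponent_ge hd hd1 (by rw [hm]; nlinarith)
  have first : ∀ d : ℝ, 0 < d → d ≤ 1 → c₁ * d ^ (-((N : ℝ) - 2)) * V *
      (R ^ ((N : ℝ) - 2) * U) ≤ c₁ * d ^ (-m) * S := by
    intro d hd hd1
    have h1 : R ^ ((N : ℝ) - 2) * U * V ≤ S := le_add_of_nonneg_right (by positivity)
    calc c₁ * d ^ (-((N : ℝ) - 2)) * V * (R ^ ((N : ℝ) - 2) * U)
        = c₁ * d ^ (-((N : ℝ) - 2)) * (R ^ ((N : ℝ) - 2) * U * V) := by ring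
      _ ≤ c₁ * d ^ (-m) * S := mul_le_mul (mul_le_mul_of_nonneg_left (dm d hd hd1) hc₁0.le) h1
          (by positivity) (by positivity)
  have step : ∀ s t, 0 ≤ s → s < t → t ≤ 1 → G s ≤ θ * G t + C₁ * S * (t - s) ^ (-m) := by
    intro s t hs hst' ht
    have hd : 0 < t - s := sub_pos.2 hst'
    obtain ⟨P, -, hP2, hP3⟩ := h.annulus_step hR hs hst' ht hst (c := c₁ * (t - s) ^ (-((N : ℝ) - 2)) * V)
      (cform _ hd).symm
    set c := c₁ * (t - s) ^ (-((N : ℝ) - 2)) * V with hc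
    have hc0 : 0 < c := by positivity
    set K := 3 * c / (1 - ω) with hK
    have hK0 : 0 < K := by positivity
    have hpt : ∀ x, ω ^ 2 * (src a p v x * v x) ≤
        ‖x‖ ^ a * v x ^ (p - 1) * max (v x - 3 * c) 0 ^ 2 + ω ^ 2 * K ^ (p + 1) * ‖x‖ ^ a := by
      intro x
      have hv := h.v_pos x
      have e1 : v x ^ p = v x ^ (p - 1) * v x := by
        rw [← Real.rpow_add_one hv.ne', sub_add_cancel]
      have hn : 0 ≤ ‖x‖ ^ a := by positivity
      have hvp : 0 ≤ v x ^ (p - 1) := by positivity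
      rcases le_or_gt K (v x) with hKv | hKv
      · have h1 : ω * v x ≤ max (v x - 3 * c) 0 := by
          refine le_trans ?_ (le_max_left _ _)
          rw [hK, div_le_iff₀ hω1'] at hKv
          linarith
        have h2 : (ω * v x) ^ 2 ≤ max (v x - 3 * c) 0 ^ 2 :=
          pow_le_pow_left₀ (by positivity) h1 2
        have h3 := mul_le_mul_of_nonneg_left h2 (mul_nonneg hn hvp)
        have h4 : 0 ≤ ω ^ 2 * K ^ (p + 1) * ‖x‖ ^ a := by positivity
        rw [src, e1]
        calc _ = ‖x‖ ^ a * v x ^ (p - 1) * (ω * v x) ^ 2 := by ring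
          _ ≤ _ := by linarith
      · have h1 : v x ^ (p + 1) ≤ K ^ (p + 1) := Real.rpow_le_rpow hv.le hKv.le (by linarith)
        have h2 : 0 ≤ ‖x‖ ^ a * v x ^ (p - 1) * max (v x - 3 * c) 0 ^ 2 := by positivity
        have h3 := mul_le_mul_of_nonneg_left h1 (mul_nonneg (sq_nonneg ω) hn)
        rw [src]
        calc _ = ω ^ 2 * ‖x‖ ^ a * v x ^ (p + 1) := by
              rw [Real.rpow_add_one hv.ne']; ring
          _ ≤ _ := by linarith
    have hs1 : s ≤ 1 := by linarith
    have c1 : ContinuousOn (fun x : Euc N => ‖x‖ ^ a * v x ^ (p - 1) * max (v x - 3 * c) 0 ^ 2)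
        {x | x ≠ 0} := by
      refine ((continuousOn_norm_rpow a).mul
        (h.v_cont.rpow_const fun x => Or.inl (h.v_pos x).ne').continuousOn).mul ?_
      exact (((h.v_cont.sub continuous_const).max continuous_const).pow 2).continuousOn
    have i1 := integrableOn_shell c1 hR hs1
    have i2 := (integrableOn_shell (continuousOn_norm_rpow (N := N) a) hR hs1).const_mul
      (ω ^ 2 * K ^ (p + 1))
    have h1 := setIntegral_mono ((integrableOn_shell hfc hR hs1).const_mul (ω ^ 2))
      (i1.add i2) hpt
    have h1' : ω ^ 2 * G s ≤ (∫ x in shell N R s, ‖x‖ ^ a * v x ^ (p - 1) *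
        max (v x - 3 * c) 0 ^ 2) + ω ^ 2 * K ^ (p + 1) * ∫ x in shell N R s, ‖x‖ ^ a := by
      rw [integral_add' i1 i2, integral_const_mul, integral_const_mul] at h1
      exact h1
    have h2 := mul_le_mul_of_nonneg_left
      (setIntegral_shell_norm_le (N := N) (a := a) hR hs1)
      (show 0 ≤ ω ^ 2 * K ^ (p + 1) by positivity)
    have h3 : Q * ω ^ 2 * G s ≤ G t + c * (R ^ ((N : ℝ) - 2) * U) +
        Q * ω ^ 2 * (K ^ (p + 1) * (Ω₁ * R ^ ((N : ℝ) + a))) := by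
      have := mul_le_mul_of_nonneg_left (h1'.trans (add_le_add_right h2 _)) hQ0.le
      have h4 := hP3.trans hP2
      calc Q * ω ^ 2 * G s = Q * (ω ^ 2 * G s) := by ring
        _ ≤ _ := this
        _ = Q * (∫ x in shell N R s, ‖x‖ ^ a * v x ^ (p - 1) * max (v x - 3 * c) 0 ^ 2) +
          Q * ω ^ 2 * (K ^ (p + 1) * (Ω₁ * R ^ ((N : ℝ) + a))) := by rw [hΩ₁]; ring
        _ ≤ _ := by linarith
    have h5 := mul_le_mul_of_nonneg_left h3 hθ0.le
    have e5 : θ * (Q * ω ^ 2) = 1 := by rw [hθ]; field_simp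
    have e6 : K ^ (p + 1) = (3 * c₁ / (1 - ω)) ^ (p + 1) * (t - s) ^ (-m) * V ^ (p + 1) := by
      rw [hK, hc, show 3 * (c₁ * (t - s) ^ (-((N : ℝ) - 2)) * V) / (1 - ω) =
        3 * c₁ / (1 - ω) * (t - s) ^ (-((N : ℝ) - 2)) * V by ring,
        Real.mul_rpow (by positivity) hV0.le, Real.mul_rpow (by positivity) (by positivity),
        ← Real.rpow_mul hd.le, hm, neg_mul]
    have h6 : K ^ (p + 1) * (Ω₁ * R ^ ((N : ℝ) + a)) ≤
        (3 * c₁ / (1 - ω)) ^ (p + 1) * Ω₁ * S * (t - s) ^ (-m) := by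
      have h7 : R ^ ((N : ℝ) + a) * V ^ (p + 1) ≤ S := le_add_of_nonneg_left (by positivity)
      rw [e6]
      calc _ = (3 * c₁ / (1 - ω)) ^ (p + 1) * Ω₁ * (t - s) ^ (-m) *
            (R ^ ((N : ℝ) + a) * V ^ (p + 1)) := by ring
        _ ≤ (3 * c₁ / (1 - ω)) ^ (p + 1) * Ω₁ * (t - s) ^ (-m) * S :=
            mul_le_mul_of_nonneg_left h7 (by positivity)
        _ = _ := by ring
    have h8 := first (t - s) hd (by linarith)
    have h9 : θ * (c * (R ^ ((N : ℝ) - 2) * U)) ≤ c₁ * (t - s) ^ (-m) * S :=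
      (mul_le_of_le_one_left (by positivity) hθ1.le).trans h8
    have e7 : θ * (Q * ω ^ 2 * G s) = G s := by rw [← mul_assoc, e5, one_mul]
    have e8 : θ * (Q * ω ^ 2 * (K ^ (p + 1) * (Ω₁ * R ^ ((N : ℝ) + a)))) =
      K ^ (p + 1) * (Ω₁ * R ^ ((N : ℝ) + a)) := by rw [← mul_assoc, e5, one_mul]
    rw [mul_add, mul_add, e7, e8] at h5
    rw [hC₁]
    linarith
  have half := iter G (G 1) (C₁ * S) (by positivity) (fun t _ ht => hGm t 1 ht le_rfl) step
  have e0 : annu N (2 * R) = shell N R 0 := by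
    ext x
    simp only [annu, shell, mem_ofPred_eq]
    rw [show 2 * R / 2 = R * (1 - 0 / 2) by ring, show 2 * R = R * (2 + 0) by ring]
  rw [e0]
  constructor
  · have h1 := hGm 0 (1 / 2) (by norm_num) (by norm_num)
    have h2 : 0 ≤ c₁ * (1 / 2) ^ (-m) * S := by positivity
    exact h1.trans (half.trans (by linarith))
  · obtain ⟨P, hP1, hP2, -⟩ := h.annulus_step hR le_rfl (show (0 : ℝ) < 1 / 2 by norm_num)
      (by norm_num) hst (c := c₁ * (1 / 2) ^ (-((N : ℝ) - 2)) * V)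
      (by rw [sub_zero]; exact (cform _ (by norm_num)).symm)
    have h1 := first (1 / 2) (by norm_num) (by norm_num)
    exact hP1.trans (hP2.trans (by linarith))

end HLERep

section Sequences

open Filter Topology

/-- Dyadic summation of masses against slowly growing weights. -/
lemma weighted_dyadic_bound {r s ρ : ℝ} (hρ : 0 < ρ) (hρr : ρ < r) (hs : 1 < s) {M T μ : ℕ → ℝ}
    (hM : ∀ k, M (k + 1) ≤ M k + μ k) (hT : ∀ k, T k ≤ T (k + 1) + ((r * s) ^ k)⁻¹ * μ k)
    (hT0 : Tendsto T atTop (𝓝 0)) {w : ℕ → ℝ} (hw0 : w 0 = 1) (hw : ∀ k, 0 < w k)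
    (hwm : ∀ k, w k ≤ w (k + 1)) (hwρ : ∀ k, w (k + 1) ≤ ρ * w k) {E : ℝ} (hE : 0 ≤ E) {k₀ : ℕ}
    (hM0 : 0 ≤ M k₀) (hμ : ∀ k, k₀ ≤ k → w k * ((r ^ k)⁻¹ * μ k) ≤ E) (k : ℕ) (hk : k₀ ≤ k) :
    w k * (s ^ k * (((r * s) ^ k)⁻¹ * M k + T k)) ≤ M k₀ + (ρ / (r - ρ) + s / (s - 1)) * E := by
  have hr : 0 < r := hρ.trans hρr
  have hs0 : 0 < s := by linarith
  have hrρ : 0 < r - ρ := by linarith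
  have hs1 : 0 < s - 1 := by linarith
  have hμ' : ∀ k, k₀ ≤ k → μ k ≤ E * r ^ k / w k := fun k hk => by
    have := hμ k hk
    rw [le_div_iff₀ (hw k)]
    have h2 := mul_le_mul_of_nonneg_right this (show 0 ≤ r ^ k by positivity)
    have e : w k * ((r ^ k)⁻¹ * μ k) * r ^ k = μ k * w k := by field_simp
    linarith
  have hwr : ∀ k, w k ≤ r ^ k := fun k => by
    induction k with
    | zero => simp [hw0]
    | succ k ih =>
      rw [pow_succ, mul_comm]
      exact (hwρ k).trans (mul_le_mul hρr.le ih (hw k).le hr.le)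
  set C := ρ / (r - ρ) with hC
  have hC0 : 0 < C := by positivity
  have hCr : (C + 1) * ρ = C * r := by rw [hC]; field_simp; ring
  set C' := s / (s - 1) with hC'
  have hC'0 : 0 < C' := by positivity
  have hCs : (C' - 1) * s = C' := by rw [hC']; field_simp; ring
  have b1 : ∀ k, k₀ ≤ k → M k ≤ M k₀ + C * (E * r ^ k / w k) := by
    intro k hk
    induction k, hk using Nat.le_induction with
    | base =>
      have : 0 ≤ C * (E * r ^ k₀ / w k₀) := by have := hw k₀; positivity
      linarith
    | succ k hk ih =>
      have h1 := hM k
      have h2 := hμ' k hk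
      have h3 : (C + 1) * (E * r ^ k / w k) ≤ C * (E * r ^ (k + 1) / w (k + 1)) := by
        have e1 : C * (E * r ^ (k + 1) / w (k + 1)) = (C + 1) * (E * r ^ k) * (ρ / w (k + 1)) := by
          rw [pow_succ]
          calc _ = (C * r) * (E * r ^ k) / w (k + 1) := by ring
            _ = _ := by rw [← hCr]; ring
        have e2 : 1 / w k ≤ ρ / w (k + 1) := by
          rw [div_le_div_iff₀ (hw k) (hw _)]; linarith [hwρ k]
        rw [e1]
        calc _ = (C + 1) * (E * r ^ k) * (1 / w k) := by ring
          _ ≤ _ := mul_le_mul_of_nonneg_left e2 (by positivity)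
      linarith
  have b2 : ∀ k, k₀ ≤ k → T k - C' * (E / (s ^ k * w k)) ≤
      T (k + 1) - C' * (E / (s ^ (k + 1) * w (k + 1))) := by
    intro k hk
    have h1 := hT k
    have h2 : ((r * s) ^ k)⁻¹ * μ k ≤ E / (s ^ k * w k) := by
      refine (mul_le_mul_of_nonneg_left (hμ' k hk) (by positivity)).trans_eq ?_
      have := hw k
      rw [mul_pow]
      field_simp
    have h3 : C' * (E / (s ^ (k + 1) * w (k + 1))) ≤ (C' - 1) * (E / (s ^ k * w k)) := by
      have e1 : C' * (E / (s ^ (k + 1) * w (k + 1))) =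
          (C' - 1) * (E / (s ^ k * w (k + 1))) := by
        have := hw (k + 1)
        nth_rewrite 1 [← hCs]
        rw [pow_succ]
        field_simp
      have e2 : 0 ≤ C' - 1 := by
        have : 0 ≤ (C' - 1) * s := by rw [hCs]; positivity
        exact nonneg_of_mul_nonneg_left this hs0
      rw [e1]
      refine mul_le_mul_of_nonneg_left ?_ e2
      have := hw k
      exact div_le_div_of_nonneg_left hE (by positivity)
        (mul_le_mul_of_nonneg_left (hwm k) (by positivity))
    linarith
  have b3 : T k ≤ C' * (E / (s ^ k * w k)) := by
    have h1 : ∀ j, T k - C' * (E / (s ^ k * w k)) ≤ T (k + j) := by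
      have : ∀ j, T k - C' * (E / (s ^ k * w k)) ≤
          T (k + j) - C' * (E / (s ^ (k + j) * w (k + j))) := by
        intro j
        induction j with
        | zero => simp
        | succ j ih => exact ih.trans (b2 (k + j) (by omega))
      intro j
      have h2 : 0 ≤ C' * (E / (s ^ (k + j) * w (k + j))) := by have := hw (k + j); positivity
      linarith [this j]
    have h2 : Tendsto (fun j => T (k + j)) atTop (𝓝 0) := by
      simpa [add_comm] using (tendsto_add_atTop_iff_nat k).2 hT0
    have := ge_of_tendsto h2 (Eventually.of_forall h1)
    linarith
  have hwk := hw k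
  calc w k * (s ^ k * (((r * s) ^ k)⁻¹ * M k + T k))
      ≤ w k * (s ^ k * (((r * s) ^ k)⁻¹ * (M k₀ + C * (E * r ^ k / w k)) +
          C' * (E / (s ^ k * w k)))) := by
        gcongr
        exact b1 k hk
    _ = w k / r ^ k * M k₀ + (C + C') * E := by
        rw [mul_pow]; field_simp; ring
    _ ≤ 1 * M k₀ + (C + C') * E := by
        gcongr
        exact (div_le_one (by positivity)).2 (hwr k)
    _ = _ := by rw [one_mul]

/-- Weights `w` with `w 0 = 1` which are nondecreasing and grow at most geometrically. -/
def IsWeight (ρ : ℝ) (w : ℕ → ℝ) : Prop :=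
  w 0 = 1 ∧ (∀ k, 0 < w k) ∧ (∀ k, w k ≤ w (k + 1)) ∧ ∀ k, w (k + 1) ≤ ρ * w k

lemma isWeight_pow_min {ρ : ℝ} (hρ : 1 ≤ ρ) (K : ℕ) : IsWeight ρ fun k => ρ ^ min k K := by
  refine ⟨by simp, fun k => by positivity, fun k => pow_le_pow_right₀ hρ (by omega), fun k => ?_⟩
  simp only
  rw [← pow_succ']
  exact pow_le_pow_right₀ hρ (by omega)

lemma IsWeight.rpow {ρ : ℝ} (hρ : 0 ≤ ρ) {w : ℕ → ℝ} (hw : IsWeight ρ w) {q : ℝ} (hq : 0 ≤ q) :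
    IsWeight (ρ ^ q) fun k => w k ^ q := by
  obtain ⟨h0, h1, h2, h3⟩ := hw
  refine ⟨by simp [h0], fun k => Real.rpow_pos_of_pos (h1 k) _,
    fun k => Real.rpow_le_rpow (h1 k).le (h2 k) hq, fun k => ?_⟩
  simp only
  rw [← Real.mul_rpow hρ (h1 k).le]
  exact Real.rpow_le_rpow (h1 _).le (h3 k) hq

/-- Geometric decay of two coupled sequences by a bootstrap argument. -/
lemma exists_geometric_bound {p q ρ : ℝ} (hq : 0 < q) (hpq : 1 < p * q) (hρ : 1 ≤ ρ)
    {U V m n : ℕ → ℝ} (hU : ∀ k, 0 ≤ U k) (hV : ∀ k, 0 ≤ V k) (hU0 : Tendsto U atTop (𝓝 0))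
    (hV0 : Tendsto V atTop (𝓝 0)) {k₁ : ℕ}
    (hm : ∀ δ, 0 < δ → ∃ C, 0 < C ∧ ∀ k, k₁ ≤ k → m k ≤ δ * U k + C * V k ^ p)
    (hn : ∀ δ, 0 < δ → ∃ C, 0 < C ∧ ∀ k, k₁ ≤ k → n k ≤ δ * V k + C * U k ^ q)
    {C₁ : ℝ} (hC₁ : 0 < C₁) {D₁ D₂ : ℕ → ℝ}
    (HU : ∀ k₀ w E, 0 ≤ E → IsWeight ρ w → (∀ k, k₀ ≤ k → w k * m k ≤ E) →
      ∀ k, k₀ ≤ k → w k * U k ≤ D₁ k₀ + C₁ * E)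
    (HV : ∀ k₀ w E, 0 ≤ E → IsWeight (ρ ^ q) w → (∀ k, k₀ ≤ k → w k * n k ≤ E) →
      ∀ k, k₀ ≤ k → w k * V k ≤ D₂ k₀ + C₁ * E) :
    ∃ (k₀ : ℕ) (X L : ℝ), ∀ k : ℕ, k₀ ≤ k → ρ ^ k * U k ≤ X ∧ (ρ ^ k) ^ q * V k ≤ L := by
  have hp : 0 < p := by
    by_contra h
    nlinarith
  have h2q : (0 : ℝ) < 2 ^ q := by positivity
  obtain ⟨c₂, hc₂, hn'⟩ := hn (1 / (4 * C₁ * 2 ^ q)) (by positivity)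
  set L := (4 * C₁ * c₂ * 2 ^ q) ^ (1 / q) with hL
  have hL0 : 0 < L := by positivity
  have hLq : L ^ q = 4 * C₁ * c₂ * 2 ^ q := by
    rw [hL, ← Real.rpow_mul (by positivity), one_div, inv_mul_cancel₀ hq.ne', Real.rpow_one]
  obtain ⟨c₁, hc₁, hm'⟩ := hm (1 / (8 * C₁)) (by positivity)
  set ε := 1 / (8 * C₁ * c₁ * L) with hε
  have hε0 : 0 < ε := by positivity
  have hexp : 0 < p - 1 / q := by
    rw [sub_pos, div_lt_iff₀ hq]; exact hpq
  have hVs : Tendsto (fun k => V k ^ (p - 1 / q)) atTop (𝓝 0) := by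
    have := hV0.rpow_const (p := p - 1 / q) (Or.inr hexp.le)
    rwa [Real.zero_rpow hexp.ne'] at this
  obtain ⟨k₂, hk₂⟩ := eventually_atTop.1 (hVs.eventually_lt_const hε0)
  set k₀ := max k₁ k₂ with hk₀
  set X₀ := max (4 * D₁ k₀) (2 / L * (2 * |D₂ k₀| + 1) ^ (1 / q)) with hX₀
  have hX₀0 : 0 < X₀ := lt_max_of_lt_right (by positivity)
  refine ⟨k₀, X₀, (L * X₀) ^ q, ?_⟩
  have main : ∀ w, IsWeight ρ w → ∀ X, X₀ ≤ X →
      (∀ k, k₀ ≤ k → w k * U k ≤ X ∧ w k ^ q * V k ≤ (L * X) ^ q) →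
      ∀ k, k₀ ≤ k → w k * U k ≤ X / 2 ∧ w k ^ q * V k ≤ (L * (X / 2)) ^ q := by
    intro w hw X hX hP
    have hX0 : 0 < X := hX₀0.trans_le hX
    have hw0 := hw.2.1
    intro k hk
    constructor
    · have h1 := HU k₀ w (X / (4 * C₁)) (by positivity) hw (fun k hk => ?_) k hk
      · have h2 : 4 * D₁ k₀ ≤ X := (le_max_left _ _).trans hX
        have h3 : C₁ * (X / (4 * C₁)) = X / 4 := by field_simp
        rw [h3] at h1
        linarith
      · obtain ⟨h2, h3⟩ := hP k hk
        have h4 := hm' k (by omega)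
        have h5 := hk₂ k (by omega)
        have h6 : w k * V k ^ p ≤ L * X * ε := by
          have e1 : V k ^ p = V k ^ (1 / q) * V k ^ (p - 1 / q) := by
            rw [← Real.rpow_add_of_nonneg (hV k) (by positivity) hexp.le]
            congr 1; ring
          have e2 : w k * V k ^ (1 / q) ≤ L * X := by
            have := Real.rpow_le_rpow (mul_nonneg (Real.rpow_nonneg (hw0 k).le _) (hV k)) h3
              (show 0 ≤ 1 / q by positivity)
            rwa [Real.mul_rpow (Real.rpow_nonneg (hw0 k).le _) (hV k),
              ← Real.rpow_mul (hw0 k).le, ← Real.rpow_mul (by positivity), mul_one_div_cancel hq.ne',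
              Real.rpow_one, Real.rpow_one] at this
          rw [e1, ← mul_assoc]
          exact mul_le_mul e2 h5.le (Real.rpow_nonneg (hV k) _) (by positivity)
        calc w k * m k ≤ w k * (1 / (8 * C₁) * U k + c₁ * V k ^ p) :=
              mul_le_mul_of_nonneg_left h4 (hw0 k).le
          _ = 1 / (8 * C₁) * (w k * U k) + c₁ * (w k * V k ^ p) := by ring
          _ ≤ 1 / (8 * C₁) * X + c₁ * (L * X * ε) := by gcongr
          _ = X / (4 * C₁) := by rw [hε]; field_simp; norm_num
    · have h1 := HV k₀ (fun k => w k ^ q) ((L * X) ^ q / (2 * C₁ * 2 ^ q)) (by positivity)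
        (hw.rpow (by linarith) hq.le) (fun k hk => ?_) k hk
      · have h2 : 2 * |D₂ k₀| + 1 ≤ (L * X / 2) ^ q := by
          have : 2 / L * (2 * |D₂ k₀| + 1) ^ (1 / q) ≤ X := (le_max_right _ _).trans hX
          have h3 : (2 * |D₂ k₀| + 1) ^ (1 / q) ≤ L * X / 2 := by
            have h4 := mul_le_mul_of_nonneg_left this (show 0 ≤ L / 2 by positivity)
            have e : L / 2 * (2 / L * (2 * |D₂ k₀| + 1) ^ (1 / q)) =
              (2 * |D₂ k₀| + 1) ^ (1 / q) := by field_simp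
            linarith
          have h5 := Real.rpow_le_rpow (by positivity) h3 hq.le
          rwa [← Real.rpow_mul (by positivity), one_div, inv_mul_cancel₀ hq.ne',
            Real.rpow_one] at h5
        have h3 : C₁ * ((L * X) ^ q / (2 * C₁ * 2 ^ q)) = (L * X / 2) ^ q / 2 := by
          rw [Real.div_rpow (by positivity) (by norm_num)]; field_simp
        rw [h3] at h1
        rw [← mul_div_assoc]
        linarith [le_abs_self (D₂ k₀)]
      · obtain ⟨h2, h3⟩ := hP k hk
        have h4 := hn' k (by omega)
        have h6 : w k ^ q * U k ^ q ≤ X ^ q := by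
          rw [← Real.mul_rpow (hw0 k).le (hU k)]
          exact Real.rpow_le_rpow (mul_nonneg (hw0 k).le (hU k)) h2 hq.le
        have hwq : 0 ≤ w k ^ q := Real.rpow_nonneg (hw0 k).le _
        calc w k ^ q * n k ≤ w k ^ q * (1 / (4 * C₁ * 2 ^ q) * V k + c₂ * U k ^ q) :=
              mul_le_mul_of_nonneg_left h4 hwq
          _ = 1 / (4 * C₁ * 2 ^ q) * (w k ^ q * V k) + c₂ * (w k ^ q * U k ^ q) := by ring
          _ ≤ 1 / (4 * C₁ * 2 ^ q) * (L * X) ^ q + c₂ * X ^ q := by gcongr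
          _ = (L * X) ^ q / (2 * C₁ * 2 ^ q) := by
            rw [Real.mul_rpow hL0.le hX0.le, hLq]; field_simp; norm_num
  have fin : ∀ w, IsWeight ρ w → (∃ W, ∀ k, w k ≤ W) →
      ∀ k, k₀ ≤ k → w k * U k ≤ X₀ ∧ w k ^ q * V k ≤ (L * X₀) ^ q := by
    rintro w hw ⟨W, hW⟩
    have hw0 := hw.2.1
    obtain ⟨B₁, hB₁⟩ := hU0.bddAbove_range
    obtain ⟨B₂, hB₂⟩ := hV0.bddAbove_range
    have hW0 : 0 < W := (hw0 0).trans_le (hW 0)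
    set Z := max X₀ (max (W * B₁) (L⁻¹ * (W ^ q * |B₂|) ^ (1 / q))) with hZ
    have ind : ∀ j : ℕ, ∀ k, k₀ ≤ k → w k * U k ≤ max X₀ (Z / 2 ^ j) ∧
        w k ^ q * V k ≤ (L * max X₀ (Z / 2 ^ j)) ^ q := by
      intro j
      induction j with
      | zero =>
        intro k hk
        rw [pow_zero, div_one, max_eq_right (le_max_left _ _)]
        have u1 : U k ≤ B₁ := hB₁ ⟨k, rfl⟩
        have v1 : V k ≤ |B₂| := (hB₂ ⟨k, rfl⟩).trans (le_abs_self _)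
        constructor
        · exact (mul_le_mul (hW k) u1 (hU k) hW0.le).trans
            ((le_max_left _ _).trans (le_max_right _ _))
        · have h1 : (W ^ q * |B₂|) ^ (1 / q) ≤ L * Z := by
            have : L⁻¹ * (W ^ q * |B₂|) ^ (1 / q) ≤ Z := (le_max_right _ _).trans (le_max_right _ _)
            rwa [inv_mul_le_iff₀ hL0] at this
          have h2 := Real.rpow_le_rpow (by positivity) h1 hq.le
          rw [← Real.rpow_mul (by positivity), one_div, inv_mul_cancel₀ hq.ne', Real.rpow_one] at h2
          exact (mul_le_mul (Real.rpow_le_rpow (hw0 k).le (hW k) hq.le) v1 (hV k)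
            (by positivity)).trans h2
      | succ j ih =>
        intro k hk
        obtain ⟨h1, h2⟩ := main w hw _ (le_max_left _ _) ih k hk
        have h3 : max X₀ (Z / 2 ^ j) / 2 ≤ max X₀ (Z / 2 ^ (j + 1)) := by
          rw [pow_succ, ← div_div]
          rcases le_total X₀ (Z / 2 ^ j) with h | h
          · rw [max_eq_right h]; exact le_max_right _ _
          · rw [max_eq_left h]; exact (by linarith : X₀ / 2 ≤ X₀).trans (le_max_left _ _)
        have h4 : 0 ≤ max X₀ (Z / 2 ^ j) / 2 := by
          have : 0 < max X₀ (Z / 2 ^ j) := lt_max_of_lt_left hX₀0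
          positivity
        exact ⟨h1.trans h3, h2.trans (Real.rpow_le_rpow (by positivity)
          (mul_le_mul_of_nonneg_left h3 hL0.le) hq.le)⟩
    have hlim : Tendsto (fun j : ℕ => Z / 2 ^ j) atTop (𝓝 0) :=
      tendsto_const_nhds.div_atTop (tendsto_pow_atTop_atTop_of_one_lt one_lt_two)
    obtain ⟨j, hj⟩ := (hlim.eventually_le_const hX₀0).exists
    have := ind j
    rwa [max_eq_left hj] at this
  intro k hk
  have h1 := fin _ (isWeight_pow_min hρ k) ⟨ρ ^ k, fun j => pow_le_pow_right₀ hρ (by omega)⟩ k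
    hk
  simpa using h1

end Sequences

namespace HLERep

open Filter Topology

variable {N : ℕ} {p q a b : ℝ} {u v : Euc N → ℝ}

lemma setIntegral_annu_norm_le {R : ℝ} (hR : 0 < R) (a : ℝ) :
    ∫ x in annu N (2 * R), ‖x‖ ^ a ≤
      4 ^ |a| * 3 ^ N * (volume (closedBall (0 : Euc N) 1)).toReal * R ^ ((N : ℝ) + a) := by
  have e0 : annu N (2 * R) = shell N R 0 := by
    ext x
    simp only [annu, shell, mem_ofPred_eq]
    rw [show 2 * R / 2 = R * (1 - 0 / 2) by ring, show 2 * R = R * (2 + 0) by ring]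
  rw [e0]
  exact setIntegral_shell_norm_le hR zero_le_one

lemma energy_cont (h : HLERep N p q a b u v) :
    ContinuousOn (fun x => src a p v x * v x) {x : Euc N | x ≠ 0} :=
  h.src_cont.mul h.v_cont.continuousOn

lemma energy_nonneg (h : HLERep N p q a b u v) (x : Euc N) : 0 ≤ src a p v x * v x :=
  mul_nonneg (h.src_nn x) (h.v_pos x).le

/-- A bound for the energy on an annulus controls the mass there. -/
lemma mass_le_of_energy (h : HLERep N p q a b u v) {C R δ : ℝ} (hC : 0 < C) (hR : 0 < R)
    (hδ : 0 < δ) (hE : ∫ x in annu N (2 * R), src a p v x * v x ≤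
      C * (R ^ ((N : ℝ) - 2) * hat (src a p v) R * hat (src b q u) R)) :
    ∫ x in annu N (2 * R), src a p v x ≤ δ * (R ^ ((N : ℝ) - 2) * hat (src a p v) R) +
      (C / δ) ^ p * (4 ^ |a| * 3 ^ N * (volume (closedBall (0 : Euc N) 1)).toReal) *
        (R ^ ((N : ℝ) + a) * hat (src b q u) R ^ p) := by
  have hp := h.hp
  have h2R : 0 < 2 * R := by positivity
  set V := hat (src b q u) R with hV
  have hV0 : 0 < V := h.symm.hat_pos hR
  set l := C / δ * V with hl
  have hl0 : 0 < l := by positivity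
  have hpt : ∀ x, src a p v x ≤ l⁻¹ * (src a p v x * v x) + l ^ p * ‖x‖ ^ a := by
    intro x
    have hv := h.v_pos x
    have hn : 0 ≤ ‖x‖ ^ a := by positivity
    rcases le_or_gt l (v x) with hlv | hlv
    · have h1 : 1 ≤ l⁻¹ * v x := by rw [inv_mul_eq_div, one_le_div hl0]; exact hlv
      have h2 := mul_le_mul_of_nonneg_left h1 (h.src_nn x)
      have h3 : 0 ≤ l ^ p * ‖x‖ ^ a := by positivity
      calc src a p v x = src a p v x * 1 := (mul_one _).symm
        _ ≤ src a p v x * (l⁻¹ * v x) := h2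
        _ = l⁻¹ * (src a p v x * v x) := by ring
        _ ≤ _ := le_add_of_nonneg_right h3
    · have h1 : v x ^ p ≤ l ^ p := Real.rpow_le_rpow hv.le hlv.le hp.le
      have h2 : 0 ≤ l⁻¹ * (src a p v x * v x) :=
        mul_nonneg (by positivity) (h.energy_nonneg x)
      have h3 := mul_le_mul_of_nonneg_left h1 hn
      rw [src] at h2 ⊢
      linarith
  have i1 := (integrableOn_annu h.energy_cont h2R).const_mul l⁻¹
  have i2 := (integrableOn_annu (continuousOn_norm_rpow (N := N) a) h2R).const_mul (l ^ p)
  have h1 := setIntegral_mono (integrableOn_annu h.src_cont h2R) (i1.add i2) hpt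
  rw [integral_add' i1 i2, integral_const_mul, integral_const_mul] at h1
  refine h1.trans (add_le_add ?_ ?_)
  · refine (mul_le_mul_of_nonneg_left hE (by positivity)).trans_eq ?_
    rw [hl]; field_simp
  · refine (mul_le_mul_of_nonneg_left (setIntegral_annu_norm_le hR a) (by positivity)).trans_eq ?_
    rw [hl, Real.mul_rpow (by positivity) hV0.le]; ring

lemma hat_weighted_bound (h : HLERep N p q a b u v) {α ρ : ℝ} (hα : 0 < α) (hρ : 0 < ρ)
    (hρr : ρ < 2 ^ ((N : ℝ) - 2 - α)) {w : ℕ → ℝ} (hw : IsWeight ρ w) {E : ℝ} (hE : 0 ≤ E)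
    {k₀ : ℕ} (hμ : ∀ k, k₀ ≤ k → w k * ((((2 : ℝ) ^ ((N : ℝ) - 2 - α)) ^ k)⁻¹ *
      ∫ y in annu N (2 * 2 ^ k), src a p v y) ≤ E) (k : ℕ) (hk : k₀ ≤ k) :
    w k * (((2 : ℝ) ^ k) ^ α * hat (src a p v) (2 ^ k)) ≤
      (∫ y in closedBall 0 (2 ^ k₀), src a p v y) +
        (ρ / (2 ^ ((N : ℝ) - 2 - α) - ρ) + 2 ^ α / (2 ^ α - 1)) * E := by
  have e : ∀ k : ℕ, (((2 : ℝ) ^ ((N : ℝ) - 2 - α) * 2 ^ α) ^ k)⁻¹ =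
      ((2 : ℝ) ^ k) ^ (-((N : ℝ) - 2)) := by
    intro k
    rw [← Real.rpow_add two_pos, sub_add_cancel, Real.rpow_neg (by positivity),
      ← Real.rpow_natCast, ← Real.rpow_natCast, ← Real.rpow_mul two_pos.le,
      ← Real.rpow_mul two_pos.le, mul_comm]
  have e2 : ((2 : ℝ) ^ k) ^ α = (2 ^ α) ^ k := by
    rw [← Real.rpow_natCast, ← Real.rpow_natCast, ← Real.rpow_mul two_pos.le,
      ← Real.rpow_mul two_pos.le, mul_comm]
  rw [h.hat_eq (by positivity), e2, ← e]
  refine weighted_dyadic_bound (M := fun k => ∫ y in closedBall 0 (2 ^ k), src a p v y)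
    (T := fun k => ∫ y in (closedBall 0 (2 ^ k))ᶜ, src a p v y * ‖y‖ ^ (-((N : ℝ) - 2)))
    (μ := fun k => ∫ y in annu N (2 * 2 ^ k), src a p v y) hρ hρr
    (Real.one_lt_rpow one_lt_two hα) (fun k => ?_) (fun k => ?_) h.tendsto_tail hw.1 hw.2.1
    hw.2.2.1 hw.2.2.2 hE (integral_nonneg h.src_nn) hμ k hk
  · rw [pow_succ' (2 : ℝ)]
    exact h.ball_le (by positivity)
  · rw [pow_succ' (2 : ℝ) k, e]
    exact h.tail_le (by positivity)

/-- Stable solutions with `R ^ α * hat (src a p v) R → 0` decay faster by a power and have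
finite energy. -/
lemma exists_decay (h : HLERep N p q a b u v) {α β l : ℝ} (hα : 0 < α) (hβ : 0 < β)
    (hpβ : p * β = α + 2 + a) (hqα : q * α = β + 2 + b) (hl : 0 < l) (hlA : l < (N : ℝ) - 2 - α)
    (hlB : q * l < (N : ℝ) - 2 - β)
    (hU0 : Tendsto (fun k : ℕ => ((2 : ℝ) ^ k) ^ α * hat (src a p v) (2 ^ k)) atTop (𝓝 0))
    {R₀ : ℝ} (hst : ∀ R, 0 < R → R₀ ≤ R →
      HLEStableOn p q a b u v {x | R / 4 < ‖x‖ ∧ ‖x‖ < 4 * R}) :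
    ∃ (k₀ : ℕ) (X L C : ℝ), 0 < C ∧ ∀ k : ℕ, k₀ ≤ k →
      ((2 : ℝ) ^ l) ^ k * (((2 : ℝ) ^ k) ^ α * hat (src a p v) (2 ^ k)) ≤ X ∧
      (((2 : ℝ) ^ l) ^ k) ^ q * (((2 : ℝ) ^ k) ^ β * hat (src b q u) (2 ^ k)) ≤ L ∧
      ∫ x in annu N (2 * 2 ^ k), src a p v x * v x ≤
        C * (((2 : ℝ) ^ k) ^ ((N : ℝ) - 2) * hat (src a p v) (2 ^ k) * hat (src b q u) (2 ^ k)) := by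
  have hp := h.hp
  have hq := h.hq
  obtain ⟨C₀, hC₀, hE⟩ := h.exists_energy_bound
  obtain ⟨Ch, hCh, hhat⟩ := h.exists_hat_rpow_le
  set C := C₀ * (1 + Ch) with hC
  have hC0 : 0 < C := by positivity
  have hE' : ∀ R, 0 < R → R₀ ≤ R →
      (∫ x in annu N (2 * R), src a p v x * v x ≤
        C * (R ^ ((N : ℝ) - 2) * hat (src a p v) R * hat (src b q u) R)) ∧
      ∫ x in annu N (2 * R), src b q u x * u x ≤
        C * (R ^ ((N : ℝ) - 2) * hat (src b q u) R * hat (src a p v) R) := by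
    intro R hR hR0
    obtain ⟨h1, h2⟩ := hE R hR (hst R hR hR0)
    have hV := h.symm.hat_pos hR
    have h3 : C₀ * (R ^ ((N : ℝ) - 2) * hat (src a p v) R * hat (src b q u) R +
        R ^ ((N : ℝ) + a) * hat (src b q u) R ^ (p + 1)) ≤
        C * (R ^ ((N : ℝ) - 2) * hat (src a p v) R * hat (src b q u) R) := by
      have h4 := mul_le_mul_of_nonneg_left (hhat R hR)
        (show 0 ≤ R ^ ((N : ℝ) - 2) * hat (src b q u) R by positivity)
      have e : R ^ ((N : ℝ) + a) = R ^ ((N : ℝ) - 2) * R ^ (a + 2) := by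
        rw [← Real.rpow_add hR]; congr 1; ring
      rw [hC, mul_assoc C₀]
      refine mul_le_mul_of_nonneg_left ?_ hC₀.le
      rw [e, Real.rpow_add_one hV.ne']
      linarith
    refine ⟨h1.trans h3, h2.trans (h3.trans_eq ?_)⟩
    ring
  set U : ℕ → ℝ := fun k => ((2 : ℝ) ^ k) ^ α * hat (src a p v) (2 ^ k) with hU
  set V : ℕ → ℝ := fun k => ((2 : ℝ) ^ k) ^ β * hat (src b q u) (2 ^ k) with hV
  have hUn : ∀ k, 0 ≤ U k := fun k => mul_nonneg (by positivity) (h.hat_nonneg _)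
  have hVn : ∀ k, 0 ≤ V k := fun k => mul_nonneg (by positivity) (h.symm.hat_nonneg _)
  have hV0 : Tendsto V atTop (𝓝 0) := by
    have h1 : ∀ k, V k ≤ (Ch * U k) ^ (1 / p) := by
      intro k
      have h2k : (0 : ℝ) < 2 ^ k := by positivity
      have h2 := mul_le_mul_of_nonneg_left (hhat (2 ^ k) h2k)
        (show 0 ≤ ((2 : ℝ) ^ k) ^ α by positivity)
      have h3 : V k ^ p ≤ Ch * U k := by
        simp only [hU, hV]
        rw [Real.mul_rpow (by positivity) (h.symm.hat_nonneg _), ← Real.rpow_mul h2k.le,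
          show β * p = α + (a + 2) by linarith, Real.rpow_add h2k]
        linarith
      have h4 := Real.rpow_le_rpow (Real.rpow_nonneg (hVn k) _) h3 (show 0 ≤ 1 / p by positivity)
      rwa [← Real.rpow_mul (hVn k), mul_one_div_cancel hp.ne', Real.rpow_one] at h4
    have h2 := (hU0.const_mul Ch).rpow_const (p := 1 / p) (Or.inr (by positivity))
    rw [mul_zero, Real.zero_rpow (by positivity)] at h2
    exact squeeze_zero hVn h1 h2
  obtain ⟨k₁, hk₁⟩ := eventually_atTop.1
    ((tendsto_pow_atTop_atTop_of_one_lt (one_lt_two (α := ℝ))).eventually_ge_atTop R₀)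
  set A := (N : ℝ) - 2 - α with hA
  set B := (N : ℝ) - 2 - β with hB
  set Ω₁ := fun a : ℝ => (4 : ℝ) ^ |a| * 3 ^ N * (volume (closedBall (0 : Euc N) 1)).toReal with hΩ
  have hΩ0 : ∀ a, 0 < Ω₁ a := fun a => mul_pos (by positivity) volume_unit_pos
  have pw : ∀ (c : ℝ) (k : ℕ), ((2 : ℝ) ^ c) ^ k = ((2 : ℝ) ^ k) ^ c := fun c k => by
    rw [← Real.rpow_natCast, ← Real.rpow_natCast, ← Real.rpow_mul two_pos.le,
      ← Real.rpow_mul two_pos.le, mul_comm]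
  have norm1 : ∀ (x c d A α β e δ K M Uh Vh : ℝ), 0 < x → 0 ≤ Uh → 0 ≤ Vh → c = A + α →
      d = A + β * e → M ≤ δ * (x ^ c * Uh) + K * (x ^ d * Vh ^ e) →
      (x ^ A)⁻¹ * M ≤ δ * (x ^ α * Uh) + K * (x ^ β * Vh) ^ e := by
    intro x c d A α β e δ K M Uh Vh hx hUh hVh hc hd hM
    rw [inv_mul_le_iff₀ (by positivity), Real.mul_rpow (by positivity) hVh, ← Real.rpow_mul hx.le]
    rw [hc, hd, Real.rpow_add hx, Real.rpow_add hx] at hM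
    linarith
  have hρ1 : (1 : ℝ) ≤ 2 ^ l := Real.one_le_rpow one_le_two hl.le
  set cU := (2 : ℝ) ^ l / (2 ^ A - 2 ^ l) + 2 ^ α / (2 ^ α - 1) with hcU
  set cV := ((2 : ℝ) ^ l) ^ q / (2 ^ B - (2 ^ l) ^ q) + 2 ^ β / (2 ^ β - 1) with hcV
  have hlA' : (2 : ℝ) ^ l < 2 ^ A := Real.rpow_lt_rpow_of_exponent_lt one_lt_two hlA
  have hlB' : ((2 : ℝ) ^ l) ^ q < 2 ^ B := by
    rw [← Real.rpow_mul two_pos.le, mul_comm]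
    exact Real.rpow_lt_rpow_of_exponent_lt one_lt_two hlB
  obtain ⟨k₀, X, L, hXL⟩ := exists_geometric_bound (p := p) (q := q) (ρ := 2 ^ l) hq h.hpq hρ1
    hUn hVn hU0 hV0 (k₁ := k₁)
    (m := fun k => (((2 : ℝ) ^ A) ^ k)⁻¹ * ∫ y in annu N (2 * 2 ^ k), src a p v y)
    (n := fun k => (((2 : ℝ) ^ B) ^ k)⁻¹ * ∫ y in annu N (2 * 2 ^ k), src b q u y)
    (C₁ := max 1 (max cU cV))
    (D₁ := fun k₀ => ∫ y in closedBall 0 (2 ^ k₀), src a p v y)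
    (D₂ := fun k₀ => ∫ y in closedBall 0 (2 ^ k₀), src b q u y)
    (fun δ hδ => ⟨(C / δ) ^ p * Ω₁ a, mul_pos (by positivity) (hΩ0 a), fun k hk => by
      have h2k : (0 : ℝ) < 2 ^ k := by positivity
      simp only [pw]
      exact norm1 _ ((N : ℝ) - 2) (N + a) _ _ _ _ _ _ _ _ _ h2k (h.hat_nonneg _) (h.symm.hat_nonneg _)
        (by rw [hA]; ring) (by rw [hA]; linarith)
        (h.mass_le_of_energy hC0 h2k hδ (hE' _ h2k (hk₁ k hk)).1)⟩)
    (fun δ hδ => ⟨(C / δ) ^ q * Ω₁ b, mul_pos (by positivity) (hΩ0 b), fun k hk => by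
      have h2k : (0 : ℝ) < 2 ^ k := by positivity
      simp only [pw]
      exact norm1 _ ((N : ℝ) - 2) (N + b) _ _ _ _ _ _ _ _ _ h2k (h.symm.hat_nonneg _) (h.hat_nonneg (2 ^ k))
        (by rw [hB]; ring) (by rw [hB]; linarith)
        (h.symm.mass_le_of_energy hC0 h2k hδ (hE' _ h2k (hk₁ k hk)).2)⟩)
    (lt_max_of_lt_left one_pos)
    (fun k₀ w E hE hw hμ k hk =>
      (h.hat_weighted_bound hα (by positivity) hlA' hw hE hμ k hk).trans (by
        refine add_le_add_right (mul_le_mul_of_nonneg_right ?_ hE) _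
        exact (le_max_left _ _).trans (le_max_right _ _)))
    (fun k₀ w E hE hw hμ k hk =>
      (h.symm.hat_weighted_bound hβ (by positivity) hlB' hw hE hμ k hk).trans (by
        refine add_le_add_right (mul_le_mul_of_nonneg_right ?_ hE) _
        exact (le_max_right _ _).trans (le_max_right _ _)))
  refine ⟨max k₀ k₁, X, L, C, hC0, fun k hk => ?_⟩
  obtain ⟨h1, h2⟩ := hXL k (by omega)
  exact ⟨h1, h2, (hE' _ (by positivity) (hk₁ k (by omega))).1⟩

/-- Finiteness of the energy. -/
lemma integrable_energy (h : HLERep N p q a b u v) {α β l : ℝ} (hα : 0 < α) (hβ : 0 < β)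
    (hpβ : p * β = α + 2 + a) (hqα : q * α = β + 2 + b) (hl : 0 < l) (hlA : l < (N : ℝ) - 2 - α)
    (hlB : q * l < (N : ℝ) - 2 - β) (hlΘ : (N : ℝ) - 2 - α - β < (1 + q) * l)
    (hU0 : Tendsto (fun k : ℕ => ((2 : ℝ) ^ k) ^ α * hat (src a p v) (2 ^ k)) atTop (𝓝 0))
    {R₀ : ℝ} (hst : ∀ R, 0 < R → R₀ ≤ R →
      HLEStableOn p q a b u v {x | R / 4 < ‖x‖ ∧ ‖x‖ < 4 * R}) :
    Integrable fun x => src a p v x * v x := by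
  obtain ⟨k₀, X, L, C, hC, hdec⟩ := h.exists_decay hα hβ hpβ hqα hl hlA hlB hU0 hst
  set x := (2 : ℝ) ^ ((N : ℝ) - 2 - α - β - (1 + q) * l) with hx
  have hx0 : 0 < x := by positivity
  have hx1 : x < 1 := Real.rpow_lt_one_of_one_lt_of_neg one_lt_two (by linarith)
  have hx1' : 0 < 1 - x := by linarith
  have hann : ∀ k, k₀ ≤ k → ∫ y in annu N (2 * 2 ^ k), src a p v y * v y ≤ C * X * L * x ^ k := by
    intro k hk
    obtain ⟨h1, h2, h3⟩ := hdec k hk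
    have hU := h.hat_nonneg (2 ^ k)
    have hV := h.symm.hat_nonneg (2 ^ k)
    have hX : 0 ≤ X := le_trans (by positivity) h1
    refine h3.trans ?_
    have h4 := mul_le_mul h1 h2 (by positivity) hX
    have h2k : (0 : ℝ) < 2 ^ k := by positivity
    have pw : ∀ c : ℝ, ((2 : ℝ) ^ c) ^ k = ((2 : ℝ) ^ k) ^ c := fun c => by
      rw [← Real.rpow_natCast, ← Real.rpow_natCast, ← Real.rpow_mul two_pos.le,
        ← Real.rpow_mul two_pos.le, mul_comm]
    have e : ((2 : ℝ) ^ k) ^ ((N : ℝ) - 2) = x ^ k * (((2 : ℝ) ^ l) ^ k * ((2 : ℝ) ^ k) ^ α *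
        (((2 : ℝ) ^ l) ^ k) ^ q * ((2 : ℝ) ^ k) ^ β) := by
      rw [hx, pw, pw, ← Real.rpow_mul h2k.le, ← Real.rpow_add h2k, ← Real.rpow_add h2k,
        ← Real.rpow_add h2k, ← Real.rpow_add h2k]
      congr 1; ring
    rw [e, mul_assoc C X L, mul_assoc C, mul_comm (X * L)]
    refine mul_le_mul_of_nonneg_left ?_ hC.le
    refine le_trans (le_of_eq ?_) (mul_le_mul_of_nonneg_left h4 (show 0 ≤ x ^ k by positivity))
    ring
  have iball : ∀ R, 0 < R → IntegrableOn (fun y => src a p v y * v y) (closedBall 0 R) := by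
    intro R hR
    obtain ⟨K, hK⟩ := (isCompact_closedBall (0 : Euc N) R).exists_bound_of_continuousOn
      h.v_cont.continuousOn
    refine Integrable.mul_bdd (c := K) (h.integrableOn_closedBall hR)
      h.v_cont.aestronglyMeasurable.restrict ?_
    exact (ae_restrict_iff' measurableSet_closedBall).2 (ae_of_all _ hK)
  have hstep : ∀ k : ℕ, ∫ y in closedBall 0 (2 ^ (k + 1)), src a p v y * v y ≤
      (∫ y in closedBall 0 (2 ^ k), src a p v y * v y) +
        ∫ y in annu N (2 * 2 ^ k), src a p v y * v y := by
    intro k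
    have h2k : (0 : ℝ) < 2 ^ k := by positivity
    have i1 := iball (2 ^ k) h2k
    have i2 := integrableOn_annu h.energy_cont (show (0 : ℝ) < 2 * 2 ^ k by positivity)
    refine le_trans (setIntegral_mono_set (i1.union i2) (ae_of_all _ h.energy_nonneg)
      (LE.le.eventuallyLE fun y hy => ?_))
      (setIntegral_union_le measurableSet_closedBall (measurableSet_annu _) h.energy_nonneg i1 i2)
    rw [mem_closedBall_zero_iff, pow_succ'] at hy
    rcases le_total ‖y‖ (2 ^ k) with h1 | h1
    · exact Or.inl (mem_closedBall_zero_iff.2 h1)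
    · exact Or.inr ⟨by linarith, hy⟩
  set D := ∫ y in closedBall 0 (2 ^ k₀), src a p v y * v y with hD
  have hCXL : 0 ≤ C * X * L := by
    have := (setIntegral_nonneg (measurableSet_annu (N := N) (2 * 2 ^ k₀))
      fun y _ => h.energy_nonneg y).trans (hann k₀ le_rfl)
    exact nonneg_of_mul_nonneg_left this (by positivity)
  have hbd : ∀ k, k₀ ≤ k → ∫ y in closedBall 0 (2 ^ k), src a p v y * v y ≤
      D + C * X * L / (1 - x) * (1 - x ^ k) := by
    intro k hk
    induction k, hk using Nat.le_induction with
    | base =>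
      have : x ^ k₀ ≤ 1 := pow_le_one₀ hx0.le hx1.le
      have h2 : 0 ≤ C * X * L / (1 - x) * (1 - x ^ k₀) :=
        mul_nonneg (div_nonneg hCXL hx1'.le) (by linarith)
      linarith
    | succ k hk ih =>
      have h1 := hstep k
      have h2 := hann k hk
      have e : C * X * L / (1 - x) * (1 - x ^ (k + 1)) =
          C * X * L / (1 - x) * (1 - x ^ k) + C * X * L * x ^ k := by
        rw [pow_succ]; field_simp; ring
      rw [e]
      linarith
  refine AECover.integrable_of_integral_bounded_of_nonneg_ae
    (aecover_closedBall (x := (0 : Euc N))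
      (tendsto_pow_atTop_atTop_of_one_lt (one_lt_two (α := ℝ)))) (D + C * X * L / (1 - x))
    (fun k => iball _ (by positivity)) (ae_of_all _ h.energy_nonneg) ?_
  refine (eventually_ge_atTop k₀).mono fun k hk => (hbd k hk).trans ?_
  have h2 : C * X * L / (1 - x) * (1 - x ^ k) ≤ C * X * L / (1 - x) :=
    mul_le_of_le_one_right (div_nonneg hCXL hx1'.le) (by linarith [pow_pos hx0 k])
  linarith

end HLERep

section Plateau

open Filter Topology

variable {N : ℕ}

lemma exists_lipschitz_sg : ∃ C > 0, ∀ s t, |sg s - sg t| ≤ C * |s - t| := by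
  obtain ⟨C, hC, h⟩ := exists_bound_sg
  refine ⟨C, hC, fun s t => ?_⟩
  have := convex_univ.norm_image_sub_le_of_norm_deriv_le (𝕜 := ℝ) (f := sg) (C := C)
    (fun x _ => (contDiff_sg (n := 1)).differentiable (by norm_num) x)
    (fun x _ => (h x).1) (mem_univ t) (mem_univ s)
  simpa [Real.norm_eq_abs] using this

lemma exists_lipschitz_cut (N : ℕ) : ∃ C > 0, ∀ r > 0, ∀ x y : Euc N, ‖y‖ ≤ ‖x‖ →
    |cut r x - cut r y| * ‖y‖ ≤ C * ‖x - y‖ := by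
  obtain ⟨C, hC, h⟩ := exists_lipschitz_sg
  refine ⟨3 * C + 1, by positivity, fun r hr x y hyx => ?_⟩
  have hxy : ‖x‖ - ‖y‖ ≤ ‖x - y‖ := norm_sub_norm_le x y
  have hx0 := norm_nonneg x
  have hy0 := norm_nonneg y
  refine le_trans ?_ (mul_le_mul_of_nonneg_left hxy (by positivity))
  rcases le_total r ‖y‖ with h1 | h1
  · rw [cut_eq_one hr h1, cut_eq_one hr (h1.trans hyx)]
    simp only [sub_self, abs_zero, zero_mul]
    exact mul_nonneg (by positivity) (by linarith)
  rcases le_total ‖x‖ (2 * r) with h2 | h2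
  · have h3 : |cut r x - cut r y| ≤ C * (r⁻¹ ^ 2 * ((‖x‖ - ‖y‖) * (3 * r))) := by
      refine (h _ _).trans (mul_le_mul_of_nonneg_left ?_ hC.le)
      rw [← mul_sub, abs_of_nonneg (by
        apply mul_nonneg (by positivity); nlinarith)]
      refine mul_le_mul_of_nonneg_left ?_ (by positivity)
      nlinarith
    calc |cut r x - cut r y| * ‖y‖
        ≤ C * (r⁻¹ ^ 2 * ((‖x‖ - ‖y‖) * (3 * r))) * r :=
          mul_le_mul h3 h1 hy0 ((abs_nonneg _).trans h3)
      _ = 3 * C * (‖x‖ - ‖y‖) := by field_simp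
      _ ≤ _ := by nlinarith
  · have h3 : |cut r x - cut r y| ≤ 1 := by
      have := cut_nonneg r x
      have := cut_nonneg r y
      have := cut_le_one r x
      have := cut_le_one r y
      exact abs_le.2 ⟨by linarith, by linarith⟩
    have h4 := mul_le_mul_of_nonneg_right h3 hy0
    have h5 : 0 ≤ C * (‖x‖ - ‖y‖) := mul_nonneg hC.le (by linarith)
    linarith

/-- A smooth cutoff equal to one for `r ≤ ‖x‖ ≤ R / 2`, supported in `r / 2 ≤ ‖x‖ ≤ R`. -/
def plateau (r R : ℝ) (x : Euc N) : ℝ := cut r x * (1 - cut R x)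

lemma contDiff_plateau (r R : ℝ) {n : ℕ∞} : ContDiff ℝ n (plateau r R : Euc N → ℝ) :=
  (contDiff_cut r).mul (contDiff_const.sub (contDiff_cut R))

lemma plateau_nonneg (r R : ℝ) (x : Euc N) : 0 ≤ plateau r R x :=
  mul_nonneg (cut_nonneg r x) (sub_nonneg.2 (cut_le_one R x))

lemma plateau_le_one (r R : ℝ) (x : Euc N) : plateau r R x ≤ 1 :=
  mul_le_one₀ (cut_le_one r x) (sub_nonneg.2 (cut_le_one R x)) (by linarith [cut_nonneg R x])

lemma tsupport_plateau_subset {r R : ℝ} (hr : 0 < r) (hR : 0 < R) :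
    tsupport (plateau r R : Euc N → ℝ) ⊆ {x | r / 2 ≤ ‖x‖ ∧ ‖x‖ ≤ R} := by
  refine closure_minimal ?_ ((isClosed_le continuous_const continuous_norm).inter
    (isClosed_le continuous_norm continuous_const))
  intro x hx
  by_contra hc
  apply hx
  simp only [mem_ofPred_eq, not_and_or, not_le] at hc
  rcases hc with hc | hc
  · rw [plateau, cut_eq_zero hr hc.le, zero_mul]
  · rw [plateau, cut_eq_one hR hc.le, sub_self, mul_zero]

lemma tsupport_plateau_subset_ne_zero {r R : ℝ} (hr : 0 < r) (hR : 0 < R) :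
    tsupport (plateau r R : Euc N → ℝ) ⊆ {x | x ≠ 0} := by
  rintro x hx rfl
  have := (tsupport_plateau_subset hr hR hx).1
  rw [norm_zero] at this
  linarith

lemma hasCompactSupport_plateau {r R : ℝ} (hr : 0 < r) (hR : 0 < R) :
    HasCompactSupport (plateau r R : Euc N → ℝ) :=
  (isCompact_closedBall (0 : Euc N) R).of_isClosed_subset (isClosed_tsupport _) fun _ hx =>
    mem_closedBall_zero_iff.2 (tsupport_plateau_subset hr hR hx).2

lemma plateau_eq_one {r R : ℝ} (hr : 0 < r) (hR : 0 < R) {x : Euc N} (h1 : r ≤ ‖x‖)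
    (h2 : ‖x‖ ≤ R / 2) : plateau r R x = 1 := by
  rw [plateau, cut_eq_one hr h1, cut_eq_zero hR h2]
  ring

/-- The radial derivative `x · ∇ φ` of the cutoff. -/
def radPlateau (r R : ℝ) (x : Euc N) : ℝ := ∑ i, x i * pd i (plateau r R) x

lemma radPlateau_eq (r R : ℝ) (x : Euc N) : radPlateau r R x =
    (1 - cut R x) * ∑ i, x i * pd i (cut r) x - cut r x * ∑ i, x i * pd i (cut R) x := by
  have hd : ∀ s, DifferentiableAt ℝ (cut s : Euc N → ℝ) x := fun s =>
    (contDiff_cut s (n := 1)).differentiable (by norm_num) x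
  have e : ∀ i, pd i (plateau r R) x =
      - (cut r x * pd i (cut R) x) + (1 - cut R x) * pd i (cut r) x := fun i => by
    have e1 : (plateau r R : Euc N → ℝ) = fun y => cut r y * (1 + (-1) * cut R y) := by
      ext y; simp only [plateau]; ring
    rw [e1, pd_mul (hd r) (((hd R).const_mul _).const_add 1),
      pd_add (f := fun _ => (1 : ℝ)) (differentiableAt_const _) ((hd R).const_mul _),
      pd_const_mul _ (hd R)]
    have : pd i (fun _ : Euc N => (1 : ℝ)) x = 0 := by simp [pd]
    rw [this]
    ring
  simp_rw [radPlateau, e, Finset.mul_sum, ← Finset.sum_sub_distrib]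
  exact Finset.sum_congr rfl fun i _ => by ring

lemma exists_bound_rad_cut (N : ℕ) :
    ∃ C > 0, ∀ r > 0, ∀ x : Euc N, |∑ i, x i * pd i (cut r) x| ≤ C := by
  obtain ⟨C, hC, h⟩ := exists_bound_cut N
  refine ⟨N * C + 1, by positivity, fun r hr x => ?_⟩
  refine (Finset.abs_sum_le_sum_abs _ _).trans ?_
  have : ∀ i, |x i * pd i (cut r) x| ≤ C := fun i => by
    rcases le_or_gt ‖x‖ r with h1 | h1
    · rw [abs_mul]
      calc |x i| * |pd i (cut r) x| ≤ r * (C / r) :=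
            mul_le_mul ((abs_coord_le x i).trans h1) ((h r hr x).1 i) (abs_nonneg _) hr.le
        _ = C := by field_simp
    · rw [pd_cut_eq_zero hr (Or.inr h1), mul_zero, abs_zero]
      exact hC.le
  refine (Finset.sum_le_sum fun i _ => this i).trans ?_
  simp

lemma exists_bound_radPlateau (N : ℕ) :
    ∃ C > 0, ∀ r > 0, ∀ R > 0, ∀ x : Euc N, |radPlateau r R x| ≤ C := by
  obtain ⟨C, hC, h⟩ := exists_bound_rad_cut N
  refine ⟨2 * C, by positivity, fun r hr R hR x => ?_⟩
  rw [radPlateau_eq]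
  refine (abs_sub _ _).trans ?_
  rw [abs_mul, abs_mul, abs_of_nonneg (cut_nonneg r x),
    abs_of_nonneg (sub_nonneg.2 (cut_le_one R x))]
  have h1 := h r hr x
  have h2 := h R hR x
  have h3 := mul_le_mul (show 1 - cut R x ≤ 1 by linarith [cut_nonneg R x]) h1 (abs_nonneg _)
    zero_le_one
  have h4 := mul_le_mul (cut_le_one r x) h2 (abs_nonneg _) zero_le_one
  linarith

lemma radPlateau_eq_zero {r R : ℝ} (hr : 0 < r) (hR : 0 < R) {x : Euc N} (h1 : r < ‖x‖)
    (h2 : ‖x‖ < R / 2) : radPlateau r R x = 0 := by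
  rw [radPlateau_eq]
  simp [pd_cut_eq_zero hr (Or.inr h1), pd_cut_eq_zero hR (Or.inl h2)]

lemma continuous_radPlateau (r R : ℝ) : Continuous (radPlateau r R : Euc N → ℝ) :=
  continuous_finsetSum _ fun i _ => (EuclideanSpace.proj i : Euc N →L[ℝ] ℝ).continuous.mul
    (contDiff_pd (contDiff_plateau r R (n := 2)) i).continuous

lemma eventually_plateau {x : Euc N} (hx : x ≠ 0) : ∀ᶠ m : ℕ in atTop,
    1 / ((m : ℝ) + 1) < ‖x‖ ∧ ‖x‖ < ((m : ℝ) + 1) / 2 := by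
  have h1 := (tendsto_one_div_add_atTop_nhds_zero_nat (𝕜 := ℝ)).eventually_lt_const
    (norm_pos_iff.2 hx)
  have h2 := (tendsto_natCast_atTop_atTop (R := ℝ)).eventually_gt_atTop (2 * ‖x‖)
  filter_upwards [h1, h2] with m h3 h4
  exact ⟨h3, by linarith⟩

/-- The quadratic form comparing the truncated dilation field at two points. -/
def dilForm (φ : Euc N → ℝ) (z : Euc N × Euc N) : ℝ :=
  ∑ i, (φ z.1 * z.1 i - φ z.2 * z.2 i) * (z.1 - z.2) i

lemma dilForm_swap (φ : Euc N → ℝ) (z : Euc N × Euc N) : dilForm φ z.swap = dilForm φ z :=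
  Finset.sum_congr rfl fun i _ => by
    simp only [Prod.fst_swap, Prod.snd_swap, PiLp.sub_apply]
    ring

lemma abs_sum_mul_le (x y : Euc N) : |∑ i, x i * y i| ≤ ‖x‖ * ‖y‖ := by
  have := abs_real_inner_le_norm x y
  rw [PiLp.inner_apply] at this
  simpa [mul_comm] using this

lemma exists_bound_dilForm (N : ℕ) : ∃ C > 0, ∀ r > 0, ∀ R > 0, ∀ z : Euc N × Euc N,
    |dilForm (plateau r R) z| ≤ C * ‖z.1 - z.2‖ ^ 2 := by
  obtain ⟨C, hC, h⟩ := exists_lipschitz_cut N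
  refine ⟨2 * C + 1, by positivity, fun r hr R hR z => ?_⟩
  wlog hz : ‖z.2‖ ≤ ‖z.1‖ generalizing z
  · have := this z.swap (le_of_not_ge hz)
    rwa [dilForm_swap, Prod.fst_swap, Prod.snd_swap, norm_sub_rev] at this
  obtain ⟨x, y⟩ := z
  simp only at hz ⊢
  have hφ : |plateau r R x - plateau r R y| * ‖y‖ ≤ 2 * C * ‖x - y‖ := by
    have e : plateau r R x - plateau r R y =
        (cut r x - cut r y) * (1 - cut R x) - cut r y * (cut R x - cut R y) := by
      simp only [plateau]; ring
    have h1 := h r hr x y hz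
    have h2 := h R hR x y hz
    have h3 : |plateau r R x - plateau r R y| ≤ |cut r x - cut r y| + |cut R x - cut R y| := by
      rw [e]
      refine (abs_sub _ _).trans (add_le_add ?_ ?_)
      · rw [abs_mul, abs_of_nonneg (sub_nonneg.2 (cut_le_one R x))]
        exact mul_le_of_le_one_right (abs_nonneg _) (by linarith [cut_nonneg R x])
      · rw [abs_mul, abs_of_nonneg (cut_nonneg r y)]
        exact mul_le_of_le_one_left (abs_nonneg _) (cut_le_one r y)
    have h4 := mul_le_mul_of_nonneg_right h3 (norm_nonneg y)
    linarith
  have e : dilForm (plateau r R) (x, y) = plateau r R x * ‖x - y‖ ^ 2 +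
      (plateau r R x - plateau r R y) * ∑ i, y i * (x - y) i := by
    rw [← sum_coord_sq, dilForm, Finset.mul_sum, Finset.mul_sum, ← Finset.sum_add_distrib]
    refine Finset.sum_congr rfl fun i _ => ?_
    simp only [PiLp.sub_apply]
    ring
  rw [e]
  refine (abs_add_le _ _).trans ?_
  rw [abs_mul, abs_mul, abs_of_nonneg (plateau_nonneg r R x), abs_of_nonneg (sq_nonneg ‖x - y‖)]
  have h1 := mul_le_mul_of_nonneg_right (plateau_le_one r R x) (sq_nonneg ‖x - y‖)
  have h2 := mul_le_mul_of_nonneg_left (abs_sum_mul_le y (x - y))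
    (abs_nonneg (plateau r R x - plateau r R y))
  have h3 := mul_le_mul_of_nonneg_right hφ (norm_nonneg (x - y))
  nlinarith

lemma continuous_dilForm {φ : Euc N → ℝ} (hφ : Continuous φ) : Continuous (dilForm φ) := by
  refine continuous_finsetSum _ fun i _ => ?_
  have hc : Continuous fun x : Euc N => x i := (EuclideanSpace.proj i : Euc N →L[ℝ] ℝ).continuous
  have h1 : Continuous fun x : Euc N => φ x * x i := hφ.mul hc
  exact ((h1.comp continuous_fst).sub (h1.comp continuous_snd)).mul
    (hc.comp (continuous_fst.sub continuous_snd))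

lemma dilForm_eq {φ : Euc N → ℝ} {x y : Euc N} (hx : φ x = 1) (hy : φ y = 1) :
    dilForm φ (x, y) = ‖x - y‖ ^ 2 := by
  rw [← sum_coord_sq, dilForm]
  refine Finset.sum_congr rfl fun i _ => ?_
  simp only [hx, hy, one_mul, PiLp.sub_apply]
  ring

end Plateau

section Interaction

open Filter Topology

variable {N : ℕ} {F G φ : Euc N → ℝ}

/-- The regularised interaction kernel between two densities. -/
def pker (F G : Euc N → ℝ) (t : ℝ) (z : Euc N × Euc N) : ℝ :=
  gam N t (z.1 - z.2) * (F z.1 * G z.2)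

lemma pker_swap (F G : Euc N → ℝ) (t : ℝ) (z : Euc N × Euc N) :
    pker G F t z.swap = pker F G t z := by
  simp only [pker, Prod.fst_swap, Prod.snd_swap]
  rw [← neg_sub z.1 z.2, gam_neg]
  ring

lemma aemeasurable_pker (hF : AEMeasurable F) (hG : AEMeasurable G) (t : ℝ) :
    AEMeasurable (pker F G t) (volume.prod volume) :=
  ((measurable_gam t).comp (measurable_fst.sub measurable_snd)).aemeasurable.mul
    (hF.comp_fst.mul hG.comp_snd)

lemma ae_fst_ne_snd (hN : 3 ≤ N) :
    ∀ᵐ z : Euc N × Euc N ∂(volume.prod volume), z.1 ≠ z.2 := by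
  refine (Measure.ae_prod_iff_ae_ae
    (isClosed_diagonal (X := Euc N)).measurableSet.compl).2 ?_
  exact ae_of_all _ fun x => (ae_ne_zero hN x).mono fun y hy => hy.symm

lemma pker_le (hN : 3 ≤ N) (hF0 : ∀ x, 0 ≤ F x) (hG0 : ∀ x, 0 ≤ G x) {t : ℝ} (ht : 0 ≤ t)
    {z : Euc N × Euc N} (hz : z.1 ≠ z.2) : |pker F G t z| ≤ pker F G 0 z := by
  have h0 := mul_nonneg (hF0 z.1) (hG0 z.2)
  rw [pker, abs_of_nonneg (mul_nonneg (gam_nonneg ht _) h0)]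
  have : 0 < ‖z.1 - z.2‖ := norm_pos_iff.2 (sub_ne_zero.2 hz)
  exact mul_le_mul_of_nonneg_right (gam_anti hN (by positivity) ht) h0

lemma integrable_pker (hN : 3 ≤ N) (hF0 : ∀ x, 0 ≤ F x) (hG0 : ∀ x, 0 ≤ G x)
    (hF : AEMeasurable F) (hG : AEMeasurable G)
    (hK : Integrable (pker F G 0) (volume.prod volume)) {t : ℝ} (ht : 0 ≤ t) :
    Integrable (pker F G t) (volume.prod volume) :=
  hK.mono' (aemeasurable_pker hF hG t).aestronglyMeasurable
    ((ae_fst_ne_snd hN).mono fun _ hz => pker_le hN hF0 hG0 ht hz)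

/-- The divergence of the truncated dilation field weighted by `F`. -/
def dvg (F φ : Euc N → ℝ) (x : Euc N) : ℝ := ∑ i, pd i (fun y => F y * (y i * φ y)) x

lemma contDiff_coord_mul {n : ℕ∞} (hφ : ContDiff ℝ n φ) (i : Fin N) :
    ContDiff ℝ n fun y : Euc N => y i * φ y :=
  (EuclideanSpace.proj i : Euc N →L[ℝ] ℝ).contDiff.mul hφ

lemma contDiff_weight (hF : ContDiffOn ℝ 1 F {x | x ≠ 0}) (hφ : ContDiff ℝ 1 φ)
    (hs : tsupport φ ⊆ {x | x ≠ 0}) (i : Fin N) :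
    ContDiff ℝ 1 fun y => F y * (y i * φ y) :=
  contDiff_mul_of_tsupport isOpen_ne_zero hF
    (contDiff_coord_mul (n := 1) hφ i).contDiffOn
    ((tsupport_mul_subset_right (f := fun y : Euc N => y i)).trans hs)

lemma tsupport_weight (F φ : Euc N → ℝ) (i : Fin N) :
    tsupport (fun y => F y * (y i * φ y)) ⊆ tsupport φ :=
  (tsupport_mul_subset_right (f := F)).trans (tsupport_mul_subset_right (f := fun y : Euc N => y i))

lemma continuous_dvg (hF : ContDiffOn ℝ 1 F {x | x ≠ 0}) (hφ : ContDiff ℝ 1 φ)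
    (hs : tsupport φ ⊆ {x | x ≠ 0}) : Continuous (dvg F φ) :=
  continuous_finsetSum _ fun i _ => continuousOn_univ.1
    (continuousOn_pd isOpen_univ (contDiff_weight hF hφ hs i).contDiffOn i)

lemma tsupport_dvg (F φ : Euc N → ℝ) : tsupport (dvg F φ) ⊆ tsupport φ := by
  refine closure_minimal (fun x hx => ?_) (isClosed_tsupport _)
  by_contra hc
  refine hx (Finset.sum_eq_zero fun i _ => ?_)
  by_contra h2
  exact hc (tsupport_weight F φ i (tsupport_pd_subset _ i (subset_tsupport _ h2)))

lemma continuous_dvg_div (hF : ContDiffOn ℝ 1 F {x | x ≠ 0}) (hF0 : ∀ x, x ≠ 0 → 0 < F x)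
    (hφ : ContDiff ℝ 1 φ) (hs : tsupport φ ⊆ {x | x ≠ 0}) :
    Continuous fun x => (F x)⁻¹ * dvg F φ x :=
  continuous_mul_of_tsupport isOpen_ne_zero (hF.continuousOn.inv₀ fun x hx => (hF0 x hx).ne')
    (continuous_dvg hF hφ hs) ((tsupport_dvg F φ).trans hs)

lemma exists_bound_dvg_div (hF : ContDiffOn ℝ 1 F {x | x ≠ 0}) (hF0 : ∀ x, x ≠ 0 → 0 < F x)
    (hφ : ContDiff ℝ 1 φ) (hc : HasCompactSupport φ) (hs : tsupport φ ⊆ {x | x ≠ 0}) :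
    ∃ C, ∀ x, ‖(F x)⁻¹ * dvg F φ x‖ ≤ C := by
  have hd : HasCompactSupport (dvg F φ) :=
    hc.of_isClosed_subset (isClosed_tsupport _) (tsupport_dvg F φ)
  exact HasCompactSupport.exists_bound_of_continuous hd.mul_left (continuous_dvg_div hF hF0 hφ hs)

lemma mul_dvg_div (hF0 : ∀ x, x ≠ 0 → 0 < F x) (hs : tsupport φ ⊆ {x | x ≠ 0}) (x : Euc N) :
    F x * ((F x)⁻¹ * dvg F φ x) = dvg F φ x := by
  by_cases hx : x = 0
  · have : dvg F φ x = 0 := by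
      by_contra h
      exact hs (tsupport_dvg F φ (subset_tsupport _ h)) hx
    simp [this]
  · rw [mul_inv_cancel_left₀ (hF0 x hx).ne']

/-- One component of the truncated dilation field paired with the displacement. -/
def halfForm (φ : Euc N → ℝ) (z : Euc N × Euc N) : ℝ := ∑ i, z.1 i * φ z.1 * (z.1 - z.2) i

lemma halfForm_add_swap (φ : Euc N → ℝ) (z : Euc N × Euc N) :
    halfForm φ z + halfForm φ z.swap = dilForm φ z := by
  simp only [halfForm, dilForm, ← Finset.sum_add_distrib, Prod.fst_swap, Prod.snd_swap,
    PiLp.sub_apply]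
  exact Finset.sum_congr rfl fun i _ => by ring

lemma continuous_halfForm (hφ : Continuous φ) : Continuous (halfForm φ) := by
  refine continuous_finsetSum _ fun i _ => ?_
  have hc : Continuous fun x : Euc N => x i := (EuclideanSpace.proj i : Euc N →L[ℝ] ℝ).continuous
  exact ((hc.mul hφ).comp continuous_fst).mul (hc.comp (continuous_fst.sub continuous_snd))

lemma exists_bound_halfForm_div (hφ : Continuous φ) (hc : HasCompactSupport φ) {t : ℝ}
    (ht : 0 < t) : ∃ C, ∀ z : Euc N × Euc N, ‖halfForm φ z / (‖z.1 - z.2‖ ^ 2 + t)‖ ≤ C := by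
  obtain ⟨C, hC⟩ := HasCompactSupport.exists_bound_of_continuous (f := fun x : Euc N => ‖x‖ * φ x)
    hc.mul_left (continuous_norm.mul hφ)
  refine ⟨C * (1 + t⁻¹), fun z => ?_⟩
  have hC' := hC z.1
  have hC0 : 0 ≤ C := (norm_nonneg _).trans hC'
  have hp : 0 < ‖z.1 - z.2‖ ^ 2 + t := by positivity
  have e : halfForm φ z = φ z.1 * ∑ i, z.1 i * (z.1 - z.2) i := by
    rw [halfForm, Finset.mul_sum]
    exact Finset.sum_congr rfl fun i _ => by ring
  rw [norm_div, Real.norm_of_nonneg hp.le, div_le_iff₀ hp, e, Real.norm_eq_abs, abs_mul]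
  rw [norm_mul, norm_norm, Real.norm_eq_abs] at hC'
  have h1 := mul_le_mul_of_nonneg_left (abs_sum_mul_le z.1 (z.1 - z.2)) (abs_nonneg (φ z.1))
  have h2 := mul_le_mul_of_nonneg_right hC' (norm_nonneg (z.1 - z.2))
  have h3 : ‖z.1 - z.2‖ ≤ (1 + t⁻¹) * (‖z.1 - z.2‖ ^ 2 + t) := by
    have e3 : (1 + t⁻¹) * (‖z.1 - z.2‖ ^ 2 + t) =
        ‖z.1 - z.2‖ ^ 2 + t + t⁻¹ * ‖z.1 - z.2‖ ^ 2 + 1 := by field_simp; ring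
    have : 0 ≤ t⁻¹ * ‖z.1 - z.2‖ ^ 2 := by positivity
    rw [e3]
    nlinarith [sq_nonneg (‖z.1 - z.2‖ - 1)]
  have h4 := mul_le_mul_of_nonneg_left h3 hC0
  nlinarith

lemma integral_gam_mul_dvg (hF : ContDiffOn ℝ 1 F {x | x ≠ 0}) (hφ : ContDiff ℝ 1 φ)
    (hc : HasCompactSupport φ) (hs : tsupport φ ⊆ {x | x ≠ 0}) {t : ℝ} (ht : 0 < t) (y : Euc N) :
    ∫ x, gam N t (x - y) * dvg F φ x = ((N : ℝ) - 2) *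
      ∫ x, gam N t (x - y) * (F x * (halfForm φ (x, y) / (‖x - y‖ ^ 2 + t))) := by
  have hg : ContDiff ℝ 1 fun x : Euc N => gam N t (x - y) :=
    (contDiff_gam ht).comp (contDiff_id.sub contDiff_const)
  have hX := contDiff_weight hF hφ hs
  have hXc : ∀ i, HasCompactSupport fun y => F y * (y i * φ y) := fun i =>
    hc.of_isClosed_subset (isClosed_tsupport _) (tsupport_weight F φ i)
  have hi1 : ∀ i, Integrable fun x => gam N t (x - y) * pd i (fun y => F y * (y i * φ y)) x :=
    fun i => integrable_mul_of_tsupport isOpen_univ hg.continuous.continuousOn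
      (continuousOn_univ.1 (continuousOn_pd isOpen_univ (hX i).contDiffOn i))
      (hasCompactSupport_pd (hXc i) i) (subset_univ _)
  have hi2 : ∀ i, Integrable fun x => pd i (fun x => gam N t (x - y)) x * (F x * (x i * φ x)) :=
    fun i => integrable_mul_of_tsupport isOpen_univ (continuousOn_pd isOpen_univ hg.contDiffOn i)
      (hX i).continuous (hXc i) (subset_univ _)
  have e1 : ∀ x, gam N t (x - y) * dvg F φ x =
      ∑ i, gam N t (x - y) * pd i (fun y => F y * (y i * φ y)) x := fun x => Finset.mul_sum _ _ _
  simp_rw [e1]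
  rw [integral_finsetSum _ fun i _ => hi1 i]
  simp_rw [fun i => integral_mul_pd isOpen_univ hg.contDiffOn (hX i) (hXc i) (subset_univ _) i]
  rw [Finset.sum_neg_distrib, ← integral_finsetSum _ fun i _ => hi2 i, ← integral_neg,
    ← integral_const_mul]
  refine integral_congr_ae (ae_of_all _ fun x => ?_)
  have hp := norm_sq_add_pos ht (x - y)
  have e2 : (‖x - y‖ ^ 2 + t) ^ (-((N : ℝ) / 2)) = gam N t (x - y) / (‖x - y‖ ^ 2 + t) := by
    rw [gam, ← Real.rpow_sub_one hp.ne']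
    congr 1; ring
  simp only [halfForm, pd_sub_const, pd_gam hp, e2]
  rw [Finset.sum_div, Finset.mul_sum, Finset.mul_sum, Finset.mul_sum, ← Finset.sum_neg_distrib]
  exact Finset.sum_congr rfl fun i _ => by ring

/-- Integration by parts against the dilation field in the first variable of the kernel. -/
lemma integral_pker_dvg (hF : ContDiffOn ℝ 1 F {x | x ≠ 0}) (hF0 : ∀ x, x ≠ 0 → 0 < F x)
    (hφ : ContDiff ℝ 1 φ) (hc : HasCompactSupport φ) (hs : tsupport φ ⊆ {x | x ≠ 0}) {t : ℝ}
    (ht : 0 < t) (hK : Integrable (pker F G t) (volume.prod volume)) :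
    ∫ z, pker F G t z * ((F z.1)⁻¹ * dvg F φ z.1) ∂(volume.prod volume) = ((N : ℝ) - 2) *
      ∫ z, pker F G t z * (halfForm φ z / (‖z.1 - z.2‖ ^ 2 + t)) ∂(volume.prod volume) := by
  obtain ⟨C, hC⟩ := exists_bound_dvg_div hF hF0 hφ hc hs
  obtain ⟨C', hC'⟩ := exists_bound_halfForm_div hφ.continuous hc ht
  have i1 : Integrable (fun z => pker F G t z * ((F z.1)⁻¹ * dvg F φ z.1))
      (volume.prod volume) := hK.mul_bdd
    ((continuous_dvg_div hF hF0 hφ hs).comp continuous_fst).aestronglyMeasurable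
    (ae_of_all _ fun z => hC z.1)
  have i2 : Integrable (fun z => pker F G t z * (halfForm φ z / (‖z.1 - z.2‖ ^ 2 + t)))
      (volume.prod volume) := hK.mul_bdd
    (((continuous_halfForm hφ.continuous).div (by fun_prop)
      fun z => (norm_sq_add_pos ht (z.1 - z.2)).ne').aestronglyMeasurable)
    (ae_of_all _ hC')
  rw [integral_prod_symm _ i1, integral_prod_symm _ i2, ← integral_const_mul]
  refine integral_congr_ae (ae_of_all _ fun y => ?_)
  have e1 : ∀ x, pker F G t (x, y) * ((F x)⁻¹ * dvg F φ x) =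
      G y * (gam N t (x - y) * dvg F φ x) := fun x => by
    conv_rhs => rw [← mul_dvg_div hF0 hs x]
    simp only [pker]
    ring
  have e2 : ∀ x, pker F G t (x, y) * (halfForm φ (x, y) / (‖x - y‖ ^ 2 + t)) =
      G y * (gam N t (x - y) * (F x * (halfForm φ (x, y) / (‖x - y‖ ^ 2 + t)))) := fun x => by
    simp only [pker]
    ring
  simp only [e1, e2]
  rw [integral_const_mul, integral_const_mul, integral_gam_mul_dvg hF hφ hc hs ht y]
  ring

end Interaction

section Interaction

open Filter Topology

variable {N : ℕ} {F G φ : Euc N → ℝ}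

/-- The dilation identity for the regularised interaction energy. -/
lemma integral_pker_dil (hF : ContDiffOn ℝ 1 F {x | x ≠ 0}) (hF0 : ∀ x, x ≠ 0 → 0 < F x)
    (hG : ContDiffOn ℝ 1 G {x | x ≠ 0}) (hG0 : ∀ x, x ≠ 0 → 0 < G x)
    (hφ : ContDiff ℝ 1 φ) (hc : HasCompactSupport φ) (hs : tsupport φ ⊆ {x | x ≠ 0}) {t : ℝ}
    (ht : 0 < t) (hK : Integrable (pker F G t) (volume.prod volume)) :
    ∫ z, pker F G t z * ((F z.1)⁻¹ * dvg F φ z.1) ∂(volume.prod volume) +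
      ∫ z, pker F G t z * ((G z.2)⁻¹ * dvg G φ z.2) ∂(volume.prod volume) = ((N : ℝ) - 2) *
      ∫ z, pker F G t z * (dilForm φ z / (‖z.1 - z.2‖ ^ 2 + t)) ∂(volume.prod volume) := by
  have hK' : Integrable (pker G F t) (volume.prod volume) := by
    have := hK.swap
    refine this.congr (ae_of_all _ fun z => ?_)
    rw [Function.comp_apply, pker_swap]
  obtain ⟨C', hC'⟩ := exists_bound_halfForm_div hφ.continuous hc ht
  have hcont : Continuous fun z : Euc N × Euc N => halfForm φ z / (‖z.1 - z.2‖ ^ 2 + t) :=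
    (continuous_halfForm hφ.continuous).div (by fun_prop)
      fun z => (norm_sq_add_pos ht (z.1 - z.2)).ne'
  have i1 : Integrable (fun z => pker F G t z * (halfForm φ z / (‖z.1 - z.2‖ ^ 2 + t)))
      (volume.prod volume) := hK.mul_bdd hcont.aestronglyMeasurable (ae_of_all _ hC')
  have i2 : Integrable (fun z => pker G F t z * (halfForm φ z / (‖z.1 - z.2‖ ^ 2 + t)))
      (volume.prod volume) := hK'.mul_bdd hcont.aestronglyMeasurable (ae_of_all _ hC')
  have h1 := integral_pker_dvg hF hF0 hφ hc hs ht hK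
  have h2 := integral_pker_dvg hG hG0 hφ hc hs ht hK'
  rw [← integral_prod_swap, ← integral_prod_swap (fun z => pker G F t z * (halfForm φ z / _))] at h2
  simp only [pker_swap, Prod.fst_swap, Prod.snd_swap] at h2
  have i3 := i2.swap
  simp only [Function.comp_def, pker_swap, Prod.fst_swap, Prod.snd_swap] at i3
  rw [h1, h2, ← mul_add, ← integral_add i1 i3]
  congr 1
  refine integral_congr_ae (ae_of_all _ fun z => ?_)
  simp only [← halfForm_add_swap φ z]
  rw [norm_sub_rev z.2 z.1]
  ring

lemma tendsto_integral_pker (hN : 3 ≤ N) (hF0 : ∀ x, 0 ≤ F x) (hG0 : ∀ x, 0 ≤ G x)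
    (hF : AEMeasurable F) (hG : AEMeasurable G)
    (hK : Integrable (pker F G 0) (volume.prod volume)) {τ : ℕ → ℝ} (hτ0 : ∀ n, 0 ≤ τ n)
    (hτ : Tendsto τ atTop (𝓝 0)) {B : ℕ → Euc N × Euc N → ℝ} {B₀ : Euc N × Euc N → ℝ} {C : ℝ}
    (hB : ∀ n, AEStronglyMeasurable (B n) (volume.prod volume))
    (hC : ∀ n z, z.1 ≠ z.2 → |B n z| ≤ C)
    (hl : ∀ᵐ z ∂(volume.prod volume), z.1 ≠ z.2 → Tendsto (fun n => B n z) atTop (𝓝 (B₀ z))) :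
    Tendsto (fun n => ∫ z, pker F G (τ n) z * B n z ∂(volume.prod volume)) atTop
      (𝓝 (∫ z, pker F G 0 z * B₀ z ∂(volume.prod volume))) := by
  refine tendsto_integral_of_dominated_convergence (fun z => pker F G 0 z * C)
    (fun n => (aemeasurable_pker hF hG _).aestronglyMeasurable.mul (hB n)) (hK.mul_const C)
    (fun n => (ae_fst_ne_snd hN).mono fun z hz => ?_) ?_
  · rw [norm_mul, Real.norm_eq_abs, Real.norm_eq_abs]
    have h1 := pker_le hN hF0 hG0 (hτ0 n) hz
    exact mul_le_mul h1 (hC n z hz) (abs_nonneg _) ((abs_nonneg _).trans h1)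
  · filter_upwards [ae_fst_ne_snd hN, hl] with z hz hz2
    exact (((tendsto_gam (sub_ne_zero.2 hz)).comp hτ).mul_const _).mul (hz2 hz)

/-- The dilation identity for the interaction energy. -/
lemma integral_pker_zero_dil (hN : 3 ≤ N) (hF : ContDiffOn ℝ 1 F {x | x ≠ 0})
    (hF0 : ∀ x, x ≠ 0 → 0 < F x) (hFn : ∀ x, 0 ≤ F x)
    (hG : ContDiffOn ℝ 1 G {x | x ≠ 0}) (hG0 : ∀ x, x ≠ 0 → 0 < G x) (hGn : ∀ x, 0 ≤ G x)
    (hφ : ContDiff ℝ 1 φ) (hc : HasCompactSupport φ) (hs : tsupport φ ⊆ {x | x ≠ 0})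
    (hK : Integrable (pker F G 0) (volume.prod volume)) {L : ℝ}
    (hL : ∀ z, |dilForm φ z| ≤ L * ‖z.1 - z.2‖ ^ 2) :
    ∫ z, pker F G 0 z * ((F z.1)⁻¹ * dvg F φ z.1) ∂(volume.prod volume) +
      ∫ z, pker F G 0 z * ((G z.2)⁻¹ * dvg G φ z.2) ∂(volume.prod volume) = ((N : ℝ) - 2) *
      ∫ z, pker F G 0 z * (dilForm φ z / ‖z.1 - z.2‖ ^ 2) ∂(volume.prod volume) := by
  have mF := aemeasurable_of_continuousOn_ne_zero hN hF.continuousOn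
  have mG := aemeasurable_of_continuousOn_ne_zero hN hG.continuousOn
  obtain ⟨C, hC⟩ := exists_bound_dvg_div hF hF0 hφ hc hs
  obtain ⟨C', hC'⟩ := exists_bound_dvg_div hG hG0 hφ hc hs
  have t1 := tendsto_integral_pker hN hFn hGn mF mG hK (fun n => (eps_pos n).le) tendsto_eps
    (B := fun _ z => (F z.1)⁻¹ * dvg F φ z.1) (B₀ := fun z => (F z.1)⁻¹ * dvg F φ z.1)
    (fun _ => ((continuous_dvg_div hF hF0 hφ hs).comp continuous_fst).aestronglyMeasurable)
    (fun _ z _ => hC z.1) (ae_of_all _ fun z _ => tendsto_const_nhds)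
  have t2 := tendsto_integral_pker hN hFn hGn mF mG hK (fun n => (eps_pos n).le) tendsto_eps
    (B := fun _ z => (G z.2)⁻¹ * dvg G φ z.2) (B₀ := fun z => (G z.2)⁻¹ * dvg G φ z.2)
    (fun _ => ((continuous_dvg_div hG hG0 hφ hs).comp continuous_snd).aestronglyMeasurable)
    (fun _ z _ => hC' z.2) (ae_of_all _ fun z _ => tendsto_const_nhds)
  have t3 := tendsto_integral_pker hN hFn hGn mF mG hK (fun n => (eps_pos n).le) tendsto_eps
    (B := fun n z => dilForm φ z / (‖z.1 - z.2‖ ^ 2 + eps n))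
    (B₀ := fun z => dilForm φ z / ‖z.1 - z.2‖ ^ 2) (C := L)
    (fun n => ((continuous_dilForm hφ.continuous).div (by fun_prop)
      fun z => (norm_sq_add_pos (eps_pos n) (z.1 - z.2)).ne').aestronglyMeasurable)
    (fun n z hz => by
      have h0 : 0 < ‖z.1 - z.2‖ := norm_pos_iff.2 (sub_ne_zero.2 hz)
      have hp := norm_sq_add_pos (eps_pos n) (z.1 - z.2)
      have hL0 : 0 ≤ L := nonneg_of_mul_nonneg_left ((abs_nonneg _).trans (hL z)) (by positivity)
      rw [abs_div, abs_of_pos hp, div_le_iff₀ hp]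
      have := hL z
      have := mul_nonneg hL0 (eps_pos n).le
      linarith)
    (ae_of_all _ fun z hz => by
      have h0 : 0 < ‖z.1 - z.2‖ := norm_pos_iff.2 (sub_ne_zero.2 hz)
      have := (tendsto_eps.const_add (‖z.1 - z.2‖ ^ 2))
      rw [add_zero] at this
      exact tendsto_const_nhds.div this (by positivity))
  refine tendsto_nhds_unique (t1.add t2) ((t3.const_mul ((N : ℝ) - 2)).congr fun n => ?_)
  exact (integral_pker_dil hF hF0 hG hG0 hφ hc hs (eps_pos n)
    (integrable_pker hN hFn hGn mF mG hK (eps_pos n).le)).symm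

end Interaction

section Scaling

variable {N : ℕ} {φ : Euc N → ℝ}

lemma pd_norm_rpow (c : ℝ) {x : Euc N} (hx : x ≠ 0) (i : Fin N) :
    pd i (fun y => ‖y‖ ^ c) x * ‖x‖ ^ 2 = c * x i * ‖x‖ ^ c := by
  have hn : 0 < ‖x‖ := norm_pos_iff.2 hx
  have e : (fun y : Euc N => ‖y‖ ^ c) = fun y => (‖y‖ ^ 2) ^ (c / 2) := by
    ext y
    rw [← Real.rpow_natCast, ← Real.rpow_mul (norm_nonneg _)]
    congr 1; push_cast; ring
  have hp : 0 < ‖x‖ ^ 2 := by positivity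
  have hd := Real.hasDerivAt_rpow_const (x := ‖x‖ ^ 2) (p := c / 2) (Or.inl hp.ne')
  rw [congrFun e x, e, pd_radial (g := fun s => s ^ (c / 2)) hd.differentiableAt, hd.deriv,
    Real.rpow_sub_one hp.ne']
  field_simp

lemma contDiffOn_norm_rpow (c : ℝ) : ContDiffOn ℝ 1 (fun x : Euc N => ‖x‖ ^ c) {x | x ≠ 0} :=
  fun _ hx => ((contDiffAt_norm ℝ hx).rpow_const_of_ne
    (norm_ne_zero_iff.2 hx)).contDiffWithinAt

lemma dvg_norm_rpow (c : ℝ) (hφ : ContDiff ℝ 1 φ) {x : Euc N} (hx : x ≠ 0) :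
    dvg (fun y => ‖y‖ ^ c) φ x =
      ‖x‖ ^ c * (((N : ℝ) + c) * φ x + ∑ i, x i * pd i φ x) := by
  have hn : 0 < ‖x‖ := norm_pos_iff.2 hx
  have hdφ : DifferentiableAt ℝ φ x := hφ.differentiable (by norm_num) x
  have hd1 : DifferentiableAt ℝ (fun y : Euc N => ‖y‖ ^ c) x :=
    ((contDiffOn_norm_rpow c).contDiffAt (isOpen_ne_zero.mem_nhds hx)).differentiableAt
      (by norm_num)
  have e : ∀ i, pd i (fun y => ‖y‖ ^ c * (y i * φ y)) x =
      ‖x‖ ^ c * (x i * pd i φ x) + ‖x‖ ^ c * φ x + c * ‖x‖ ^ c * φ x / ‖x‖ ^ 2 * x i ^ 2 := by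
    intro i
    have h1 : pd i (fun y : Euc N => ‖y‖ ^ c) x = c * x i * ‖x‖ ^ c / ‖x‖ ^ 2 := by
      rw [eq_div_iff (by positivity), pd_norm_rpow c hx]
    have hd2 : DifferentiableAt ℝ (fun y : Euc N => y i * φ y) x :=
      (differentiableAt_coord i x).mul hdφ
    rw [pd_mul hd1 hd2,
      pd_mul (differentiableAt_coord i x) hdφ, pd_coord, h1]
    field_simp
  rw [dvg, Finset.sum_congr rfl fun i _ => e i, Finset.sum_add_distrib, Finset.sum_add_distrib,
    ← Finset.mul_sum, ← Finset.mul_sum (s := Finset.univ) (f := fun i => x i ^ 2), sum_coord_sq]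
  simp only [Finset.sum_const, Finset.card_univ, Fintype.card_fin, nsmul_eq_mul]
  field_simp
  ring

end Scaling

namespace HLERep

open Filter Topology

variable {N : ℕ} {p q a b : ℝ} {u v φ : Euc N → ℝ}

lemma src_C1 (h : HLERep N p q a b u v) : ContDiffOn ℝ 1 (src a p v) {x | x ≠ 0} :=
  h.src_C2.of_le (by norm_num)

lemma integrable_pker_src (h : HLERep N p q a b u v)
    (hE : Integrable fun x => src a p v x * v x) :
    Integrable (pker (src a p v) (src b q u) 0) (volume.prod volume) := by
  have hin : ∀ x, Integrable fun y => pker (src a p v) (src b q u) 0 (x, y) := fun x => by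
    refine ((h.symm.integrable x).const_mul (src a p v x)).congr (ae_of_all _ fun y => ?_)
    simp only [pker]
    ring
  refine (integrable_prod_iff
    (aemeasurable_pker h.src_aemeas h.symm.src_aemeas 0).aestronglyMeasurable).2
      ⟨ae_of_all _ hin, (hE.const_mul (kap N)).congr (ae_of_all _ fun x => ?_)⟩
  have e : ∀ y, ‖pker (src a p v) (src b q u) 0 (x, y)‖ =
      src a p v x * (gam N 0 (x - y) * src b q u y) := fun y => by
    rw [pker, Real.norm_of_nonneg (mul_nonneg (gam_nonneg le_rfl _)
      (mul_nonneg (h.src_nn _) (h.symm.src_nn _)))]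
    ring
  simp only [e]
  rw [integral_const_mul, h.symm.integral_eq]
  ring

/-- Integrating the kernel against a function of the first variable. -/
lemma integral_pker_src_mul (h : HLERep N p q a b u v)
    (hK : Integrable (pker (src a p v) (src b q u) 0) (volume.prod volume)) {B : Euc N → ℝ}
    (hB : Continuous B) {C : ℝ} (hC : ∀ x, ‖B x‖ ≤ C) :
    ∫ z, pker (src a p v) (src b q u) 0 z * B z.1 ∂(volume.prod volume) =
      kap N * ∫ x, src a p v x * B x * v x := by
  have hi : Integrable (fun z => pker (src a p v) (src b q u) 0 z * B z.1)
      (volume.prod volume) := hK.mul_bdd (hB.comp continuous_fst).aestronglyMeasurable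
    (ae_of_all _ fun z => hC z.1)
  rw [integral_prod _ hi, ← integral_const_mul]
  refine integral_congr_ae (ae_of_all _ fun x => ?_)
  have e : ∀ y, pker (src a p v) (src b q u) 0 (x, y) * B x =
      src a p v x * B x * (gam N 0 (x - y) * src b q u y) := fun y => by
    simp only [pker]
    ring
  simp only [e]
  rw [integral_const_mul, h.symm.integral_eq]
  ring

lemma integral_dvg_mul (h : HLERep N p q a b u v) (hφ : ContDiff ℝ 1 φ)
    (hc : HasCompactSupport φ) (hs : tsupport φ ⊆ {x | x ≠ 0}) :
    ∫ x, dvg (src a p v) φ x * v x =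
      (p + 1)⁻¹ * ∫ x, src a p v x * v x * (((N : ℝ) + a) * φ x + ∑ i, x i * pd i φ x) := by
  have hp := h.hp
  have v1 : ContDiffOn ℝ 1 v {x | x ≠ 0} := h.v_C2.of_le (by norm_num)
  have w1 : ContDiffOn ℝ 1 (fun x => v x ^ (p + 1)) {x | x ≠ 0} :=
    v1.rpow_const_of_ne fun x _ => (h.v_pos x).ne'
  have hX := contDiff_weight h.src_C1 hφ hs
  have hXc : ∀ i, HasCompactSupport fun y => src a p v y * (y i * φ y) := fun i =>
    hc.of_isClosed_subset (isClosed_tsupport _) (tsupport_weight _ φ i)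
  have hXs : ∀ i, tsupport (fun y => src a p v y * (y i * φ y)) ⊆ {x | x ≠ 0} := fun i =>
    (tsupport_weight _ φ i).trans hs
  have hY := contDiff_weight (contDiffOn_norm_rpow a) hφ hs
  have hYc : ∀ i, HasCompactSupport fun y => ‖y‖ ^ a * (y i * φ y) := fun i =>
    hc.of_isClosed_subset (isClosed_tsupport _) (tsupport_weight (fun y => ‖y‖ ^ a) φ i)
  have hYs : ∀ i, tsupport (fun y => ‖y‖ ^ a * (y i * φ y)) ⊆ {x | x ≠ 0} := fun i =>
    (tsupport_weight (fun y => ‖y‖ ^ a) φ i).trans hs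
  have hpd : ∀ {g : Euc N → ℝ}, ContDiff ℝ 1 g → ∀ i, Continuous (pd i g) := fun hg i =>
    continuousOn_univ.1 (continuousOn_pd isOpen_univ hg.contDiffOn i)
  have hi1 : ∀ i, Integrable fun x => v x * pd i (fun y => src a p v y * (y i * φ y)) x :=
    fun i => integrable_mul_of_tsupport isOpen_ne_zero v1.continuousOn (hpd (hX i) i)
      (hasCompactSupport_pd (hXc i) i) ((tsupport_pd_subset _ i).trans (hXs i))
  have hi2 : ∀ i, Integrable fun x =>
      v x ^ (p + 1) * pd i (fun y => ‖y‖ ^ a * (y i * φ y)) x :=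
    fun i => integrable_mul_of_tsupport isOpen_ne_zero w1.continuousOn (hpd (hY i) i)
      (hasCompactSupport_pd (hYc i) i) ((tsupport_pd_subset _ i).trans (hYs i))
  have key : ∀ i, ∫ x, v x * pd i (fun y => src a p v y * (y i * φ y)) x =
      (p + 1)⁻¹ * ∫ x, v x ^ (p + 1) * pd i (fun y => ‖y‖ ^ a * (y i * φ y)) x := by
    intro i
    rw [integral_mul_pd isOpen_ne_zero v1 (hX i) (hXc i) (hXs i),
      integral_mul_pd isOpen_ne_zero w1 (hY i) (hYc i) (hYs i), mul_neg, ← integral_const_mul]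
    congr 1
    refine integral_congr_ae ((ae_ne_zero h.hN 0).mono fun x hx => ?_)
    have hd : DifferentiableAt ℝ v x :=
      (v1.contDiffAt (isOpen_ne_zero.mem_nhds hx)).differentiableAt (by norm_num)
    have hr := Real.hasDerivAt_rpow_const (x := v x) (p := p + 1) (Or.inl (h.v_pos x).ne')
    simp only
    rw [pd_comp (h := fun s => s ^ (p + 1)) hr.differentiableAt hd, hr.deriv, src,
      add_sub_cancel_right]
    field_simp
  have e1 : ∀ x, dvg (src a p v) φ x * v x =
      ∑ i, v x * pd i (fun y => src a p v y * (y i * φ y)) x := fun x => by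
    rw [dvg, mul_comm, Finset.mul_sum]
  simp_rw [e1]
  rw [integral_finsetSum _ fun i _ => hi1 i, Finset.sum_congr rfl fun i _ => key i,
    ← Finset.mul_sum, ← integral_finsetSum _ fun i _ => hi2 i]
  congr 1
  refine integral_congr_ae ((ae_ne_zero h.hN 0).mono fun x hx => ?_)
  simp only
  rw [← Finset.mul_sum]
  have e2 := dvg_norm_rpow a hφ hx
  rw [dvg] at e2
  rw [e2, src, Real.rpow_add_one (h.v_pos x).ne']
  ring

lemma integral_pker_dvg_eq (h : HLERep N p q a b u v)
    (hK : Integrable (pker (src a p v) (src b q u) 0) (volume.prod volume))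
    (hφ : ContDiff ℝ 1 φ) (hc : HasCompactSupport φ) (hs : tsupport φ ⊆ {x | x ≠ 0}) :
    ∫ z, pker (src a p v) (src b q u) 0 z * ((src a p v z.1)⁻¹ * dvg (src a p v) φ z.1)
        ∂(volume.prod volume) =
      kap N * ((p + 1)⁻¹ *
        ∫ x, src a p v x * v x * (((N : ℝ) + a) * φ x + ∑ i, x i * pd i φ x)) := by
  have hF0 : ∀ x, x ≠ 0 → 0 < src a p v x := fun x hx => src_pos h.v_pos hx
  obtain ⟨C, hC⟩ := exists_bound_dvg_div h.src_C1 hF0 hφ hc hs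
  rw [h.integral_pker_src_mul hK (continuous_dvg_div h.src_C1 hF0 hφ hs) hC,
    ← h.integral_dvg_mul hφ hc hs]
  simp_rw [mul_dvg_div hF0 hs]

lemma tendsto_integral_energy_plateau (h : HLERep N p q a b u v)
    (hE : Integrable fun x => src a p v x * v x) :
    Tendsto (fun m : ℕ => ∫ x, src a p v x * v x *
        (((N : ℝ) + a) * plateau (1 / ((m : ℝ) + 1)) ((m : ℝ) + 1) x +
          ∑ i, x i * pd i (plateau (1 / ((m : ℝ) + 1)) ((m : ℝ) + 1)) x)) atTop
      (𝓝 (((N : ℝ) + a) * ∫ x, src a p v x * v x)) := by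
  obtain ⟨C, hC, hb⟩ := exists_bound_radPlateau N
  rw [← integral_const_mul]
  refine tendsto_integral_of_dominated_convergence
    (fun x => src a p v x * v x * (|(N : ℝ) + a| + C)) (fun m => ?_) (hE.mul_const _)
    (fun m => ae_of_all _ fun x => ?_) ((ae_ne_zero h.hN 0).mono fun x hx => ?_)
  · refine hE.aestronglyMeasurable.mul (Continuous.aestronglyMeasurable ?_)
    exact (continuous_const.mul (contDiff_plateau _ _ (n := 0)).continuous).add
      (continuous_radPlateau _ _)
  · rw [norm_mul, Real.norm_of_nonneg (h.energy_nonneg x), Real.norm_eq_abs]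
    refine mul_le_mul_of_nonneg_left ((abs_add_le _ _).trans (add_le_add ?_ ?_))
      (h.energy_nonneg x)
    · rw [abs_mul, abs_of_nonneg (plateau_nonneg _ _ x)]
      exact mul_le_of_le_one_right (abs_nonneg _) (plateau_le_one _ _ x)
    · exact hb _ (by positivity) _ (by positivity) x
  · refine tendsto_const_nhds.congr' ((eventually_plateau hx).mono fun m hm => ?_)
    have h1 := radPlateau_eq_zero (x := x) (by positivity) (by positivity) hm.1 hm.2
    rw [radPlateau] at h1
    simp only
    rw [h1, plateau_eq_one (by positivity) (by positivity) hm.1.le hm.2.le]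
    ring

/-- The Pohozaev identity for solutions of finite energy. -/
theorem pohozaev (h : HLERep N p q a b u v) (hE : Integrable fun x => src a p v x * v x) :
    ((N : ℝ) + a) / (p + 1) + ((N : ℝ) + b) / (q + 1) = (N : ℝ) - 2 := by
  have hκ := h.kap_pos
  have hK := h.integrable_pker_src hE
  have hF0 : ∀ x, x ≠ 0 → 0 < src a p v x := fun x hx => src_pos h.v_pos hx
  have hG0 : ∀ x, x ≠ 0 → 0 < src b q u x := fun x hx => src_pos h.u_pos hx
  have hK' : Integrable (pker (src b q u) (src a p v) 0) (volume.prod volume) :=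
    hK.swap.congr (ae_of_all _ fun z => by rw [Function.comp_apply, pker_swap])
  have hin : ∀ x, ∫ y, pker (src b q u) (src a p v) 0 (x, y) =
      kap N * (src b q u x * u x) := fun x => by
    have e : ∀ y, pker (src b q u) (src a p v) 0 (x, y) =
        src b q u x * (gam N 0 (x - y) * src a p v y) := fun y => by
      simp only [pker]
      ring
    simp only [e]
    rw [integral_const_mul, h.integral_eq]
    ring
  have hE' : Integrable fun x => src b q u x * u x := by
    have := hK'.integral_prod_left.const_mul (kap N)⁻¹
    refine this.congr (ae_of_all _ fun x => ?_)
    simp only [hin]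
    rw [inv_mul_cancel_left₀ hκ.ne']
  set E := ∫ x, src a p v x * v x with hEdef
  have e1 : ∫ z, pker (src a p v) (src b q u) 0 z ∂(volume.prod volume) = kap N * E := by
    have := h.integral_pker_src_mul hK (B := fun _ => 1) continuous_const (C := 1) (by simp)
    simpa using this
  have e2 : ∫ x, src b q u x * u x = E := by
    have h1 := h.symm.integral_pker_src_mul hK' (B := fun _ => 1) continuous_const (C := 1)
      (by simp)
    simp only [mul_one] at h1
    rw [← integral_prod_swap] at h1
    simp only [pker_swap] at h1
    rw [e1] at h1
    exact (mul_left_cancel₀ hκ.ne' h1).symm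
  have hE0 : 0 < E := by
    rw [hEdef, integral_pos_iff_support_of_nonneg h.energy_nonneg hE]
    have : {x : Euc N | x ≠ 0} ⊆ Function.support fun x => src a p v x * v x := fun x hx =>
      (mul_pos (hF0 x hx) (h.v_pos x)).ne'
    refine lt_of_lt_of_le ?_ (measure_mono this)
    have hne : Nonempty (Fin N) := ⟨⟨0, by have := h.hN; omega⟩⟩
    exact isOpen_ne_zero.measure_pos volume (exists_ne (0 : Euc N))
  obtain ⟨L, hL, hd⟩ := exists_bound_dilForm N
  have t1 := (h.tendsto_integral_energy_plateau hE).const_mul (p + 1)⁻¹ |>.const_mul (kap N)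
  have t2 := (h.symm.tendsto_integral_energy_plateau hE').const_mul (q + 1)⁻¹
    |>.const_mul (kap N)
  have t3 : Tendsto (fun m : ℕ => ∫ z, pker (src a p v) (src b q u) 0 z *
      (dilForm (plateau (1 / ((m : ℝ) + 1)) ((m : ℝ) + 1)) z / ‖z.1 - z.2‖ ^ 2)
        ∂(volume.prod volume)) atTop
      (𝓝 (∫ z, pker (src a p v) (src b q u) 0 z * 1 ∂(volume.prod volume))) := by
    refine tendsto_integral_pker h.hN h.src_nn h.symm.src_nn h.src_aemeas h.symm.src_aemeas hK
      (τ := fun _ => 0) (fun _ => le_rfl) tendsto_const_nhds (C := L) (B₀ := fun _ => 1)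
      (fun m => ?_) (fun m z hz => ?_) ?_
    · exact (((continuous_dilForm (contDiff_plateau _ _ (n := 0)).continuous).measurable).div
        (by fun_prop)).aestronglyMeasurable
    · have h0 : 0 < ‖z.1 - z.2‖ := norm_pos_iff.2 (sub_ne_zero.2 hz)
      rw [abs_div, abs_of_nonneg (sq_nonneg ‖z.1 - z.2‖), div_le_iff₀ (by positivity)]
      exact hd _ (by positivity) _ (by positivity) z
    · have hz1 : ∀ᵐ z : Euc N × Euc N ∂(volume.prod volume), z.1 ≠ 0 :=
        Measure.quasiMeasurePreserving_fst.ae (ae_ne_zero h.hN 0)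
      have hz2 : ∀ᵐ z : Euc N × Euc N ∂(volume.prod volume), z.2 ≠ 0 :=
        Measure.quasiMeasurePreserving_snd.ae (ae_ne_zero h.hN 0)
      filter_upwards [hz1, hz2] with z h1 h2 hz
      have h0 : 0 < ‖z.1 - z.2‖ := norm_pos_iff.2 (sub_ne_zero.2 hz)
      refine tendsto_const_nhds.congr' ?_
      filter_upwards [eventually_plateau h1, eventually_plateau h2] with m hm1 hm2
      rw [show z = (z.1, z.2) from rfl, dilForm_eq
        (plateau_eq_one (by positivity) (by positivity) hm1.1.le hm1.2.le)
        (plateau_eq_one (by positivity) (by positivity) hm2.1.le hm2.2.le), div_self (by positivity)]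
  simp only [mul_one] at t3
  rw [e1] at t3
  rw [e2] at t2
  have hlim := tendsto_nhds_unique (t1.add t2) ((t3.const_mul ((N : ℝ) - 2)).congr fun m => ?_)
  · have hp := h.hp
    have hq := h.hq
    have hne : kap N * E ≠ 0 := (mul_pos hκ hE0).ne'
    have : (((N : ℝ) + a) / (p + 1) + ((N : ℝ) + b) / (q + 1)) * (kap N * E) =
        ((N : ℝ) - 2) * (kap N * E) := by
      rw [← hlim, ← hEdef]
      field_simp
    exact mul_right_cancel₀ hne this
  · have hr : (0 : ℝ) < 1 / ((m : ℝ) + 1) := by positivity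
    have hR : (0 : ℝ) < (m : ℝ) + 1 := by positivity
    have hφ := contDiff_plateau (N := N) (1 / ((m : ℝ) + 1)) ((m : ℝ) + 1) (n := 1)
    have hc := hasCompactSupport_plateau (N := N) hr hR
    have hs := tsupport_plateau_subset_ne_zero (N := N) hr hR
    have h3 := integral_pker_zero_dil h.hN h.src_C1 hF0 h.src_nn h.symm.src_C1 hG0 h.symm.src_nn
      hφ hc hs hK (hd _ hr _ hR)
    have h4 := h.symm.integral_pker_dvg_eq hK' hφ hc hs
    rw [← integral_prod_swap] at h4
    simp only [pker_swap, Prod.fst_swap] at h4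
    rw [← h3, h4, h.integral_pker_dvg_eq hK hφ hc hs]

end HLERep

/-- Stability outside a compact set gives stability on all large annuli. -/
lemma HLEStableOutside.exists_annulus {N : ℕ} {p q a b : ℝ} {u v : Euc N → ℝ} {K : Set (Euc N)}
    (h : HLEStableOutside p q a b u v K) : ∃ R₀ : ℝ, ∀ R, 0 < R → R₀ ≤ R →
      HLEStableOn p q a b u v {x | R / 4 < ‖x‖ ∧ ‖x‖ < 4 * R} := by
  obtain ⟨hK, hst⟩ := h
  obtain ⟨ρ, hρ⟩ := hK.isBounded.subset_closedBall 0
  refine ⟨4 * (ρ + 1), fun R hR hRR => ?_⟩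
  have hcl : closure {x : Euc N | R / 4 < ‖x‖ ∧ ‖x‖ < 4 * R} ⊆
      {x | R / 4 ≤ ‖x‖ ∧ ‖x‖ ≤ 4 * R} :=
    closure_minimal (fun x hx => ⟨hx.1.le, hx.2.le⟩)
      ((isClosed_le continuous_const continuous_norm).inter
        (isClosed_le continuous_norm continuous_const))
  refine hst _ ((isOpen_lt continuous_const continuous_norm).inter
    (isOpen_lt continuous_norm continuous_const)) ?_ fun x hx hxK => ?_
  · exact (isCompact_closedBall (0 : Euc N) (4 * R)).of_isClosed_subset isClosed_closure
      fun x hx => mem_closedBall_zero_iff.2 (hcl hx).2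
  · have h1 := mem_closedBall_zero_iff.1 (hρ hxK)
    have h2 := (hcl hx).1
    linarith

/-- Theorem 1.10 (iii): in the supercritical case with `0 ≤ a - b ≤ (N-2)(p-q)`, if the
Lane–Emden system has no bounded positive smooth solution stable in every bounded open set,
then the Hénon–Lane–Emden system has no positive solution which is stable outside a compact
set and has `u ∈ L^{N/α̃}`. -/
theorem stmt_10 (N : ℕ) (hN : 3 ≤ N) (p q a b : ℝ)
    (hq : 0 < q) (hqp : q ≤ p) (hpq : 1 < p * q)
    (ha : -2 < a) (hb : -2 < b)
    (hsup : ((N : ℝ) + a) / (p + 1) + ((N : ℝ) + b) / (q + 1) < (N : ℝ) - 2)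
    (hab : 0 ≤ a - b ∧ a - b ≤ ((N : ℝ) - 2) * (p - q))
    (hLE : ¬ ∃ u v : Euc N → ℝ, ContDiff ℝ (⊤ : ℕ∞) u ∧ ContDiff ℝ (⊤ : ℕ∞) v ∧
        (∀ x, 0 < u x) ∧ (∀ x, 0 < v x) ∧
        (∃ M : ℝ, ∀ x, u x ≤ M ∧ v x ≤ M) ∧ IsLESol p q u v ∧
        ∀ Ω : Set (Euc N), IsOpen Ω → Bornology.IsBounded Ω → LEStableOn p q u v Ω) :
    ¬ ∃ (u v : Euc N → ℝ) (K : Set (Euc N)),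
        IsHLESol p q a b u v ∧ (∀ x, 0 < u x) ∧ (∀ x, 0 < v x) ∧
        HLEStableOutside p q a b u v K ∧
        (∫⁻ x : Euc N, ENNReal.ofReal
            (u x ^ ((N : ℝ) / ((2 * (p + 1) + a + p * b) / (p * q - 1))))) < ⊤ := by
  rintro ⟨u, v, K, hsol, hu, hv, hst, hint⟩
  have hN3 : (3 : ℝ) ≤ N := by exact_mod_cast hN
  have hp0 : 0 < p := hq.trans_le hqp
  have hp1 : 1 < p := by nlinarith
  have hd : 0 < p * q - 1 := by linarith
  obtain ⟨α, hα⟩ : ∃ α, α = (2 * (p + 1) + a + p * b) / (p * q - 1) := ⟨_, rfl⟩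
  obtain ⟨β, hβ⟩ : ∃ β, β = (2 * (q + 1) + b + q * a) / (p * q - 1) := ⟨_, rfl⟩
  rw [← hα] at hint
  have hα0 : 0 < α := by
    rw [hα]
    refine div_pos ?_ hd
    nlinarith
  have hβ0 : 0 < β := by
    rw [hβ]
    refine div_pos ?_ hd
    nlinarith
  have hpβ : p * β = α + 2 + a := by
    rw [hα, hβ]
    field_simp
    ring
  have hqα : q * α = β + 2 + b := by
    rw [hα, hβ, ← mul_div_assoc, div_add' _ _ _ hd.ne', div_add' _ _ _ hd.ne']
    congr 1
    ring
  obtain ⟨Θ, hΘ⟩ : ∃ Θ, Θ = (N : ℝ) - 2 - α - β := ⟨_, rfl⟩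
  have e1 : (N : ℝ) + a = Θ + (p + 1) * β := by linarith
  have e2 : (N : ℝ) + b = Θ + (q + 1) * α := by linarith
  have hΘ0 : 0 < Θ := by
    rw [e1, e2, add_div, add_div, mul_div_cancel_left₀ _ (by positivity : p + 1 ≠ 0),
      mul_div_cancel_left₀ _ (by positivity : q + 1 ≠ 0)] at hsup
    have h1 : Θ / (p + 1) + Θ / (q + 1) < Θ := by linarith
    have h2 : Θ / (p + 1) + Θ / (q + 1) = Θ * (p + q + 2) / ((p + 1) * (q + 1)) := by
      field_simp
      ring
    rw [h2, div_lt_iff₀ (by positivity)] at h1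
    nlinarith
  have hs1 : 1 ≤ (N : ℝ) / α := by
    rw [le_div_iff₀ hα0]
    linarith
  have h := hleRep_of_averages hN hp1.le hq hpq ha hb hsol hu hv hs1 hint
  have hU0 := h.tendsto_hat (by linarith) hint
  rw [show (N : ℝ) / ((N : ℝ) / α) = α by field_simp] at hU0
  obtain ⟨R₀, hR₀⟩ := hst.exists_annulus
  have hmin : Θ / (1 + q) < min ((N : ℝ) - 2 - α) (((N : ℝ) - 2 - β) / q) := by
    refine lt_min ?_ ?_
    · rw [div_lt_iff₀ (by positivity)]
      nlinarith
    · rw [div_lt_div_iff₀ (by positivity) hq]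
      nlinarith
  obtain ⟨l, hl1, hl2⟩ := exists_between hmin
  have hl0 : 0 < l := lt_trans (by positivity) hl1
  have hlA := hl2.trans_le (min_le_left _ _)
  have hlB := hl2.trans_le (min_le_right _ _)
  rw [lt_div_iff₀ hq, mul_comm] at hlB
  rw [div_lt_iff₀ (by positivity), mul_comm, hΘ] at hl1
  have hE := h.integrable_energy hα0 hβ0 hpβ hqα hl0 hlA hlB hl1 hU0 hR₀
  exact hsup.ne (h.pohozaev hE)
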